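/- Let q be a prime power, n a positive integer, and set ϑ = 2 if gcd(q, n) = 1 and ϑ = 3 otherwise. Let d be a divisor of q^n - 1 and n_0 a fixed positive integer such that every prime divisor of (q^n - 1)/d that is coprime to d is congruent to 1 modulo n_0. Let p_1, ..., p_l be the first l primes congruent to 1 modulo n_0 such that their product P_l = p_1···p_l satisfies P_l <= (q^n - 1)/d, and set S_l = Σ_{i=1}^{l} 1/p_i. If 1 - S_l - (2n-1)/q > 0 and q^{n/2 - ϑ} > 2·W(d)·( (l + 2n - 2)/(1 - S_l - (2n-1)/q) + 2 ), then there exists an element α in F_{q^n}* such that both α and α^{-1} are simultaneously primitive and 1-normal over F_q. -/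

import Mathlib

open Polynomial

noncomputable section

/-- The action `h ∘ β = Σ_i a_i β^{q^i}` of a polynomial `h = Σ_i a_i x^i` over `F_q`
on an element `β` of an extension field. -/
def polyAct {Fq F : Type*} [Field Fq] [Field F] [Algebra Fq F]
    (q : ℕ) (h : Fq[X]) (β : F) : F :=
  h.sum fun i a => algebraMap Fq F a * β ^ q ^ i

/-- `h` is the `F_q`-order of `β`: the monic divisor of `x^n - 1` of least degree
annihilating `β`. -/
def IsFqOrder {Fq F : Type*} [Field Fq] [Field F] [Algebra Fq F]
    (q n : ℕ) (h : Fq[X]) (β : F) : Prop :=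
  h.Monic ∧ h ∣ (X ^ n - 1 : Fq[X]) ∧ polyAct q h β = 0 ∧
    ∀ h' : Fq[X], h'.Monic → h' ∣ (X ^ n - 1 : Fq[X]) → polyAct q h' β = 0 →
      h.natDegree ≤ h'.natDegree

/-- `α` is `k`-normal over `F_q`: its `F_q`-order has degree `n - k`. -/
def IsKNormal (Fq : Type*) {F : Type*} [Field Fq] [Field F] [Algebra Fq F]
    (q n k : ℕ) (α : F) : Prop :=
  ∃ h : Fq[X], IsFqOrder q n h α ∧ h.natDegree = n - k

/-- `W(m)`: number of squarefree divisors of `m`. -/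
def Wnat (m : ℕ) : ℕ := (m.divisors.filter Squarefree).card

/-- More polynomials of degree less than `N` than `N` satisfy a nontrivial linear relation. -/
theorem exists_relation_of_natDegree_lt {K ι : Type*} [Field K] [Fintype ι] {N : ℕ}
    (v : ι → K[X]) (hv : ∀ i, (v i).natDegree < N) (hN : N < Fintype.card ι) :
    ∃ e : ι → K, e ≠ 0 ∧ ∑ i, C (e i) * v i = 0 := by
  let φ : (ι → K) →ₗ[K] (Fin N → K) :=
    LinearMap.pi fun k => Fintype.linearCombination K (fun i => (v i).coeff k)
  have hker : LinearMap.ker φ ≠ ⊥ := by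
    apply LinearMap.ker_ne_bot_of_finrank_lt
    simpa using hN
  obtain ⟨e, he, he0⟩ := (Submodule.ne_bot_iff _).1 hker
  refine ⟨e, he0, ?_⟩
  ext k
  rw [finsetSum_coeff, coeff_zero]
  by_cases hk : k < N
  · have := congrFun (LinearMap.mem_ker.1 he) ⟨k, hk⟩
    simpa [φ, Fintype.linearCombination_apply] using this
  · apply Finset.sum_eq_zero
    intro i _
    rw [coeff_C_mul, coeff_eq_zero_of_natDegree_lt (by have := hv i; omega), mul_zero]

/-- Nonzero polynomials of distinct degrees are linearly independent. -/
theorem sum_C_mul_ne_zero_of_injective_natDegree {K ι : Type*} [Field K] [Fintype ι]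
    (g : ι → K[X]) (hg : ∀ i, g i ≠ 0) (hinj : Function.Injective fun i => (g i).natDegree)
    (c : ι → K) (hc : c ≠ 0) : ∑ i, C (c i) * g i ≠ 0 := by
  intro h0
  have h := degree_sum_eq_of_disjoint (fun i => C (c i) * g i) Finset.univ (by
    intro i hi j hj hij heq
    have hi' : c i ≠ 0 := fun h => hi.2 (by simp [h])
    have hj' : c j ≠ 0 := fun h => hj.2 (by simp [h])
    simp only [Function.comp, degree_C_mul hi', degree_C_mul hj'] at heq
    exact hij (hinj (natDegree_eq_of_degree_eq heq)))
  rw [h0, degree_zero] at h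
  obtain ⟨i, hi⟩ := Function.ne_iff.1 hc
  have := Finset.le_sup (f := fun i => (C (c i) * g i).degree) (Finset.mem_univ i)
  rw [← h, le_bot_iff, degree_eq_bot] at this
  exact (mul_ne_zero (C_ne_zero.2 hi) (hg i)) this

set_option maxHeartbeats 1000000 in
/-- Stepanov's method: a bound for the number of solutions of `y ^ s = c - y` with
`y = Y(z) / z ^ m` among the solutions of `z ^ (s * s) = ζ z`. -/
theorem card_le_of_stepanov {E : Type*} [Field E] [IsAlgClosed E] (p e : ℕ) [hp : Fact p.Prime]
    [CharP E p] (Q D s m : ℕ) (hs : s = p ^ e) (hsQ : s = Q * D) (hm : m = (Q - 1) * D)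
    (hQ : 2 ≤ Q) (Y : E[X]) (hY : Y.natDegree = 2 * m) (c ζ : E) (B : Finset E)
    (hB : ∀ z ∈ B, z ≠ 0 ∧ z ^ (s * s) = ζ * z ∧
      (Y.eval z / z ^ m) ^ s = c - Y.eval z / z ^ m) :
    B.card ≤ D * s + 8 * Q * s := by
  classical
  have hs0 : 0 < s := hs ▸ pow_pos hp.out.pos e
  have hD : 0 < D := Nat.pos_of_ne_zero (by rintro rfl; simp [hsQ] at hs0)
  obtain ⟨R, rfl⟩ : ∃ R, Q = R + 1 := ⟨Q - 1, by omega⟩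
  have hR : 1 ≤ R := by omega
  simp only [Nat.add_sub_cancel] at hm
  have hm0 : 0 < m := by rw [hm]; positivity
  have hY0 : Y ≠ 0 := by
    rintro rfl
    simp at hY
    omega
  set U := D + 5 * (R + 1) with hU
  let ι := Fin D × Fin U × Fin (R + 1)
  let v : ι → E[X] := fun t =>
    C (ζ ^ (t.2.1 : ℕ)) * (X ^ ((t.1 : ℕ) * s + t.2.1) * (C c * X ^ m - Y) ^ (t.2.2 : ℕ) *
      X ^ (m * (R - t.2.2)))
  have hv : ∀ t, (v t).natDegree < (D - 1) * s + U + 2 * m * R := by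
    rintro ⟨i, u, j⟩
    have h1 : (C c * X ^ m - Y).natDegree ≤ 2 * m :=
      (natDegree_sub_le _ _).trans (max_le ((natDegree_C_mul_X_pow_le _ _).trans (by omega)) hY.le)
    have h2 : (v ⟨i, u, j⟩).natDegree ≤ ((i : ℕ) * s + u) + j * (2 * m) + m * (R - j) := by
      refine (natDegree_C_mul_le _ _).trans ?_
      refine natDegree_mul_le.trans (add_le_add (natDegree_mul_le.trans (add_le_add ?_ ?_)) ?_)
      · exact natDegree_X_pow_le _
      · exact natDegree_pow_le.trans (Nat.mul_le_mul_left _ h1)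
      · exact natDegree_X_pow_le _
    have hi := i.2
    have hu := u.2
    have hj : (j : ℕ) ≤ R := by omega
    have h3 : (i : ℕ) * s ≤ (D - 1) * s := Nat.mul_le_mul_right _ (by omega)
    have h4 : (j : ℕ) * (2 * m) + m * (R - j) ≤ 2 * m * R := by
      have h5 : m * (R - j) + m * j = m * R := by rw [← mul_add, Nat.sub_add_cancel hj]
      have h6 : m * (j : ℕ) ≤ m * R := Nat.mul_le_mul_left _ hj
      linarith
    omega
  have hcard : (D - 1) * s + U + 2 * m * R < Fintype.card ι := by
    simp only [ι, Fintype.card_prod, Fintype.card_fin]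
    obtain ⟨D', rfl⟩ : ∃ D', D = D' + 1 := ⟨D - 1, by omega⟩
    simp only [Nat.add_sub_cancel, hU, hm, hsQ]
    nlinarith [Nat.zero_le (D' * R), Nat.zero_le (D' * R * R), Nat.zero_le (D' * D' * R)]
  obtain ⟨e', he0, he⟩ := exists_relation_of_natDegree_lt v hv hcard
  have hroot : ∀ a : E, ∃ b : E, b ^ s = a := fun a => IsAlgClosed.exists_pow_nat_eq a hs0
  choose ρ hρ using hroot
  let g : ι → E[X] := fun t =>
    X ^ ((t.1 : ℕ) + t.2.1 * s) * X ^ (m * (R - t.2.2)) * Y ^ (t.2.2 : ℕ)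
  have hgd : ∀ t, (g t).natDegree = (t.1 : ℕ) + t.2.1 * s + m * R + m * t.2.2 := by
    rintro ⟨i, u, j⟩
    have hj : (j : ℕ) ≤ R := by omega
    simp only [g]
    rw [natDegree_mul (by simp) (pow_ne_zero _ hY0), natDegree_mul (by simp) (by simp),
      natDegree_X_pow, natDegree_X_pow, natDegree_pow, hY]
    have h5 : m * (R - j) + m * j = m * R := by rw [← mul_add, Nat.sub_add_cancel hj]
    linarith
  have hg0 : ∀ t, g t ≠ 0 := fun t => by simp [g, hY0]
  have hinj : Function.Injective fun t => (g t).natDegree := by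
    rintro ⟨i, u, j⟩ ⟨i', u', j'⟩ h
    simp only [hgd] at h
    have h' : (i : ℕ) + D * (u * (R + 1) + R * j) = i' + D * (u' * (R + 1) + R * j') := by
      rw [hsQ, hm] at h
      linarith
    have hi : (i : ℕ) = i' := by
      have := congrArg (· % D) h'
      simpa [Nat.add_mul_mod_self_left, Nat.mod_eq_of_lt i.2, Nat.mod_eq_of_lt i'.2] using this
    have h2 : (u : ℕ) * (R + 1) + R * j = u' * (R + 1) + R * j' := by
      rw [hi] at h'
      exact Nat.eq_of_mul_eq_mul_left hD (Nat.add_left_cancel h')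
    have hj : (j : ℕ) = j' := by
      have h3 : ((u + j : ℕ) : ℤ) * (R + 1) - j = (u' + j' : ℕ) * (R + 1) - j' := by
        have : ((u : ℕ) : ℤ) * (R + 1) + R * (j : ℕ) = (u' : ℕ) * (R + 1) + R * (j' : ℕ) := by
          exact_mod_cast h2
        push_cast
        linarith
      have h4 : (((u + j : ℕ) : ℤ) - (u' + j' : ℕ)) * (R + 1) = (j : ℕ) - (j' : ℕ) := by linarith
      have hjl := j.2
      have hjl' := j'.2
      have h5 : (((u + j : ℕ) : ℤ) - (u' + j' : ℕ)) = 0 := by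
        by_contra hne
        rcases lt_or_gt_of_ne hne with hlt | hgt
        · nlinarith
        · nlinarith
      rw [h5] at h4
      omega
    have hu : (u : ℕ) = u' := by
      rw [hj] at h2
      exact Nat.eq_of_mul_eq_mul_right (Nat.succ_pos R) (Nat.add_right_cancel h2)
    rw [Fin.ext hi, Fin.ext hu, Fin.ext hj]
  let G : E[X] := ∑ t, C (ρ (e' t)) * g t
  have hG0 : G ≠ 0 := by
    apply sum_C_mul_ne_zero_of_injective_natDegree g hg0 hinj
    intro h
    apply he0
    ext t
    rw [← hρ (e' t), congrFun h t]
    simp [hs0.ne']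
  have hGd : G.natDegree ≤ D * s + 8 * (R + 1) * s := by
    apply natDegree_sum_le_of_forall_le
    rintro ⟨i, u, j⟩ -
    refine (natDegree_C_mul_le _ _).trans ?_
    rw [hgd]
    dsimp only
    have hi := i.2
    have hu := u.2
    have hj : (j : ℕ) ≤ R := by omega
    have h1 : (u : ℕ) * s ≤ (U - 1) * s := Nat.mul_le_mul_right _ (by omega)
    have h2 : m * (j : ℕ) ≤ m * R := Nat.mul_le_mul_left _ hj
    have h3 : (U - 1) * s + s = U * s := by
      rw [← Nat.succ_mul]; congr 1
    have h4 : D ≤ s := by rw [hsQ]; nlinarith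
    have h5 : m ≤ s := by rw [hsQ, hm]; exact Nat.mul_le_mul_right _ (Nat.le_succ R)
    have h6 : m * R ≤ s * R := Nat.mul_le_mul_right _ h5
    have h7 : U * s = D * s + 5 * (s * R) + 5 * s := by rw [hU]; ring
    have h8 : 8 * (R + 1) * s = 8 * (s * R) + 8 * s := by ring
    linarith [Nat.zero_le (s * R)]
  have hGB : ∀ z ∈ B, G.eval z = 0 := by
    intro z hz
    obtain ⟨hz0, hz1, hz2⟩ := hB z hz
    have hY' : Y.eval z = (Y.eval z / z ^ m) * z ^ m := by field_simp
    set y := Y.eval z / z ^ m with hy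
    have : ExpChar E p := ExpChar.prime hp.out
    have key : G.eval z ^ s = z ^ (m * R * s) * (z ^ (m * R))⁻¹ *
        (∑ t, C (e' t) * v t).eval z := by
      rw [hs]
      simp only [G, eval_finsetSum]
      rw [sum_pow_char_pow, ← hs, Finset.mul_sum]
      refine Finset.sum_congr rfl ?_
      rintro ⟨i, u, j⟩ -
      have hj : (j : ℕ) ≤ R := by omega
      have h5 : m * R = m * (R - j) + m * j := by rw [← mul_add, Nat.sub_add_cancel hj]
      simp only [g, v, eval_mul, eval_C, eval_pow, eval_X, eval_sub, mul_pow, hρ]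
      rw [hY', show c * z ^ m - y * z ^ m = y ^ s * z ^ m by rw [hz2]; ring]
      have h1 : (z ^ ((i : ℕ) + u * s)) ^ s = z ^ ((i : ℕ) * s) * (ζ ^ (u : ℕ) * z ^ (u : ℕ)) := by
        rw [← mul_pow, ← hz1]; ring
      rw [h1, h5]
      generalize R - (j : ℕ) = k
      have hne : z ^ (m * k + m * j) ≠ 0 := pow_ne_zero _ hz0
      field_simp
      ring
    rw [he, eval_zero, mul_zero] at key
    exact pow_eq_zero_iff hs0.ne' |>.1 key
  calc B.card ≤ G.roots.toFinset.card := Finset.card_le_card fun z hz => by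
        rw [Multiset.mem_toFinset, mem_roots hG0]; exact hGB z hz
    _ ≤ G.roots.card := Multiset.toFinset_card_le _
    _ ≤ G.natDegree := card_roots' _
    _ ≤ _ := hGd

/-- The roots of `X ^ N - x` in an algebraically closed field in which `N` is invertible. -/
theorem card_roots_X_pow_sub_C {E : Type*} [Field E] [IsAlgClosed E] [DecidableEq E] {N : ℕ}
    (hN : (N : E) ≠ 0) {x : E} (hx : x ≠ 0) :
    (X ^ N - C x : E[X]).roots.toFinset.card = N := by
  have hsep : (X ^ N - C x : E[X]).Separable := separable_X_pow_sub_C x hN hx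
  rw [Multiset.toFinset_card_of_nodup (nodup_roots hsep),
    ← (IsAlgClosed.splits (X ^ N - C x : E[X])).natDegree_eq_card_roots, natDegree_X_pow_sub_C]

/-- Few elements of an extension of even degree have prescribed norm and
prescribed trace of `a x + b / x`. -/
theorem card_trace_norm_le {F K : Type*} [Field F] [Fintype F] [DecidableEq F] [Field K] [Fintype K]
    [DecidableEq K] [Algebra F K] (k : ℕ) (hk : Module.finrank F K = 2 * (k + 1)) {a b : F}
    (ha : a ≠ 0) (c ζ : F) :
    (Finset.univ.filter fun x : K => x ≠ 0 ∧
        Algebra.trace F K (algebraMap F K a * x + algebraMap F K b * x⁻¹) = c ∧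
        Algebra.norm F x = ζ).card * (Fintype.card F - 1) ≤
      Fintype.card F ^ k * Fintype.card F ^ (k + 1) +
        8 * Fintype.card F * Fintype.card F ^ (k + 1) := by
  classical
  obtain ⟨p, hpc⟩ := CharP.exists F
  have hp : Fact p.Prime := ⟨CharP.char_is_prime F p⟩
  obtain ⟨f, -, hf⟩ := FiniteField.card F p
  set q := Fintype.card F with hq
  have hq2 : 2 ≤ q := Fintype.one_lt_card
  let E := AlgebraicClosure K
  have : CharP K p := charP_of_injective_algebraMap (algebraMap F K).injective p
  have : CharP E p := charP_of_injective_algebraMap (algebraMap K E).injective p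
  have hExp : ExpChar E p := ExpChar.prime hp.out
  let φ : F →+* E := (algebraMap K E).comp (algebraMap F K)
  have hqE : ((q - 1 : ℕ) : E) ≠ 0 := by
    rw [Nat.cast_sub (by omega), hf, Nat.cast_pow, CharP.cast_eq_zero, zero_pow f.pos.ne']
    simp
  set s := q ^ (k + 1) with hs
  set D := q ^ k with hD
  set m := (q - 1) * D with hm
  have hsD : s = q * D := by rw [hs, hD]; ring
  have hsp : s = p ^ ((f : ℕ) * (k + 1)) := by rw [hs, hf, ← pow_mul]
  have hD0 : 0 < D := by positivity
  have hm0 : 0 < m := Nat.mul_pos (by omega) hD0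
  have hFs : ∀ u : F, φ u ^ s = φ u := fun u => by
    rw [← map_pow, hs, FiniteField.pow_card_pow]
  have hKc : Fintype.card K = s * s := by
    rw [Module.card_eq_pow_finrank (K := F), hk, hs, ← hq]; ring
  let Y : E[X] := ∑ i ∈ Finset.range (k + 1),
    (C (φ a) * X ^ (m + (q - 1) * q ^ i) + C (φ b) * X ^ (m - (q - 1) * q ^ i))
  have hle : ∀ i ∈ Finset.range (k + 1), (q - 1) * q ^ i ≤ m := fun i hi =>
    Nat.mul_le_mul_left _ (Nat.pow_le_pow_right (by omega) (by
      have := Finset.mem_range.1 hi; omega))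
  have hYd : Y.natDegree = 2 * m := by
    apply natDegree_eq_of_le_of_coeff_ne_zero
    · apply natDegree_sum_le_of_forall_le
      intro i hi
      have := hle i hi
      refine (natDegree_add_le _ _).trans (max_le ?_ ?_)
      · exact (natDegree_C_mul_X_pow_le _ _).trans (by omega)
      · exact (natDegree_C_mul_X_pow_le _ _).trans (by omega)
    · have hc : Y.coeff (2 * m) = φ a := by
        simp only [Y]
        rw [finsetSum_coeff, Finset.sum_range_succ, Finset.sum_eq_zero, zero_add]
        · have h1 : m ≠ 0 := hm0.ne'
          rw [coeff_add, coeff_C_mul_X_pow, coeff_C_mul_X_pow, if_pos (by rw [hm]; ring),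
            if_neg (by omega), add_zero]
        · intro i hi
          have h1 : (q - 1) * q ^ i < m := Nat.mul_lt_mul_of_pos_left
            (Nat.pow_lt_pow_right (by omega) (Finset.mem_range.1 hi)) (by omega)
          rw [coeff_add, coeff_C_mul_X_pow, coeff_C_mul_X_pow, if_neg (by omega),
            if_neg (by omega), add_zero]
      rw [hc]
      simpa [φ] using ha
  set A := Finset.univ.filter fun x : K => x ≠ 0 ∧
        Algebra.trace F K (algebraMap F K a * x + algebraMap F K b * x⁻¹) = c ∧
        Algebra.norm F x = ζ with hA
  let B : Finset E := A.biUnion fun x => (X ^ (q - 1) - C (algebraMap K E x) : E[X]).roots.toFinset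
  have hmem : ∀ (x : K) (z : E), z ∈ (X ^ (q - 1) - C (algebraMap K E x) : E[X]).roots.toFinset →
      z ^ (q - 1) = algebraMap K E x := by
    intro x z hz
    rw [Multiset.mem_toFinset, mem_roots (X_pow_sub_C_ne_zero (by omega) _)] at hz
    simpa [sub_eq_zero] using hz
  have hBc : B.card = A.card * (q - 1) := by
    rw [Finset.card_biUnion, Finset.sum_const_nat]
    · intro x hx
      apply card_roots_X_pow_sub_C hqE
      simpa using ((Finset.mem_filter.1 hx).2).1
    · intro x _ y _ hxy
      refine Finset.disjoint_left.2 fun z hz hz' => hxy ?_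
      exact (algebraMap K E).injective ((hmem x z hz).symm.trans (hmem y z hz'))
  rw [← hBc]
  refine card_le_of_stepanov p ((f : ℕ) * (k + 1)) q D s m hsp hsD hm hq2 Y hYd (φ c) (φ ζ) B ?_
  intro z hz
  obtain ⟨x, hxA, hzx⟩ := Finset.mem_biUnion.1 hz
  have hzx := hmem x z hzx
  obtain ⟨hx0, htr, hnorm⟩ := (Finset.mem_filter.1 hxA).2
  have hz0 : z ≠ 0 := by
    rintro rfl
    rw [zero_pow (by omega)] at hzx
    exact hx0 ((algebraMap K E).injective (by simpa using hzx.symm))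
  refine ⟨hz0, ?_, ?_⟩
  · have hdvd : q - 1 ∣ s * s - 1 := by
      have := Nat.sub_dvd_pow_sub_pow q 1 (2 * (k + 1))
      rw [one_pow] at this
      convert this using 2
      rw [hs]; ring
    have h1 : φ ζ = z ^ (s * s - 1) := by
      have h2 := FiniteField.algebraMap_norm_eq_pow (K := F) (K' := K) (x := x)
      rw [hnorm, Nat.card_eq_fintype_card, Nat.card_eq_fintype_card, hKc, ← hq] at h2
      simp only [φ, RingHom.comp_apply]
      rw [h2, map_pow, ← hzx, ← pow_mul, Nat.mul_div_cancel' hdvd]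
    rw [h1, ← pow_succ, Nat.sub_add_cancel]
    rw [← hKc]
    exact Fintype.card_pos
  · set w := algebraMap K E x with hw
    have hw0 : w ≠ 0 := by simpa [hw] using hx0
    have hy : Y.eval z / z ^ m =
        ∑ i ∈ Finset.range (k + 1), (φ a * w ^ q ^ i + φ b * w⁻¹ ^ q ^ i) := by
      simp only [Y]
      rw [eval_finsetSum, Finset.sum_div]
      refine Finset.sum_congr rfl fun i hi => ?_
      have h1 := hle i hi
      have h2 : z ^ (m - (q - 1) * q ^ i) = z ^ m * w⁻¹ ^ q ^ i := by
        rw [← hzx, pow_sub₀ _ hz0 h1, inv_pow, ← pow_mul]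
      simp only [eval_add, eval_mul, eval_C, eval_pow, eval_X]
      rw [h2, pow_add, pow_mul z (q - 1) (q ^ i), hzx]
      have : z ^ m ≠ 0 := pow_ne_zero _ hz0
      rw [div_eq_iff this]; ring
    have hys : (Y.eval z / z ^ m) ^ s =
        ∑ i ∈ Finset.range (k + 1), (φ a * w ^ q ^ (k + 1 + i) + φ b * w⁻¹ ^ q ^ (k + 1 + i)) := by
      rw [hy, hsp, sum_pow_char_pow]
      refine Finset.sum_congr rfl fun i hi => ?_
      rw [add_pow_char_pow, mul_pow, mul_pow, ← hsp, hFs, hFs, ← pow_mul, ← pow_mul,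
        pow_add q (k + 1) i, ← hs, mul_comm s]
    rw [eq_sub_iff_add_eq, add_comm, hys, hy, ← Finset.sum_range_add, ← two_mul, ← htr]
    simp only [φ, RingHom.comp_apply]
    rw [FiniteField.algebraMap_trace_eq_sum_pow, map_sum, hk]
    refine Finset.sum_congr rfl fun i _ => ?_
    rw [Nat.card_eq_fintype_card, ← hq]
    have hFq : ∀ u : F, algebraMap F K u ^ q ^ i = algebraMap F K u := fun u => by
      rw [← map_pow, FiniteField.pow_card_pow]
    have hadd : ∀ u v : K, (u + v) ^ q ^ i = u ^ q ^ i + v ^ q ^ i := fun u v => by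
      have : ExpChar K p := ExpChar.prime hp.out
      rw [hf, ← pow_mul, add_pow_char_pow]
    rw [hadd, mul_pow, mul_pow, hFq, hFq]
    simp [hw]

/-- The Kloosterman sum of `a x + b / x` twisted by the multiplicative character `χ`. -/
noncomputable def kloostermanSum {F : Type*} [Field F] [Fintype F] (χ : MulChar F ℂ)
    (ψ : AddChar F ℂ) (a b : F) : ℂ :=
  ∑ x : F, χ x * ψ (a * x + b * x⁻¹)

/-- The lift of a multiplicative character along the norm. -/
noncomputable def normChar {F K : Type*} [Field F] [Field K] [Algebra F K] [FiniteDimensional F K]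
    (χ : MulChar F ℂ) : MulChar K ℂ where
  toMonoidHom := χ.toMonoidHom.comp (Algebra.norm F)
  map_nonunit' x hx := by
    have hx0 : x = 0 := by
      by_contra h
      exact hx (isUnit_iff_ne_zero.2 h)
    subst hx0
    change χ (Algebra.norm F (0 : K)) = 0
    rw [Algebra.norm_zero]
    exact χ.map_zero

theorem normChar_apply {F K : Type*} [Field F] [Field K] [Algebra F K] [FiniteDimensional F K]
    (χ : MulChar F ℂ) (x : K) : normChar (K := K) χ x = χ (Algebra.norm F x) := rfl

/-- The lift of an additive character along the trace. -/
noncomputable def traceChar {F K : Type*} [Field F] [Field K] [Algebra F K]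
    (ψ : AddChar F ℂ) : AddChar K ℂ :=
  ψ.compAddMonoidHom (Algebra.trace F K).toAddMonoidHom

theorem traceChar_apply {F K : Type*} [Field F] [Field K] [Algebra F K]
    (ψ : AddChar F ℂ) (x : K) : traceChar (K := K) ψ x = ψ (Algebra.trace F K x) := rfl

theorem traceChar_ne_one {F K : Type*} [Field F] [Field K] [Fintype K] [Algebra F K] [Finite F]
    {ψ : AddChar F ℂ} (hψ : ψ ≠ 1) : traceChar (K := K) ψ ≠ 1 := by
  obtain ⟨t, ht⟩ := AddChar.ne_one_iff.1 hψ
  obtain ⟨x, rfl⟩ := Algebra.trace_surjective F K t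
  exact AddChar.ne_one_iff.2 ⟨x, by rwa [traceChar_apply]⟩

theorem norm_addChar_apply {F : Type*} [Field F] [Finite F] (ψ : AddChar F ℂ) (x : F) :
    ‖ψ x‖ = 1 := AddChar.norm_apply ψ x

theorem norm_mulChar_apply_le {F : Type*} [Field F] [Fintype F] (χ : MulChar F ℂ) (x : F) :
    ‖χ x‖ ≤ 1 := by
  by_cases hx : x = 0
  · rw [hx, χ.map_zero, norm_zero]; exact zero_le_one
  · have h : χ x ^ (Fintype.card F - 1) = 1 := by
      rw [← map_pow, FiniteField.pow_card_sub_one_eq_one x hx, map_one]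
    exact (Complex.norm_eq_one_of_pow_eq_one h
      (Nat.sub_ne_zero_of_lt Fintype.one_lt_card)).le

/-- A weak bound of the correct order of magnitude for sums over extensions of even degree. -/
theorem norm_kloostermanSum_lift_le {F K : Type*} [Field F] [Fintype F] [Field K] [Fintype K]
    [Algebra F K] (k : ℕ) (hk : Module.finrank F K = 2 * (k + 1)) {a b : F} (ha : a ≠ 0)
    (χ : MulChar F ℂ) {ψ : AddChar F ℂ} (hψ : ψ ≠ 1) :
    ‖kloostermanSum (normChar (K := K) χ) (traceChar ψ) (algebraMap F K a) (algebraMap F K b)‖ ≤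
      9 * (Fintype.card F : ℝ) ^ 2 * √(Fintype.card K) := by
  classical
  set q := Fintype.card F with hq
  have hq2 : 2 ≤ q := Fintype.one_lt_card
  set A : F → F → Finset K := fun c ζ => Finset.univ.filter fun x : K => x ≠ 0 ∧
        Algebra.trace F K (algebraMap F K a * x + algebraMap F K b * x⁻¹) = c ∧
        Algebra.norm F x = ζ with hA
  set s : ℝ := (q : ℝ) ^ (k + 1) with hs
  have hs1 : 1 ≤ s := one_le_pow₀ (by exact_mod_cast (by omega : 1 ≤ q))
  have hKc : (Fintype.card K : ℝ) = s * s := by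
    rw [Module.card_eq_pow_finrank (K := F), hk, ← hq, hs]; push_cast; ring
  have hsqrt : √(Fintype.card K) = s := by rw [hKc, Real.sqrt_mul_self (by positivity)]
  have hq0 : (0 : ℝ) < q := by positivity
  have hq1 : (0 : ℝ) < q - 1 := by
    have : (2 : ℝ) ≤ q := by exact_mod_cast hq2
    linarith
  set M : ℝ := (s * s / q + 8 * q * s) / (q - 1) with hM
  have hAM : ∀ c ζ, ((A c ζ).card : ℝ) ≤ M := by
    intro c ζ
    rw [hM, le_div_iff₀ hq1]
    have h := card_trace_norm_le (K := K) (b := b) k hk ha c ζ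
    rw [← hq] at h
    have h' : ((A c ζ).card : ℝ) * ((q - 1 : ℕ) : ℝ) ≤
        q ^ k * q ^ (k + 1) + 8 * q * q ^ (k + 1) := by
      exact_mod_cast h
    rw [Nat.cast_sub (by omega), Nat.cast_one] at h'
    refine h'.trans (le_of_eq ?_)
    rw [hs]
    field_simp
    ring
  have hsum : ∑ c : F, ∑ ζ : F, (if ζ = 0 then (0 : ℝ) else (A c ζ).card) = s * s - 1 := by
    have h1 : ∀ c ζ, (if ζ = 0 then (0 : ℝ) else (A c ζ).card) = (A c ζ).card := by
      intro c ζ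
      split_ifs with h
      · rw [eq_comm, Nat.cast_eq_zero, Finset.card_eq_zero, Finset.filter_eq_empty_iff]
        rintro x - ⟨hx, -, hn⟩
        rw [h, Algebra.norm_eq_zero_iff] at hn
        exact hx hn
      · rfl
    simp only [h1]
    rw [← hKc]
    have h2 : ∑ c : F, ∑ ζ : F, (A c ζ).card = (Finset.univ.filter fun x : K => x ≠ 0).card := by
      rw [← Finset.sum_product', Finset.card_eq_sum_card_fiberwise
        (f := fun x : K => ((Algebra.trace F K (algebraMap F K a * x + algebraMap F K b * x⁻¹),
          Algebra.norm F x) : F × F)) (t := Finset.univ ×ˢ Finset.univ) (by intro x _; simp)]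
      refine Finset.sum_congr rfl fun t _ => ?_
      rw [Finset.filter_filter]
      congr 1
      ext x
      simp [hA, Prod.ext_iff]
    have h3 : (Finset.univ.filter fun x : K => x ≠ 0).card + 1 = Fintype.card K := by
      rw [Finset.filter_ne' Finset.univ (0 : K), Finset.card_erase_add_one (Finset.mem_univ _),
        Finset.card_univ]
    rw [eq_sub_iff_add_eq, ← h3, ← h2]
    push_cast
    rfl
  have hS : kloostermanSum (normChar (K := K) χ) (traceChar ψ) (algebraMap F K a)
      (algebraMap F K b) = ∑ c : F, ∑ ζ : F, χ ζ * ψ c * ((A c ζ).card : ℂ) := by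
    have hz : ∀ x : K, x ∉ Finset.univ.filter (fun x : K => x ≠ 0) →
        normChar (K := K) χ x *
          traceChar ψ (algebraMap F K a * x + algebraMap F K b * x⁻¹) = 0 := by
      intro x hx
      have : x = 0 := by simpa using hx
      rw [this, MulChar.map_zero, zero_mul]
    rw [kloostermanSum, ← Finset.sum_subset (Finset.filter_subset _ _) (fun x _ hx => hz x hx),
      ← Finset.sum_product',
      ← Finset.sum_fiberwise_of_maps_to (t := Finset.univ ×ˢ Finset.univ)
        (g := fun x : K => ((Algebra.trace F K (algebraMap F K a * x + algebraMap F K b * x⁻¹),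
          Algebra.norm F x) : F × F)) (by intro x _; simp)]
    refine Finset.sum_congr rfl fun t _ => ?_
    have hfil : ((Finset.univ.filter fun x : K => x ≠ 0).filter fun x =>
        ((Algebra.trace F K (algebraMap F K a * x + algebraMap F K b * x⁻¹),
          Algebra.norm F x) : F × F) = t) = A t.1 t.2 := by
      rw [Finset.filter_filter]
      ext x
      simp [hA, Prod.ext_iff]
    rw [hfil, mul_comm, ← nsmul_eq_mul]
    refine Finset.sum_eq_card_nsmul fun x hx => ?_
    obtain ⟨-, h1, h2⟩ := (Finset.mem_filter.1 hx).2
    rw [normChar_apply, traceChar_apply, h1, h2]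
  have hzero : ∑ c : F, ∑ ζ : F, χ ζ * ψ c * (M : ℂ) = 0 := by
    have : ∀ c : F, ∑ ζ : F, χ ζ * ψ c * (M : ℂ) = (∑ ζ, χ ζ) * M * ψ c := fun c => by
      rw [Finset.sum_mul, Finset.sum_mul]
      exact Finset.sum_congr rfl fun _ _ => by ring
    simp only [this]
    rw [← Finset.mul_sum, AddChar.sum_eq_zero_of_ne_one hψ, mul_zero]
  have hS' : kloostermanSum (normChar (K := K) χ) (traceChar ψ) (algebraMap F K a)
      (algebraMap F K b) = - ∑ c : F, ∑ ζ : F, χ ζ * ψ c * ((M - (A c ζ).card : ℝ) : ℂ) := by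
    rw [hS, ← sub_eq_zero, sub_neg_eq_add, ← Finset.sum_add_distrib, ← hzero]
    refine Finset.sum_congr rfl fun c _ => ?_
    rw [← Finset.sum_add_distrib]
    refine Finset.sum_congr rfl fun ζ _ => ?_
    push_cast
    ring
  rw [hS', norm_neg, hsqrt]
  calc ‖∑ c : F, ∑ ζ : F, χ ζ * ψ c * ((M - (A c ζ).card : ℝ) : ℂ)‖
      ≤ ∑ c : F, ∑ ζ : F, (if ζ = 0 then 0 else M - (A c ζ).card) := by
        refine (norm_sum_le _ _).trans (Finset.sum_le_sum fun c _ => (norm_sum_le _ _).trans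
          (Finset.sum_le_sum fun ζ _ => ?_))
        split_ifs with h
        · rw [h, χ.map_zero]; simp
        · rw [norm_mul, norm_mul, norm_addChar_apply, mul_one, Complex.norm_real,
            Real.norm_of_nonneg (sub_nonneg.2 (hAM c ζ))]
          exact mul_le_of_le_one_left (sub_nonneg.2 (hAM c ζ)) (norm_mulChar_apply_le χ ζ)
    _ = (∑ c : F, ∑ ζ : F, (if ζ = 0 then 0 else M)) - (s * s - 1) := by
        rw [← hsum, ← Finset.sum_sub_distrib]
        refine Finset.sum_congr rfl fun c _ => ?_
        rw [← Finset.sum_sub_distrib]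
        refine Finset.sum_congr rfl fun ζ _ => ?_
        split_ifs <;> simp
    _ = q * ((q - 1) * M) - (s * s - 1) := by
        have : ∑ ζ : F, (if ζ = 0 then 0 else M) = (q - 1) * M := by
          rw [Finset.sum_ite, Finset.sum_const_zero, zero_add, Finset.sum_const, nsmul_eq_mul,
            Finset.filter_ne' Finset.univ (0 : F), Finset.card_erase_of_mem (Finset.mem_univ _),
            Finset.card_univ, ← hq, Nat.cast_sub (by omega), Nat.cast_one]
        rw [this, Finset.sum_const, Finset.card_univ, nsmul_eq_mul, ← hq]
    _ = 8 * q ^ 2 * s + 1 := by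
        rw [hM, mul_div_cancel₀ _ hq1.ne']
        field_simp
        ring
    _ ≤ 9 * (q : ℝ) ^ 2 * s := by
        have : (1 : ℝ) ≤ (q : ℝ) ^ 2 * s := one_le_mul_of_one_le_of_one_le
          (one_le_pow₀ (by exact_mod_cast (by omega : 1 ≤ q))) hs1
        linarith

section Quadratic

variable {F K : Type*} [Field F] [Fintype F] [Field K] [Fintype K] [Algebra F K]

theorem algebraMap_trace_of_finrank_two (hK : Module.finrank F K = 2) (x : K) :
    algebraMap F K (Algebra.trace F K x) = x + x ^ Fintype.card F := by
  rw [FiniteField.algebraMap_trace_eq_sum_pow, hK, Finset.sum_range_succ, Finset.sum_range_one,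
    Nat.card_eq_fintype_card, pow_zero, pow_one, pow_one]

theorem algebraMap_norm_of_finrank_two (hK : Module.finrank F K = 2) (x : K) :
    algebraMap F K (Algebra.norm F x) = x * x ^ Fintype.card F := by
  rw [FiniteField.algebraMap_norm_eq_prod_pow, hK, Finset.prod_range_succ, Finset.prod_range_one,
    Nat.card_eq_fintype_card, pow_zero, pow_one, pow_one]

theorem card_trace_norm_add_card_sum_prod_le [DecidableEq F] (hK : Module.finrank F K = 2)
    (t n : F) :
    (Finset.univ.filter fun x : F × F => (x.1 + x.2, x.1 * x.2) = (t, n)).card +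
      (Finset.univ.filter fun x : K =>
        (Algebra.trace F K x, Algebra.norm F x) = (t, n)).card ≤ 2 := by
  classical
  set φ := algebraMap F K with hφ
  have hFq : ∀ u : F, φ u ^ Fintype.card F = φ u := fun u => by
    rw [← map_pow, FiniteField.pow_card]
  set N₁ : Finset K := (Finset.univ.filter fun x : F × F =>
    (x.1 + x.2, x.1 * x.2) = (t, n)).image fun x => φ x.1 with hN₁
  set N₂ := Finset.univ.filter fun x : K => (Algebra.trace F K x, Algebra.norm F x) = (t, n)
    with hN₂
  have hcard : N₁.card = (Finset.univ.filter fun x : F × F =>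
      (x.1 + x.2, x.1 * x.2) = (t, n)).card := by
    refine Finset.card_image_of_injOn ?_
    rintro ⟨x, y⟩ hx ⟨x', y'⟩ hx' h
    simp only [Finset.coe_filter, Finset.mem_univ, true_and, Set.mem_ofPred_eq, Prod.mk.injEq]
      at hx hx'
    have h1 : x = x' := φ.injective h
    subst h1
    have : y = y' := by
      have := hx.1.trans hx'.1.symm
      exact add_left_cancel this
    rw [this]
  rw [← hcard]
  have h1 : ∀ y ∈ N₁, y * (φ t - y) = φ n ∧ y ^ Fintype.card F = y := by
    intro y hy
    obtain ⟨⟨x, x'⟩, hx, rfl⟩ := Finset.mem_image.1 hy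
    simp only [Finset.mem_filter, Finset.mem_univ, true_and, Prod.mk.injEq] at hx
    refine ⟨?_, hFq _⟩
    rw [← hx.1, ← hx.2]
    simp
  have h2 : ∀ y ∈ N₂, y * (φ t - y) = φ n ∧ y ^ Fintype.card F = φ t - y := by
    intro y hy
    simp only [hN₂, Finset.mem_filter, Finset.mem_univ, true_and, Prod.mk.injEq] at hy
    have ht := algebraMap_trace_of_finrank_two hK y
    have hn := algebraMap_norm_of_finrank_two hK y
    rw [hy.1] at ht
    rw [hy.2] at hn
    have : y ^ Fintype.card F = φ t - y := by rw [hφ, ht]; ring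
    exact ⟨by rw [← this, ← hn], this⟩
  rcases (N₁ ∪ N₂).eq_empty_or_nonempty with h0 | ⟨y₀, hy₀⟩
  · obtain ⟨h01, h02⟩ := Finset.union_eq_empty.1 h0
    simp [h01, h02]
  have hall : ∀ y ∈ N₁ ∪ N₂, y * (φ t - y) = φ n := by
    intro y hy
    rcases Finset.mem_union.1 hy with h | h
    · exact (h1 y h).1
    · exact (h2 y h).1
  have hsub : ∀ y ∈ N₁ ∪ N₂, y = y₀ ∨ y = φ t - y₀ := by
    intro y hy
    have : (y - y₀) * (y - (φ t - y₀)) = 0 := by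
      linear_combination -(hall y hy) + hall y₀ hy₀
    rcases mul_eq_zero.1 this with h | h
    · exact Or.inl (sub_eq_zero.1 h)
    · exact Or.inr (sub_eq_zero.1 h)
  by_cases hd : y₀ = φ t - y₀
  · have h3 : N₁ ⊆ {y₀} := fun y hy => Finset.mem_singleton.2 <| by
      rcases hsub y (Finset.mem_union_left _ hy) with h | h
      · exact h
      · exact h.trans hd.symm
    have h4 : N₂ ⊆ {y₀} := fun y hy => Finset.mem_singleton.2 <| by
      rcases hsub y (Finset.mem_union_right _ hy) with h | h
      · exact h
      · exact h.trans hd.symm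
    have := Finset.card_le_card h3
    have := Finset.card_le_card h4
    simp only [Finset.card_singleton] at *
    omega
  · have hdis : Disjoint N₁ N₂ := by
      refine Finset.disjoint_left.2 fun y hy hy' => hd ?_
      have h5 : y = φ t - y := (h1 y hy).2.symm.trans (h2 y hy').2
      rcases hsub y (Finset.mem_union_left _ hy) with h | h
      · rwa [h] at h5
      · rw [h] at h5
        linear_combination -h5
    rw [← Finset.card_union_of_disjoint hdis]
    refine (Finset.card_le_card (t := {y₀, φ t - y₀}) fun y hy => ?_).trans Finset.card_le_two
    simpa using hsub y hy

theorem card_trace_norm_add_card_sum_prod [DecidableEq F] (hK : Module.finrank F K = 2)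
    (t n : F) :
    (Finset.univ.filter fun x : F × F => (x.1 + x.2, x.1 * x.2) = (t, n)).card +
      (Finset.univ.filter fun x : K =>
        (Algebra.trace F K x, Algebra.norm F x) = (t, n)).card = 2 := by
  have hKc : Fintype.card K = Fintype.card F ^ 2 := by
    rw [Module.card_eq_pow_finrank (K := F), hK]
  have h1 : ∑ w : F × F, (Finset.univ.filter fun x : F × F => (x.1 + x.2, x.1 * x.2) = w).card =
      Fintype.card F ^ 2 := by
    rw [← Finset.card_eq_sum_card_fiberwise (by intro x _; simp), Finset.card_univ,
      Fintype.card_prod, sq]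
  have h2 : ∑ w : F × F, (Finset.univ.filter fun x : K =>
      (Algebra.trace F K x, Algebra.norm F x) = w).card = Fintype.card F ^ 2 := by
    rw [← Finset.card_eq_sum_card_fiberwise (by intro x _; simp), Finset.card_univ, hKc]
  have h3 : ∑ w : F × F, ((Finset.univ.filter fun x : F × F => (x.1 + x.2, x.1 * x.2) = w).card +
      (Finset.univ.filter fun x : K => (Algebra.trace F K x, Algebra.norm F x) = w).card) =
      ∑ w : F × F, 2 := by
    rw [Finset.sum_add_distrib, h1, h2, Finset.sum_const, Finset.card_univ, Fintype.card_prod,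
      smul_eq_mul]
    ring
  exact (Finset.sum_eq_sum_iff_of_le fun w _ =>
    card_trace_norm_add_card_sum_prod_le hK w.1 w.2).1 h3 (t, n) (Finset.mem_univ _)

/-- The sum over a quadratic extension in terms of the square of the sum over the base field. -/
theorem sq_norm_kloostermanSum_le (hK : Module.finrank F K = 2) {a b : F} (hb : b ≠ 0)
    (χ : MulChar F ℂ) {ψ : AddChar F ℂ} (hψ : ψ ≠ 1) :
    ‖kloostermanSum χ ψ a b‖ ^ 2 - 2 * Fintype.card F ≤
      ‖kloostermanSum (normChar (K := K) χ) (traceChar ψ) (algebraMap F K a)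
        (algebraMap F K b)‖ := by
  classical
  let f : F × F → ℂ := fun w => χ w.2 * ψ (a * w.1 + b * (w.1 * w.2⁻¹))
  have hS2 : kloostermanSum χ ψ a b ^ 2 =
      ∑ w : F × F, ((Finset.univ.filter fun x : F × F =>
        (x.1 + x.2, x.1 * x.2) = w).card : ℂ) * f w := by
    have h1 : kloostermanSum χ ψ a b ^ 2 = ∑ x : F × F, f (x.1 + x.2, x.1 * x.2) := by
      rw [sq, kloostermanSum, Finset.sum_mul_sum, ← Finset.sum_product', ← Finset.univ_product_univ]
      refine Finset.sum_congr rfl fun x _ => ?_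
      simp only [f]
      by_cases h1 : x.1 = 0
      · simp [h1, MulChar.map_zero]
      by_cases h2 : x.2 = 0
      · simp [h2, MulChar.map_zero]
      rw [map_mul, mul_mul_mul_comm, ← AddChar.map_add_eq_mul]
      congr 2
      field_simp
      ring
    rw [h1, ← Finset.sum_fiberwise_of_maps_to (t := Finset.univ)
        (g := fun x : F × F => (x.1 + x.2, x.1 * x.2)) (by intro x _; simp)]
    refine Finset.sum_congr rfl fun w _ => ?_
    rw [← nsmul_eq_mul]
    refine Finset.sum_eq_card_nsmul fun x hx => ?_
    rw [(Finset.mem_filter.1 hx).2]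
  have hSK : kloostermanSum (normChar (K := K) χ) (traceChar ψ) (algebraMap F K a)
      (algebraMap F K b) = ∑ w : F × F, ((Finset.univ.filter fun x : K =>
        (Algebra.trace F K x, Algebra.norm F x) = w).card : ℂ) * f w := by
    have h1 : kloostermanSum (normChar (K := K) χ) (traceChar ψ) (algebraMap F K a)
        (algebraMap F K b) = ∑ x : K, f (Algebra.trace F K x, Algebra.norm F x) := by
      rw [kloostermanSum]
      refine Finset.sum_congr rfl fun x _ => ?_
      simp only [f]
      rw [normChar_apply, traceChar_apply]
      by_cases hx : x = 0
      · simp [hx]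
      congr 2
      rw [map_add, ← Algebra.smul_def, ← Algebra.smul_def, map_smul, map_smul, smul_eq_mul,
        smul_eq_mul]
      congr 2
      apply (algebraMap F K).injective
      rw [map_mul, map_inv₀ (algebraMap F K), algebraMap_trace_of_finrank_two hK,
        algebraMap_trace_of_finrank_two hK,
        algebraMap_norm_of_finrank_two hK, inv_pow]
      have : x ^ Fintype.card F ≠ 0 := pow_ne_zero _ hx
      field_simp
      ring
    rw [h1, ← Finset.sum_fiberwise_of_maps_to (t := Finset.univ)
        (g := fun x : K => (Algebra.trace F K x, Algebra.norm F x)) (by intro x _; simp)]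
    refine Finset.sum_congr rfl fun w _ => ?_
    rw [← nsmul_eq_mul]
    refine Finset.sum_eq_card_nsmul fun x hx => ?_
    rw [(Finset.mem_filter.1 hx).2]
  have hadd : kloostermanSum χ ψ a b ^ 2 + kloostermanSum (normChar (K := K) χ) (traceChar ψ)
      (algebraMap F K a) (algebraMap F K b) = 2 * ∑ w, f w := by
    rw [hS2, hSK, ← Finset.sum_add_distrib, Finset.mul_sum]
    refine Finset.sum_congr rfl fun w _ => ?_
    rw [← add_mul]
    congr 1
    exact_mod_cast card_trace_norm_add_card_sum_prod hK w.1 w.2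
  have hL : ‖∑ w, f w‖ ≤ Fintype.card F := by
    have h1 : ∀ n : F, ∑ t : F, f (t, n) =
        if a + b * n⁻¹ = 0 then χ n * (Fintype.card F : ℂ) else 0 := by
      intro n
      have h2 : ∀ t : F, f (t, n) = χ n * ψ ((a + b * n⁻¹) * t) := fun t => by
        simp only [f]; congr 2; ring
      simp only [h2]
      rw [← Finset.mul_sum]
      split_ifs with h
      · simp [h]
      · have : AddChar.mulShift ψ (a + b * n⁻¹) ≠ 1 :=
          AddChar.IsPrimitive.of_ne_one hψ h
        have h4 := AddChar.sum_eq_zero_of_ne_one this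
        simp only [AddChar.mulShift_apply] at h4
        rw [h4, mul_zero]
    rw [← Finset.univ_product_univ, Finset.sum_product_right]
    simp only [h1]
    have h2 : ∀ n : F, ‖if a + b * n⁻¹ = 0 then χ n * (Fintype.card F : ℂ) else 0‖ ≤
        if n = -b * a⁻¹ then (Fintype.card F : ℝ) else 0 := by
      intro n
      by_cases hn : n = 0
      · have : (0 : ℝ) ≤ if n = -b * a⁻¹ then (Fintype.card F : ℝ) else 0 := by
          split_ifs <;> positivity
        simpa [hn, MulChar.map_zero] using this
      by_cases h : a + b * n⁻¹ = 0
      · have ha : a ≠ 0 := by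
          rintro rfl
          simp [hb, hn] at h
        have h' : n = -b * a⁻¹ := by
          field_simp at h ⊢
          linear_combination h
        rw [if_pos h, if_pos h', norm_mul]
        simpa using mul_le_of_le_one_left (Nat.cast_nonneg _) (norm_mulChar_apply_le χ n)
      · rw [if_neg h, norm_zero]
        split_ifs <;> positivity
    refine (norm_sum_le _ _).trans ((Finset.sum_le_sum fun n _ => h2 n).trans ?_)
    rw [Finset.sum_ite_eq' Finset.univ, if_pos (Finset.mem_univ _)]
  have h5 : kloostermanSum χ ψ a b ^ 2 = 2 * ∑ w, f w - kloostermanSum (normChar (K := K) χ)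
      (traceChar ψ) (algebraMap F K a) (algebraMap F K b) := by rw [← hadd]; ring
  have h6 := norm_sub_le (2 * ∑ w, f w) (kloostermanSum (normChar (K := K) χ)
      (traceChar ψ) (algebraMap F K a) (algebraMap F K b))
  rw [← h5, norm_pow, norm_mul, Complex.norm_two] at h6
  linarith

end Quadratic

/-- One step up a tower of quadratic extensions amplifies an excess over the square root bound. -/
theorem exists_quadratic_amplification {F : Type*} [Field F] [Fintype F] {a b : F} (hb : b ≠ 0)
    (χ : MulChar F ℂ) {ψ : AddChar F ℂ} (hψ : ψ ≠ 1) {δ : ℝ} (hδ : 0 ≤ δ)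
    (h : (2 + δ) * √(Fintype.card F) ≤ ‖kloostermanSum χ ψ a b‖) :
    ∃ (K : Type) (_ : Field K) (_ : Fintype K) (_ : Algebra F K), Module.finrank F K = 2 ∧
      (2 + 4 * δ) * √(Fintype.card K) ≤ ‖kloostermanSum (normChar (K := K) χ) (traceChar ψ)
        (algebraMap F K a) (algebraMap F K b)‖ := by
  obtain ⟨p, hpc⟩ := CharP.exists F
  have hp : Fact p.Prime := ⟨CharP.char_is_prime F p⟩
  let K := FiniteField.Extension F p 2
  have hfin : Fintype K := Fintype.ofFinite K
  have hK : Module.finrank F K = 2 := FiniteField.finrank_extension F p 2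
  refine ⟨K, inferInstance, hfin, inferInstance, hK, ?_⟩
  refine le_trans ?_ (sq_norm_kloostermanSum_le (K := K) hK hb χ hψ)
  have hKc : Fintype.card K = Fintype.card F ^ 2 := by
    rw [Module.card_eq_pow_finrank (K := F), hK]
  rw [hKc, Nat.cast_pow, Real.sqrt_sq (Nat.cast_nonneg _)]
  have h1 : ((2 + δ) * √(Fintype.card F)) ^ 2 ≤ ‖kloostermanSum χ ψ a b‖ ^ 2 :=
    pow_le_pow_left₀ (by positivity) h 2
  rw [mul_pow, Real.sq_sqrt (Nat.cast_nonneg _)] at h1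
  nlinarith [mul_nonneg (sq_nonneg δ) (Nat.cast_nonneg (α := ℝ) (Fintype.card F))]

theorem exists_tower_amplification {F : Type*} [Field F] [Fintype F] {a b : F} (hb : b ≠ 0)
    (χ : MulChar F ℂ) {ψ : AddChar F ℂ} (hψ : ψ ≠ 1) {δ : ℝ} (hδ : 0 ≤ δ)
    (h : (2 + δ) * √(Fintype.card F) ≤ ‖kloostermanSum χ ψ a b‖) (r : ℕ) :
    ∃ (K : Type) (_ : Field K) (_ : Fintype K) (_ : Algebra F K),
      Module.finrank F K = 2 ^ (r + 1) ∧
      (2 + 4 ^ (r + 1) * δ) * √(Fintype.card K) ≤ ‖kloostermanSum (normChar (K := K) χ)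
        (traceChar ψ) (algebraMap F K a) (algebraMap F K b)‖ := by
  induction r with
  | zero => simpa using exists_quadratic_amplification hb χ hψ hδ h
  | succ r ih =>
    obtain ⟨K, _, _, _, hK, hS⟩ := ih
    obtain ⟨L, _, _, _, hL, hSum⟩ := exists_quadratic_amplification (F := K)
      (b := algebraMap F K b) (by simpa using hb) (normChar (K := K) χ)
      (traceChar_ne_one (K := K) hψ) (by positivity) hS
    let alg : Algebra F L := ((algebraMap K L).comp (algebraMap F K)).toAlgebra
    have tow : IsScalarTower F K L := IsScalarTower.of_algebraMap_eq fun _ => rfl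
    refine ⟨L, inferInstance, inferInstance, alg, ?_, ?_⟩
    · rw [← Module.finrank_mul_finrank F K L, hK, hL, pow_succ 2 (r + 1)]
    · have h1 : normChar (K := L) (normChar (K := K) χ) = normChar (K := L) χ := by
        ext x
        rw [normChar_apply, normChar_apply, normChar_apply, Algebra.norm_norm]
      have h2 : traceChar (K := L) (traceChar (K := K) ψ) = traceChar (K := L) ψ := by
        ext x
        rw [traceChar_apply, traceChar_apply, traceChar_apply, Algebra.trace_trace]
      rw [h1, h2] at hSum
      rw [pow_succ, mul_comm _ (4 : ℝ), mul_assoc]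
      exact hSum

/-- Weil's bound for twisted Kloosterman sums. -/
theorem norm_kloostermanSum_le {F : Type*} [Field F] [Fintype F] {a b : F} (ha : a ≠ 0)
    (hb : b ≠ 0) (χ : MulChar F ℂ) {ψ : AddChar F ℂ} (hψ : ψ ≠ 1) :
    ‖kloostermanSum χ ψ a b‖ ≤ 2 * √(Fintype.card F) := by
  by_contra! hlt
  have hsq : 0 < √(Fintype.card F : ℝ) := Real.sqrt_pos.2 (by exact_mod_cast Fintype.card_pos)
  set δ := ‖kloostermanSum χ ψ a b‖ / √(Fintype.card F) - 2 with hδ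
  have hδ0 : 0 < δ := by
    rw [hδ, sub_pos, lt_div_iff₀ hsq]; exact hlt
  have h : (2 + δ) * √(Fintype.card F) ≤ ‖kloostermanSum χ ψ a b‖ := by
    rw [hδ, add_sub_cancel, div_mul_cancel₀ _ hsq.ne']
  obtain ⟨r, hr⟩ := pow_unbounded_of_one_lt (9 * (Fintype.card F : ℝ) ^ 2 / δ)
    (by norm_num : (1 : ℝ) < 4)
  obtain ⟨K, _, _, _, hK, hS⟩ := exists_tower_amplification hb χ hψ hδ0.le h r
  have h2 := norm_kloostermanSum_lift_le (K := K) (b := b) (2 ^ r - 1)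
    (by rw [hK, Nat.sub_add_cancel Nat.one_le_two_pow, pow_succ, mul_comm]) ha χ hψ
  have hsqK : 0 < √(Fintype.card K : ℝ) := Real.sqrt_pos.2 (by exact_mod_cast Fintype.card_pos)
  have h3 := le_of_mul_le_mul_right (hS.trans h2) hsqK
  rw [div_lt_iff₀ hδ0] at hr
  have : (0 : ℝ) < 4 ^ r * δ := by positivity
  rw [pow_succ] at h3
  linarith

/-- Gauss sums and sums of characters are special cases of the same bound. -/
theorem norm_kloostermanSum_le_of_ne {F : Type*} [Field F] [Fintype F] {a b : F}
    (χ : MulChar F ℂ) (h : χ ≠ 1 ∨ a ≠ 0 ∨ b ≠ 0) {ψ : AddChar F ℂ} (hψ : ψ ≠ 1) :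
    ‖kloostermanSum χ ψ a b‖ ≤ 2 * √(Fintype.card F) := by
  classical
  have hq1 : (1 : ℝ) ≤ Fintype.card F := by exact_mod_cast Fintype.card_pos
  have hs1 : 1 ≤ √(Fintype.card F : ℝ) := Real.one_le_sqrt.2 hq1
  have gauss : ∀ (χ : MulChar F ℂ) (a : F), χ ≠ 1 ∨ a ≠ 0 →
      ‖∑ x : F, χ x * ψ (a * x)‖ ≤ 2 * √(Fintype.card F) := by
    intro χ a h
    by_cases ha : a = 0
    · have hχ : χ ≠ 1 := by tauto
      simp only [ha, zero_mul, AddChar.map_zero_eq_one, mul_one]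
      rw [MulChar.sum_eq_zero_of_ne_one hχ, norm_zero]
      positivity
    have hprim : (AddChar.mulShift ψ a).IsPrimitive :=
      AddChar.IsPrimitive.of_ne_one (AddChar.IsPrimitive.of_ne_one hψ ha)
    by_cases hχ : χ = 1
    · have h1 : ∑ x : F, χ x * ψ (a * x) = ∑ x : F, AddChar.mulShift ψ a x - 1 := by
        rw [← Finset.sum_erase_add _ _ (Finset.mem_univ (0 : F)),
          ← Finset.sum_erase_add _ (fun x => AddChar.mulShift ψ a x)
            (Finset.mem_univ (0 : F))]
        simp only [mul_zero, AddChar.map_zero_eq_one, MulChar.map_zero, zero_mul, add_zero,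
          add_sub_cancel_right]
        refine Finset.sum_congr rfl fun x hx => ?_
        rw [hχ, MulChar.one_apply (isUnit_iff_ne_zero.2 (Finset.ne_of_mem_erase hx)), one_mul,
          AddChar.mulShift_apply]
      rw [h1, AddChar.sum_eq_zero_of_ne_one (AddChar.IsPrimitive.of_ne_one hψ ha), zero_sub,
        norm_neg, norm_one]
      linarith
    · have h1 : ∑ x : F, χ x * ψ (a * x) = gaussSum χ (AddChar.mulShift ψ a) := by
        simp [gaussSum, AddChar.mulShift_apply]
      have h2 := gaussSum_mul_gaussSum_eq_card hχ hprim
      rw [← star_gaussSum_eq] at h2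
      have h3 := congrArg norm h2
      rw [norm_mul, norm_star, Complex.norm_natCast, ← sq] at h3
      rw [h1, ← Real.sqrt_sq (norm_nonneg (gaussSum χ (AddChar.mulShift ψ a))), h3]
      linarith
  by_cases hb : b = 0
  · have := gauss χ a (by tauto)
    simpa [kloostermanSum, hb] using this
  by_cases ha : a = 0
  · have := gauss χ⁻¹ b (Or.inr hb)
    rw [kloostermanSum, ← Equiv.sum_comp (Equiv.inv F)]
    simpa [ha, MulChar.inv_apply'] using this
  exact norm_kloostermanSum_le ha hb χ hψ

section TraceConditions

variable {k F W : Type*} [Field k] [Finite k] [Field F] [Fintype F] [DecidableEq F] [DecidableEq k]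
  [Algebra k F] [AddCommGroup W] [Module k W] [Fintype W]

/-- The nonzero elements satisfying a linear system of trace conditions on themselves
and on their inverses. -/
noncomputable def traceSet (A B : W →ₗ[k] F) : Finset F :=
  Finset.univ.filter fun α => α ≠ 0 ∧ ∀ w, Algebra.trace k F (A w * α + B w * α⁻¹) = 0

theorem card_mul_sum_traceSet {k F W : Type*} [Field k] [Field F] [Fintype F]
    [DecidableEq F] [DecidableEq k] [Algebra k F] [AddCommGroup W] [Module k W] [Fintype W]
    (A B : W →ₗ[k] F) (χ : MulChar F ℂ) {ψ : AddChar k ℂ}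
    (hψ : ψ ≠ 1) : (Fintype.card W : ℂ) * ∑ α ∈ traceSet A B, χ α =
      ∑ w, kloostermanSum χ (traceChar (K := F) ψ) (A w) (B w) := by
  have key : ∀ α : F, ∑ w : W, χ α * traceChar (K := F) ψ (A w * α + B w * α⁻¹) =
      if α ∈ traceSet A B then Fintype.card W * χ α else 0 := by
    intro α
    rw [← Finset.mul_sum]
    by_cases hα : α = 0
    · simp [hα, MulChar.map_zero]
    split_ifs with h
    · have h' := ((Finset.mem_filter.1 h).2).2
      simp only [traceChar_apply, h', AddChar.map_zero_eq_one, Finset.sum_const, Finset.card_univ,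
        nsmul_eq_mul, mul_one]
      rw [mul_comm]
    · obtain ⟨w₀, hw₀⟩ : ∃ w, Algebra.trace k F (A w * α + B w * α⁻¹) ≠ 0 := by
        by_contra! h'
        exact h (Finset.mem_filter.2 ⟨Finset.mem_univ _, hα, h'⟩)
      let lin : W →ₗ[k] k := (Algebra.trace k F).comp
        ((LinearMap.mulRight k α).comp A + (LinearMap.mulRight k α⁻¹).comp B)
      have hlin : ∀ w, lin w = Algebra.trace k F (A w * α + B w * α⁻¹) := fun w => rfl
      have hne : ψ.compAddMonoidHom lin.toAddMonoidHom ≠ 1 := by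
        obtain ⟨t, ht⟩ := AddChar.ne_one_iff.1 hψ
        refine AddChar.ne_one_iff.2 ⟨(t * (lin w₀)⁻¹) • w₀, ?_⟩
        have : lin ((t * (lin w₀)⁻¹) • w₀) = t := by
          rw [map_smul, smul_eq_mul, inv_mul_cancel_right₀ (by rwa [hlin])]
        simpa [AddChar.compAddMonoidHom_apply, this] using ht
      have h1 := AddChar.sum_eq_zero_of_ne_one hne
      have h2 : ∑ w : W, traceChar (K := F) ψ (A w * α + B w * α⁻¹) = 0 := by
        rw [← h1]
        rfl
      rw [h2, mul_zero]
  simp only [kloostermanSum]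
  rw [Finset.sum_comm]
  simp only [key]
  rw [Finset.sum_ite_mem, Finset.univ_inter, Finset.mul_sum]

theorem exists_addChar_ne_one (k : Type*) [Field k] [Finite k] : ∃ ψ : AddChar k ℂ, ψ ≠ 1 := by
  obtain ⟨ψ, hψ⟩ := AddChar.exists_apply_ne_zero.2 (one_ne_zero (α := k))
  exact ⟨ψ, AddChar.ne_one_iff.2 ⟨1, hψ⟩⟩

theorem norm_sum_traceSet_le (A B : W →ₗ[k] F) {χ : MulChar F ℂ} (hχ : χ ≠ 1) :
    ‖∑ α ∈ traceSet A B, χ α‖ ≤ 2 * √(Fintype.card F) := by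
  obtain ⟨ψ, hψ⟩ := exists_addChar_ne_one k
  have h := congrArg norm (card_mul_sum_traceSet A B χ hψ)
  have hW : (0 : ℝ) < Fintype.card W := by exact_mod_cast Fintype.card_pos
  rw [norm_mul, Complex.norm_natCast] at h
  refine le_of_mul_le_mul_left ?_ hW
  rw [h]
  refine (norm_sum_le _ _).trans ?_
  refine (Finset.sum_le_sum fun w _ => norm_kloostermanSum_le_of_ne χ (Or.inl hχ)
    (traceChar_ne_one hψ)).trans ?_
  rw [Finset.sum_const, Finset.card_univ, nsmul_eq_mul]

theorem abs_card_traceSet_sub_le (A B : W →ₗ[k] F) (hinj : ∀ w, A w = 0 → B w = 0 → w = 0) :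
    |((traceSet A B).card : ℝ) - Fintype.card F / Fintype.card W| ≤ 2 * √(Fintype.card F) := by
  classical
  obtain ⟨ψ, hψ⟩ := exists_addChar_ne_one k
  have h := card_mul_sum_traceSet A B (1 : MulChar F ℂ) hψ
  have hW : (0 : ℝ) < Fintype.card W := by exact_mod_cast Fintype.card_pos
  have hs1 : 1 ≤ √(Fintype.card F : ℝ) := Real.one_le_sqrt.2 (by exact_mod_cast Fintype.card_pos)
  have h1 : ∑ α ∈ traceSet A B, (1 : MulChar F ℂ) α = (traceSet A B).card := by
    rw [Finset.cast_card]
    refine Finset.sum_congr rfl fun α hα => ?_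
    exact MulChar.one_apply (isUnit_iff_ne_zero.2 ((Finset.mem_filter.1 hα).2).1)
  have h2 : kloostermanSum (1 : MulChar F ℂ) (traceChar (K := F) ψ) (A 0) (B 0) =
      Fintype.card F - 1 := by
    have h3 : ∀ x : F, (1 : MulChar F ℂ) x * traceChar (K := F) ψ (A 0 * x + B 0 * x⁻¹) =
        if x = 0 then 0 else 1 := by
      intro x
      split_ifs with hx
      · simp [hx, MulChar.map_zero]
      · rw [MulChar.one_apply (isUnit_iff_ne_zero.2 hx)]
        simp
    simp only [kloostermanSum, h3]
    rw [Finset.sum_ite, Finset.sum_const_zero, zero_add, Finset.sum_const, nsmul_eq_mul, mul_one,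
      Finset.filter_ne' Finset.univ (0 : F), Finset.card_erase_of_mem (Finset.mem_univ _),
      Finset.card_univ, Nat.cast_sub Fintype.card_pos, Nat.cast_one]
  rw [h1, ← Finset.sum_erase_add _ _ (Finset.mem_univ (0 : W)), h2] at h
  have h4 : ((Fintype.card W * (traceSet A B).card - Fintype.card F : ℝ) : ℂ) =
      ∑ w ∈ Finset.univ.erase (0 : W),
        kloostermanSum (1 : MulChar F ℂ) (traceChar (K := F) ψ) (A w) (B w) - 1 := by
    push_cast
    rw [h]
    ring
  have h5 : |(Fintype.card W * (traceSet A B).card - Fintype.card F : ℝ)| ≤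
      Fintype.card W * (2 * √(Fintype.card F)) := by
    rw [← Real.norm_eq_abs, ← Complex.norm_real, h4]
    refine (norm_sub_le _ _).trans ?_
    rw [norm_one]
    have h6 : ‖∑ w ∈ Finset.univ.erase (0 : W),
        kloostermanSum (1 : MulChar F ℂ) (traceChar (K := F) ψ) (A w) (B w)‖ ≤
        (Finset.univ.erase (0 : W)).card * (2 * √(Fintype.card F)) := by
      refine (norm_sum_le _ _).trans ?_
      rw [← nsmul_eq_mul]
      refine Finset.sum_le_card_nsmul _ _ _ fun w hw => ?_
      refine norm_kloostermanSum_le_of_ne 1 (Or.inr ?_) (traceChar_ne_one hψ)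
      by_contra! h'
      exact Finset.ne_of_mem_erase hw (hinj w h'.1 h'.2)
    rw [Finset.card_erase_of_mem (Finset.mem_univ _), Finset.card_univ,
      Nat.cast_sub Fintype.card_pos, Nat.cast_one] at h6
    linarith
  have h7 : ((traceSet A B).card : ℝ) - Fintype.card F / Fintype.card W =
      (Fintype.card W * (traceSet A B).card - Fintype.card F) / Fintype.card W := by
    field_simp
  rw [h7, abs_div, abs_of_pos hW, div_le_iff₀ hW]
  linarith

end TraceConditions

section Sieve

variable {F : Type*} [Field F]

theorem sum_range_mulChar_pow {X : MulChar F ℂ} {r : ℕ} (hX : orderOf X = r) {α : F}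
    (hα : α ≠ 0) : ∑ i ∈ Finset.range r, (X ^ i) α = if X α = 1 then (r : ℂ) else 0 := by
  have h1 : ∀ i, (X ^ i) α = X α ^ i := fun i => by
    simpa using MulChar.pow_apply_coe X i (Units.mk0 α hα)
  have h2 : X α ^ r = 1 := by
    rw [← h1, ← hX, pow_orderOf_eq_one, MulChar.one_apply (isUnit_iff_ne_zero.2 hα)]
  simp only [h1]
  split_ifs with h
  · simp [h]
  · have h3 := geom_sum_mul (X α) r
    rw [h2, sub_self] at h3
    exact (mul_eq_zero.1 h3).resolve_right (sub_ne_zero.2 h)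

variable {X : ℕ → MulChar F ℂ}

open Classical in
/-- The elements of `G` which are not `r`-th powers for `r ∈ J`, in terms of characters `X r`
of order `r`. -/
noncomputable def sieved (X : ℕ → MulChar F ℂ) (G : Finset F) (J : Finset ℕ) : Finset F :=
  G.filter fun α => ∀ r ∈ J, X r α ≠ 1

theorem sum_sieved_insert (G : Finset F) (hG : ∀ α ∈ G, α ≠ 0) (J : Finset ℕ) {r : ℕ}
    (hr : r.Prime) (hX : orderOf (X r) = r)
    (χ : MulChar F ℂ) :
    (∑ α ∈ sieved X G (insert r J), χ α) = (1 - 1 / (r : ℂ)) * ∑ α ∈ sieved X G J, χ α -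
      1 / (r : ℂ) * ∑ i ∈ Finset.range (r - 1), ∑ α ∈ sieved X G J, (χ * X r ^ (i + 1)) α := by
  classical
  have hr0 : (r : ℂ) ≠ 0 := by exact_mod_cast hr.ne_zero
  have h1 : sieved X G (insert r J) = (sieved X G J).filter fun α => X r α ≠ 1 := by
    ext α
    simp only [sieved, Finset.mem_filter, Finset.forall_mem_insert]
    tauto
  rw [h1, Finset.sum_filter, Finset.mul_sum, Finset.sum_comm, Finset.mul_sum,
    ← Finset.sum_sub_distrib]
  refine Finset.sum_congr rfl fun α hα => ?_
  have hα0 : α ≠ 0 := hG α (Finset.mem_filter.1 hα).1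
  have h2 := sum_range_mulChar_pow hX hα0
  obtain ⟨m, rfl⟩ : ∃ m, r = m + 1 := ⟨r - 1, (Nat.sub_add_cancel hr.one_le).symm⟩
  rw [Finset.sum_range_succ', pow_zero, MulChar.one_apply (isUnit_iff_ne_zero.2 hα0)] at h2
  rw [Nat.add_sub_cancel]
  simp only [MulChar.mul_apply]
  rw [← Finset.mul_sum, eq_sub_of_add_eq h2]
  by_cases h3 : X (m + 1) α = 1
  · simp only [h3, ne_eq, not_true_eq_false, if_false, if_true]
    push_cast at hr0 ⊢
    field_simp
    ring
  · simp only [h3, ne_eq, not_false_eq_true, if_true, if_false]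
    push_cast at hr0 ⊢
    field_simp
    ring

/-- The bounds for sums of characters over a sieved set. -/
theorem norm_sum_sieved_le (G : Finset F) (hG : ∀ α ∈ G, α ≠ 0) {E : ℝ}
    (hE : ∀ χ : MulChar F ℂ, χ ≠ 1 → ‖∑ α ∈ G, χ α‖ ≤ E) (J : Finset ℕ)
    (hJ : ∀ r ∈ J, r.Prime ∧ orderOf (X r) = r) (χ : MulChar F ℂ) (hχ : χ ≠ 1)
    (hχJ : ∀ r ∈ J, ¬ r ∣ orderOf χ) :
    ‖∑ α ∈ sieved X G J, χ α‖ ≤ (∏ r ∈ J, (1 - 1 / (r : ℝ))) * 2 ^ J.card * E := by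
  classical
  induction J using Finset.induction_on generalizing χ with
  | empty => simpa [sieved] using hE χ hχ
  | insert r J hrJ ih =>
    obtain ⟨hr, hX⟩ := hJ r (Finset.mem_insert_self _ _)
    have hJ' : ∀ r ∈ J, r.Prime ∧ orderOf (X r) = r :=
      fun s hs => hJ s (Finset.mem_insert_of_mem hs)
    have hrχ : ¬ r ∣ orderOf χ := hχJ r (Finset.mem_insert_self _ _)
    have hr0 : (0 : ℝ) < r := by exact_mod_cast hr.pos
    have hr1 : (1 : ℝ) ≤ r := by exact_mod_cast hr.one_le
    rw [sum_sieved_insert G hG J hr hX, Finset.prod_insert hrJ, Finset.card_insert_of_notMem hrJ]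
    set T := (∏ r ∈ J, (1 - 1 / (r : ℝ))) * 2 ^ J.card * E with hT
    have h1 := ih hJ' χ hχ fun s hs => hχJ s (Finset.mem_insert_of_mem hs)
    have h2 : ∀ i ∈ Finset.range (r - 1),
        ‖∑ α ∈ sieved X G J, (χ * X r ^ (i + 1)) α‖ ≤ T := by
      intro i hi
      have hi' : i + 1 < r := by have := Finset.mem_range.1 hi; omega
      have hord : orderOf (X r ^ (i + 1)) ∣ r := by
        have := orderOf_pow_dvd (x := X r) (i + 1)
        rwa [hX] at this
      apply ih hJ'
      · intro h
        have h3 : χ⁻¹ = X r ^ (i + 1) := inv_eq_of_mul_eq_one_right h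
        have h4 : orderOf χ ∣ r := by rw [← orderOf_inv, h3]; exact hord
        rcases (Nat.dvd_prime hr).1 h4 with h5 | h5
        · exact hχ (orderOf_eq_one_iff.1 h5)
        · exact hrχ (h5 ▸ dvd_rfl)
      · intro s hs hdvd
        have hsp := (hJ' s hs).1
        have h3 := hdvd.trans (Commute.all χ (X r ^ (i + 1))).orderOf_mul_dvd_lcm
        rcases (hsp.dvd_lcm).1 h3 with h4 | h4
        · exact hχJ s (Finset.mem_insert_of_mem hs) h4
        · have := (Nat.prime_dvd_prime_iff_eq hsp hr).1 (h4.trans hord)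
          exact hrJ (this ▸ hs)
    have hnn : (0 : ℝ) ≤ 1 - 1 / r := by
      rw [sub_nonneg, div_le_one hr0]; exact hr1
    have hn1 : ‖(1 - 1 / (r : ℂ))‖ = 1 - 1 / (r : ℝ) := by
      rw [show (1 - 1 / (r : ℂ)) = ((1 - 1 / (r : ℝ) : ℝ) : ℂ) by push_cast; rfl, Complex.norm_real,
        Real.norm_of_nonneg hnn]
    have hn2 : ‖(1 / (r : ℂ))‖ = 1 / (r : ℝ) := by simp
    calc _ ≤ (1 - 1 / (r : ℝ)) * T + 1 / (r : ℝ) * ((r - 1) * T) := by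
          refine (norm_sub_le _ _).trans (add_le_add ?_ ?_)
          · rw [norm_mul, hn1]
            exact mul_le_mul_of_nonneg_left h1 hnn
          · rw [norm_mul, hn2]
            refine mul_le_mul_of_nonneg_left ?_ (by positivity)
            refine (norm_sum_le _ _).trans ((Finset.sum_le_card_nsmul _ _ _ h2).trans ?_)
            rw [Finset.card_range, nsmul_eq_mul, Nat.cast_sub hr.one_le, Nat.cast_one]
      _ = _ := by
          rw [hT]
          field_simp
          ring

end Sieve

section SieveCount

variable {F : Type*} [Field F] {X : ℕ → MulChar F ℂ}

theorem prod_one_sub_inv_nonneg {J : Finset ℕ} (hJ : ∀ r ∈ J, r.Prime) :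
    0 ≤ ∏ r ∈ J, (1 - 1 / (r : ℝ)) :=
  Finset.prod_nonneg fun r hr => by
    have : (1 : ℝ) ≤ r := by exact_mod_cast (hJ r hr).one_le
    rw [sub_nonneg, div_le_one (by linarith)]
    exact this

theorem prod_one_sub_inv_pos {J : Finset ℕ} (hJ : ∀ r ∈ J, r.Prime) :
    0 < ∏ r ∈ J, (1 - 1 / (r : ℝ)) :=
  Finset.prod_pos fun r hr => by
    have : (1 : ℝ) < r := by exact_mod_cast (hJ r hr).one_lt
    rw [sub_pos, div_lt_one (by linarith)]
    exact this

/-- The effect of one more sieving prime on the size of the sieved set. -/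
theorem abs_card_sieved_insert_sub_le (G : Finset F) (hG : ∀ α ∈ G, α ≠ 0) {E : ℝ}
    (hE : ∀ χ : MulChar F ℂ, χ ≠ 1 → ‖∑ α ∈ G, χ α‖ ≤ E) (J : Finset ℕ)
    (hJ : ∀ r ∈ J, r.Prime ∧ orderOf (X r) = r) {r : ℕ} (hr : r.Prime) (hX : orderOf (X r) = r)
    (hrJ : r ∉ J) :
    |((sieved X G (insert r J)).card : ℝ) - (1 - 1 / (r : ℝ)) * (sieved X G J).card| ≤
      (1 - 1 / (r : ℝ)) * ((∏ r ∈ J, (1 - 1 / (r : ℝ))) * 2 ^ J.card * E) := by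
  have hone : ∀ I : Finset ℕ, ∑ α ∈ sieved X G I, (1 : MulChar F ℂ) α = (sieved X G I).card := by
    intro I
    rw [Finset.cast_card]
    exact Finset.sum_congr rfl fun α hα =>
      MulChar.one_apply (isUnit_iff_ne_zero.2 (hG α (Finset.mem_filter.1 hα).1))
  have h := sum_sieved_insert G hG J hr hX 1
  rw [hone, hone] at h
  have hr0 : (0 : ℝ) < r := by exact_mod_cast hr.pos
  set T := (∏ r ∈ J, (1 - 1 / (r : ℝ))) * 2 ^ J.card * E with hT
  have h2 : ∀ i ∈ Finset.range (r - 1),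
      ‖∑ α ∈ sieved X G J, (1 * X r ^ (i + 1)) α‖ ≤ T := by
    intro i hi
    have hi' : i + 1 < r := by have := Finset.mem_range.1 hi; omega
    have hord : orderOf (X r ^ (i + 1)) ∣ r := by
      have := orderOf_pow_dvd (x := X r) (i + 1)
      rwa [hX] at this
    rw [one_mul]
    apply norm_sum_sieved_le G hG hE J hJ
    · intro h1
      have := Nat.le_of_dvd (Nat.succ_pos i) (orderOf_dvd_of_pow_eq_one h1)
      omega
    · intro s hs hdvd
      exact hrJ ((Nat.prime_dvd_prime_iff_eq (hJ s hs).1 hr).1 (hdvd.trans hord) ▸ hs)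
  have h3 : (((sieved X G (insert r J)).card - (1 - 1 / (r : ℝ)) * (sieved X G J).card : ℝ) : ℂ) =
      -(1 / (r : ℂ) * ∑ i ∈ Finset.range (r - 1),
        ∑ α ∈ sieved X G J, (1 * X r ^ (i + 1)) α) := by
    push_cast
    rw [h]
    ring
  rw [← Real.norm_eq_abs, ← Complex.norm_real, h3, norm_neg, norm_mul]
  have hn2 : ‖(1 / (r : ℂ))‖ = 1 / (r : ℝ) := by simp
  rw [hn2]
  calc _ ≤ 1 / (r : ℝ) * ((r - 1) * T) := by
        refine mul_le_mul_of_nonneg_left ?_ (by positivity)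
        refine (norm_sum_le _ _).trans ((Finset.sum_le_card_nsmul _ _ _ h2).trans ?_)
        rw [Finset.card_range, nsmul_eq_mul, Nat.cast_sub hr.one_le, Nat.cast_one]
    _ = _ := by
        field_simp

theorem abs_card_sieved_sub_le (G : Finset F) (hG : ∀ α ∈ G, α ≠ 0) {E : ℝ}
    (hE : ∀ χ : MulChar F ℂ, χ ≠ 1 → ‖∑ α ∈ G, χ α‖ ≤ E) (J : Finset ℕ)
    (hJ : ∀ r ∈ J, r.Prime ∧ orderOf (X r) = r) :
    |((sieved X G J).card : ℝ) - (∏ r ∈ J, (1 - 1 / (r : ℝ))) * G.card| ≤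
      (∏ r ∈ J, (1 - 1 / (r : ℝ))) * (2 ^ J.card - 1) * E := by
  classical
  induction J using Finset.induction_on with
  | empty => simp [sieved]
  | insert r J hrJ ih =>
    obtain ⟨hr, hX⟩ := hJ r (Finset.mem_insert_self _ _)
    have hJ' : ∀ r ∈ J, r.Prime ∧ orderOf (X r) = r :=
      fun s hs => hJ s (Finset.mem_insert_of_mem hs)
    have h1 := abs_card_sieved_insert_sub_le G hG hE J hJ' hr hX hrJ
    have h2 := ih hJ'
    have hnn : (0 : ℝ) ≤ 1 - 1 / r := by
      have : (1 : ℝ) ≤ r := by exact_mod_cast hr.one_le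
      rw [sub_nonneg, div_le_one (by linarith)]; exact this
    rw [Finset.prod_insert hrJ, Finset.card_insert_of_notMem hrJ]
    have h3 := mul_le_mul_of_nonneg_left h2 hnn
    rw [← abs_of_nonneg hnn, ← abs_mul, abs_of_nonneg hnn] at h3
    refine (abs_sub_le _ ((1 - 1 / (r : ℝ)) * (sieved X G J).card) _).trans ?_
    rw [mul_assoc, ← mul_sub]
    refine (add_le_add h1 h3).trans (le_of_eq ?_)
    ring

theorem exists_mem_of_sieve (T B : Finset F) (hT : ∀ α ∈ T, α ≠ 0) {E A : ℝ}
    (hE : ∀ χ : MulChar F ℂ, χ ≠ 1 → ‖∑ α ∈ T, χ α‖ ≤ E) (hA : A - E ≤ T.card)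
    (J K : Finset ℕ) (hJ : ∀ r ∈ J, r.Prime ∧ orderOf (X r) = r)
    (hK : ∀ r ∈ K, r.Prime ∧ orderOf (X r) = r ∧ r ∉ J)
    (hS : ∑ r ∈ K, 1 / (r : ℝ) ≤ 1)
    (hB : ((sieved X B J).card : ℝ) < (∏ r ∈ J, (1 - 1 / (r : ℝ))) *
      ((1 - ∑ r ∈ K, 1 / (r : ℝ)) * (A - 2 ^ J.card * E) -
        (K.card - ∑ r ∈ K, 1 / (r : ℝ)) * (2 ^ J.card * E))) :
    ∃ α ∈ T, α ∉ B ∧ (∀ r ∈ J, X r α ≠ 1) ∧ ∀ r ∈ K, X r α ≠ 1 := by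
  classical
  by_contra! hno
  set S := ∑ r ∈ K, 1 / (r : ℝ) with hSdef
  set θ := ∏ r ∈ J, (1 - 1 / (r : ℝ)) with hθ
  have hθ0 : 0 ≤ θ := prod_one_sub_inv_nonneg fun r hr => (hJ r hr).1
  set N : ℝ := ((sieved X T J).card : ℝ) with hN
  have h1 : N ≥ θ * (A - 2 ^ J.card * E) := by
    have h := (abs_le.1 (abs_card_sieved_sub_le T hT hE J hJ)).1
    have h' := mul_le_mul_of_nonneg_left hA hθ0
    rw [← hθ, ← hN] at h
    nlinarith
  have hsub : sieved X T J ⊆ sieved X B J ∪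
      K.biUnion fun r => (sieved X T J).filter fun α => X r α = 1 := by
    intro α hα
    have hα' := Finset.mem_filter.1 hα
    by_cases hb : α ∈ B
    · exact Finset.mem_union_left _ (Finset.mem_filter.2 ⟨hb, hα'.2⟩)
    · obtain ⟨r, hr, h⟩ := hno α hα'.1 hb hα'.2
      exact Finset.mem_union_right _ (Finset.mem_biUnion.2 ⟨r, hr, Finset.mem_filter.2 ⟨hα, h⟩⟩)
  have hbad : ∀ r ∈ K, (((sieved X T J).filter fun α => X r α = 1).card : ℝ) ≤
      1 / r * N + (1 - 1 / r) * (θ * 2 ^ J.card * E) := by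
    intro r hr
    obtain ⟨hrp, hX, hrJ⟩ := hK r hr
    have h := (abs_le.1 (abs_card_sieved_insert_sub_le T hT hE J hJ hrp hX hrJ)).1
    have h2 : sieved X T (insert r J) = (sieved X T J).filter fun α => ¬ X r α = 1 := by
      ext α
      simp only [sieved, Finset.mem_filter, Finset.forall_mem_insert]
      tauto
    have h3 := Finset.card_filter_add_card_filter_not (s := sieved X T J) (fun α => X r α = 1)
    rw [← h2] at h3
    have h4 : (((sieved X T J).filter fun α => X r α = 1).card : ℝ) +
      (sieved X T (insert r J)).card = N := by rw [hN]; exact_mod_cast h3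
    rw [← hN, ← hθ] at h
    linarith
  have h5 : N ≤ (sieved X B J).card +
      ∑ r ∈ K, (1 / (r : ℝ) * N + (1 - 1 / r) * (θ * 2 ^ J.card * E)) := by
    have := (Finset.card_le_card hsub).trans
      ((Finset.card_union_le _ _).trans (Nat.add_le_add_left Finset.card_biUnion_le _))
    have h6 : N ≤ (sieved X B J).card +
        ∑ r ∈ K, (((sieved X T J).filter fun α => X r α = 1).card : ℝ) := by
      rw [hN]; exact_mod_cast this
    exact h6.trans (by gcongr with r hr; exact hbad r hr)
  rw [Finset.sum_add_distrib, ← Finset.sum_mul, ← Finset.sum_mul, Finset.sum_sub_distrib,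
    Finset.sum_const, nsmul_eq_mul, mul_one, ← hSdef] at h5
  have h7 := mul_le_mul_of_nonneg_left h1 (sub_nonneg.2 hS)
  nlinarith

end SieveCount

section TraceForm

variable (k F : Type*) [Field k] [Fintype k] [Field F] [Fintype F] [Algebra k F]

theorem exists_mulChar_orderOf_prime (F : Type*) [Field F] [Fintype F] :
    ∃ X : ℕ → MulChar F ℂ, ∀ r, r.Prime → r ∣ Fintype.card F - 1 → orderOf (X r) = r := by
  have h : ∀ r, ∃ χ : MulChar F ℂ, r.Prime → r ∣ Fintype.card F - 1 → orderOf χ = r := by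
    intro r
    by_cases hr : r.Prime ∧ r ∣ Fintype.card F - 1
    · obtain ⟨χ, hχ⟩ := MulChar.exists_mulChar_orderOf F hr.2
        (Complex.isPrimitiveRoot_exp r hr.1.ne_zero)
      exact ⟨χ, fun _ _ => hχ⟩
    · exact ⟨1, fun h1 h2 => absurd ⟨h1, h2⟩ hr⟩
  choose X hX using h
  exact ⟨X, hX⟩

variable {k F}

theorem mulChar_pow_eq_one_of_orderOf {F : Type*} [Field F] {χ : MulChar F ℂ} {r : ℕ}
    (hχ : orderOf χ = r) {β : F}
    (hβ : β ≠ 0) : χ (β ^ r) = 1 := by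
  have h : (χ ^ r) β = χ β ^ r := by
    simpa using MulChar.pow_apply_coe χ r (Units.mk0 β hβ)
  rw [map_pow, ← h, ← hχ, pow_orderOf_eq_one, MulChar.one_apply (isUnit_iff_ne_zero.2 hβ)]

/-- The number of common zeros of `Tr x` and `Tr (γ x)`. -/
theorem card_trace_eq_zero_and_trace_mul_eq_zero [DecidableEq F] [DecidableEq k] {γ : F}
    (hγ : γ ∉ Set.range (algebraMap k F)) :
    (Finset.univ.filter fun x : F => Algebra.trace k F x = 0 ∧
      Algebra.trace k F (γ * x) = 0).card * Fintype.card k ^ 2 = Fintype.card F := by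
  have hli : LinearIndependent k ![(1 : F), γ] := by
    rw [LinearIndependent.pair_iff]
    intro s t h
    have ht : t = 0 := by
      by_contra ht
      apply hγ
      refine ⟨-s / t, ?_⟩
      have hm : algebraMap k F t ≠ 0 := by simpa using ht
      rw [map_div₀, map_neg, div_eq_iff hm]
      rw [Algebra.smul_def, Algebra.smul_def] at h
      linear_combination -h
    subst ht
    simpa using h
  let U := Submodule.span k (Set.range ![(1 : F), γ])
  have hU : Module.finrank k U = 2 := by
    simpa using finrank_span_eq_card hli
  have hnd := traceForm_nondegenerate k F
  have hfin := LinearMap.BilinForm.finrank_orthogonal hnd U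
  have hle : Module.finrank k U ≤ Module.finrank k F := Submodule.finrank_le U
  set V := (Algebra.traceForm k F).orthogonal U with hV
  have hmem : ∀ x, x ∈ V ↔ Algebra.trace k F x = 0 ∧ Algebra.trace k F (γ * x) = 0 := by
    intro x
    rw [hV, LinearMap.BilinForm.mem_orthogonal_iff]
    constructor
    · intro h
      constructor
      · simpa [Algebra.traceForm_apply] using
          h 1 (Submodule.subset_span ⟨0, rfl⟩)
      · simpa [Algebra.traceForm_apply] using
          h γ (Submodule.subset_span ⟨1, rfl⟩)
    · rintro ⟨h1, h2⟩ y hy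
      induction hy using Submodule.span_induction with
      | mem y hy =>
        obtain ⟨i, rfl⟩ := hy
        fin_cases i
        · simpa [Algebra.traceForm_apply] using h1
        · simpa [Algebra.traceForm_apply] using h2
      | zero => simp
      | add a b _ _ ha hb =>
        simp only [map_add, LinearMap.add_apply] at *
        rw [ha, hb, add_zero]
      | smul c a _ ha =>
        simp only [map_smul, LinearMap.smul_apply] at *
        rw [ha, smul_zero]
  have hcard : (Finset.univ.filter fun x : F => Algebra.trace k F x = 0 ∧
      Algebra.trace k F (γ * x) = 0).card = Nat.card V := by
    rw [← Fintype.card_subtype, ← Nat.card_eq_fintype_card]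
    exact Nat.card_congr (Equiv.subtypeEquivRight fun x => (hmem x).symm)
  rw [hcard, Module.natCard_eq_pow_finrank (K := k), Nat.card_eq_fintype_card,
    Module.card_eq_pow_finrank (K := k) (V := F), hfin, hU, ← pow_add]
  congr 1
  omega

/-- A subspace of codimension at least two inside the kernel of the trace is contained in the
kernel of `x ↦ Tr (γ x)` for some `γ` outside the base field. -/
theorem exists_trace_mul_eq_zero (U : Submodule k F)
    (hU : Module.finrank k U + 2 ≤ Module.finrank k F) :
    ∃ γ : F, γ ∉ Set.range (algebraMap k F) ∧ ∀ x ∈ U, Algebra.trace k F (γ * x) = 0 := by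
  have hnd := traceForm_nondegenerate k F
  have hfin := LinearMap.BilinForm.finrank_orthogonal hnd U
  set V := (Algebra.traceForm k F).orthogonal U with hV
  obtain ⟨γ, hγV, hγ⟩ : ∃ γ ∈ V, γ ∉ Submodule.span k {(1 : F)} := by
    by_contra! h
    have h1 : V ≤ Submodule.span k {(1 : F)} := h
    have h2 := (Submodule.finrank_mono h1).trans (finrank_span_singleton (one_ne_zero)).le
    omega
  refine ⟨γ, ?_, fun x hx => ?_⟩
  · rintro ⟨c, rfl⟩
    exact hγ (Submodule.mem_span_singleton.2 ⟨c, by rw [Algebra.smul_def, mul_one]⟩)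
  · have := LinearMap.BilinForm.mem_orthogonal_iff.1 hγV x hx
    rw [Algebra.traceForm_apply] at this
    rwa [mul_comm]

end TraceForm

section Criteria

variable {k F : Type*} [Field k] [Fintype k] [Field F] [Fintype F] [Algebra k F]
  [DecidableEq F] [DecidableEq k]

variable (k F) in
/-- The nonzero elements of trace zero whose inverse has trace zero. -/
noncomputable def biTraceZero : Finset F :=
  Finset.univ.filter fun α => α ≠ 0 ∧ Algebra.trace k F α = 0 ∧ Algebra.trace k F α⁻¹ = 0

theorem biTraceZero_eq_traceSet : biTraceZero k F =
    traceSet (W := k × k) ((Algebra.linearMap k F).comp (LinearMap.fst k k k))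
      ((Algebra.linearMap k F).comp (LinearMap.snd k k k)) := by
  ext α
  simp only [biTraceZero, traceSet, Finset.mem_filter, Finset.mem_univ, true_and,
    LinearMap.comp_apply, Algebra.linearMap_apply, map_add, ← Algebra.smul_def, map_smul]
  refine and_congr_right fun _ => ⟨fun h w => by simp [h], fun h => ⟨?_, ?_⟩⟩
  · simpa using h (1, 0)
  · simpa using h (0, 1)

theorem biTraceZero_filter_eq_traceSet (γ : F) :
    (biTraceZero k F).filter (fun α => Algebra.trace k F (γ * α) = 0) =
    traceSet (W := k × k × k) ((Algebra.linearMap k F).comp (LinearMap.fst k k (k × k)) +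
        (LinearMap.mulRight k γ).comp ((Algebra.linearMap k F).comp
          ((LinearMap.snd k k k).comp (LinearMap.snd k k (k × k)))))
      ((Algebra.linearMap k F).comp ((LinearMap.fst k k k).comp (LinearMap.snd k k (k × k)))) := by
  ext α
  simp only [biTraceZero, traceSet, Finset.mem_filter, Finset.mem_univ, true_and,
    LinearMap.comp_apply, LinearMap.add_apply, LinearMap.mulRight_apply,
    Algebra.linearMap_apply, map_add, ← Algebra.smul_def, map_smul, add_mul, smul_mul_assoc]
  rw [and_assoc]
  refine and_congr_right fun _ => ⟨fun h w => by simp [h], fun h => ⟨⟨?_, ?_⟩, ?_⟩⟩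
  · simpa using h (1, 0, 0)
  · simpa using h (0, 1, 0)
  · simpa using h (0, 0, 1)

theorem biTraceZero_filter_inv_eq_traceSet (γ : F) :
    (biTraceZero k F).filter (fun α => Algebra.trace k F (γ * α⁻¹) = 0) =
    traceSet (W := k × k × k)
      ((Algebra.linearMap k F).comp ((LinearMap.fst k k k).comp (LinearMap.snd k k (k × k))))
      ((Algebra.linearMap k F).comp (LinearMap.fst k k (k × k)) +
        (LinearMap.mulRight k γ).comp ((Algebra.linearMap k F).comp
          ((LinearMap.snd k k k).comp (LinearMap.snd k k (k × k))))) := by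
  ext α
  simp only [biTraceZero, traceSet, Finset.mem_filter, Finset.mem_univ, true_and,
    LinearMap.comp_apply, LinearMap.add_apply, LinearMap.mulRight_apply,
    Algebra.linearMap_apply, map_add, ← Algebra.smul_def, map_smul, add_mul, smul_mul_assoc]
  rw [and_assoc]
  refine and_congr_right fun _ => ⟨fun h w => by simp [h], fun h => ⟨⟨?_, ?_⟩, ?_⟩⟩
  · simpa using h (0, 1, 0)
  · simpa using h (1, 0, 0)
  · simpa using h (0, 0, 1)

theorem ne_zero_of_mem_biTraceZero {k F : Type*} [Field k] [Field F] [Fintype F] [Algebra k F]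
    [DecidableEq F] [DecidableEq k] {α : F} (h : α ∈ biTraceZero k F) : α ≠ 0 :=
  (Finset.mem_filter.1 h).2.1

theorem le_card_biTraceZero : (Fintype.card F : ℝ) / Fintype.card k ^ 2 - 2 * √(Fintype.card F) ≤
    (biTraceZero k F).card := by
  rw [biTraceZero_eq_traceSet]
  have h := abs_card_traceSet_sub_le ((Algebra.linearMap k F).comp (LinearMap.fst k k k))
      ((Algebra.linearMap k F).comp (LinearMap.snd k k k)) (fun w h1 h2 => by
        ext
        · simpa using h1
        · simpa using h2)
  rw [Fintype.card_prod, Nat.cast_mul, ← sq] at h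
  linarith [(abs_le.1 h).1]

theorem eq_zero_of_smul_add {k F : Type*} [Field k] [Field F] [Algebra k F] {γ : F}
    (hγ : γ ∉ Set.range (algebraMap k F)) {s t : k}
    (h : algebraMap k F s + algebraMap k F t * γ = 0) : s = 0 ∧ t = 0 := by
  have ht : t = 0 := by
    by_contra ht
    apply hγ
    refine ⟨-s / t, ?_⟩
    have hm : algebraMap k F t ≠ 0 := by simpa using ht
    rw [map_div₀, map_neg, div_eq_iff hm]
    linear_combination -h
  subst ht
  simpa using h

theorem card_biTraceZero_filter_le {γ : F} (hγ : γ ∉ Set.range (algebraMap k F)) :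
    (((biTraceZero k F).filter fun α => Algebra.trace k F (γ * α) = 0).card : ℝ) ≤
      Fintype.card F / Fintype.card k ^ 3 + 2 * √(Fintype.card F) := by
  rw [biTraceZero_filter_eq_traceSet]
  have h := abs_card_traceSet_sub_le ((Algebra.linearMap k F).comp (LinearMap.fst k k (k × k)) +
        (LinearMap.mulRight k γ).comp ((Algebra.linearMap k F).comp
          ((LinearMap.snd k k k).comp (LinearMap.snd k k (k × k)))))
      ((Algebra.linearMap k F).comp ((LinearMap.fst k k k).comp (LinearMap.snd k k (k × k))))
      (fun w h1 h2 => by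
        obtain ⟨h3, h4⟩ := eq_zero_of_smul_add hγ h1
        ext
        · exact h3
        · simpa using h2
        · exact h4)
  simp only [Fintype.card_prod, Nat.cast_mul] at h
  rw [show (Fintype.card k : ℝ) ^ 3 = Fintype.card k * (Fintype.card k * Fintype.card k) by ring]
  linarith [(abs_le.1 h).2]

theorem card_biTraceZero_filter_inv {k F : Type*} [Field k] [Field F] [Fintype F] [Algebra k F]
    [DecidableEq F] [DecidableEq k] (γ : F) :
    ((biTraceZero k F).filter fun α => Algebra.trace k F (γ * α⁻¹) = 0).card =
      ((biTraceZero k F).filter fun α => Algebra.trace k F (γ * α) = 0).card := by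
  refine Finset.card_bij (fun α _ => α⁻¹) ?_ ?_ ?_
  · intro α hα
    simp only [biTraceZero, Finset.mem_filter, Finset.mem_univ, true_and, inv_inv, ne_eq,
      inv_eq_zero] at hα ⊢
    tauto
  · intro a _ b _ h
    exact inv_injective h
  · intro b hb
    refine ⟨b⁻¹, ?_, inv_inv b⟩
    simp only [biTraceZero, Finset.mem_filter, Finset.mem_univ, true_and, inv_inv, ne_eq,
      inv_eq_zero] at hb ⊢
    tauto

/-- The elements of `biTraceZero k F` failing one of the trace conditions given by `Γ`. -/
noncomputable def badSet (k : Type*) {F : Type*} [Field k] [Field F] [Fintype F] [Algebra k F]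
    [DecidableEq F] [DecidableEq k] (Γ : Finset F) : Finset F :=
  Γ.biUnion fun γ => (biTraceZero k F).filter (fun α => Algebra.trace k F (γ * α) = 0) ∪
    (biTraceZero k F).filter fun α => Algebra.trace k F (γ * α⁻¹) = 0

theorem card_sieved_badSet_le {k F : Type*} [Field k] [Field F] [Fintype F] [Algebra k F]
    [DecidableEq F] [DecidableEq k] (X : ℕ → MulChar F ℂ) (J : Finset ℕ) (Γ : Finset F) {c : ℝ}
    (h1 : ∀ γ ∈ Γ, ((sieved X ((biTraceZero k F).filter
      fun α => Algebra.trace k F (γ * α) = 0) J).card : ℝ) ≤ c)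
    (h2 : ∀ γ ∈ Γ, ((sieved X ((biTraceZero k F).filter
      fun α => Algebra.trace k F (γ * α⁻¹) = 0) J).card : ℝ) ≤ c) :
    ((sieved X (badSet k Γ) J).card : ℝ) ≤ Γ.card * (2 * c) := by
  have hsub : sieved X (badSet k Γ) J ⊆ Γ.biUnion fun γ =>
      sieved X ((biTraceZero k F).filter fun α => Algebra.trace k F (γ * α) = 0) J ∪
      sieved X ((biTraceZero k F).filter fun α => Algebra.trace k F (γ * α⁻¹) = 0) J := by
    intro α hα
    simp only [sieved, badSet, Finset.mem_filter, Finset.mem_biUnion, Finset.mem_union] at hα ⊢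
    obtain ⟨⟨γ, hγ, h⟩, hJ⟩ := hα
    exact ⟨γ, hγ, by tauto⟩
  have h3 : ((sieved X (badSet k Γ) J).card : ℝ) ≤ ∑ γ ∈ Γ,
      (((sieved X ((biTraceZero k F).filter fun α => Algebra.trace k F (γ * α) = 0) J).card : ℝ) +
      (sieved X ((biTraceZero k F).filter fun α => Algebra.trace k F (γ * α⁻¹) = 0) J).card) := by
    have := (Finset.card_le_card hsub).trans (Finset.card_biUnion_le.trans
      (Finset.sum_le_sum fun γ _ => Finset.card_union_le _ _))
    exact_mod_cast this
  refine h3.trans ((Finset.sum_le_card_nsmul _ _ (2 * c) fun γ hγ => ?_).trans ?_)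
  · linarith [h1 γ hγ, h2 γ hγ]
  · rw [nsmul_eq_mul]

theorem exists_of_card_sieved_badSet_lt (Γ : Finset F) {X : ℕ → MulChar F ℂ}
    (hX : ∀ r, r.Prime → r ∣ Fintype.card F - 1 → orderOf (X r) = r) (J K : Finset ℕ)
    (hJ : ∀ r ∈ J, r.Prime ∧ r ∣ Fintype.card F - 1)
    (hK : ∀ r ∈ K, r.Prime ∧ r ∣ Fintype.card F - 1 ∧ r ∉ J)
    (hS : ∑ r ∈ K, 1 / (r : ℝ) ≤ 1)
    (hB : ((sieved X (badSet k Γ) J).card : ℝ) < (∏ r ∈ J, (1 - 1 / (r : ℝ))) *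
      ((1 - ∑ r ∈ K, 1 / (r : ℝ)) *
        ((Fintype.card F : ℝ) / Fintype.card k ^ 2 - 2 ^ J.card * (2 * √(Fintype.card F))) -
        (K.card - ∑ r ∈ K, 1 / (r : ℝ)) * (2 ^ J.card * (2 * √(Fintype.card F))))) :
    ∃ α : F, α ≠ 0 ∧ Algebra.trace k F α = 0 ∧ Algebra.trace k F α⁻¹ = 0 ∧
      (∀ γ ∈ Γ, Algebra.trace k F (γ * α) ≠ 0 ∧ Algebra.trace k F (γ * α⁻¹) ≠ 0) ∧
      ∀ r ∈ J ∪ K, ∀ β, β ^ r ≠ α := by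
  obtain ⟨α, hαT, hαB, h1, h2⟩ := exists_mem_of_sieve (biTraceZero k F) (badSet k Γ)
    (fun α => ne_zero_of_mem_biTraceZero)
    (fun χ hχ => by rw [biTraceZero_eq_traceSet]; exact norm_sum_traceSet_le _ _ hχ)
    le_card_biTraceZero J K (fun r hr => ⟨(hJ r hr).1, hX r (hJ r hr).1 (hJ r hr).2⟩)
    (fun r hr => ⟨(hK r hr).1, hX r (hK r hr).1 (hK r hr).2.1, (hK r hr).2.2⟩) hS hB
  have hα := (Finset.mem_filter.1 hαT).2
  refine ⟨α, hα.1, hα.2.1, hα.2.2, fun γ hγ => ?_, fun r hr β hβ => ?_⟩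
  · constructor <;> intro h <;> apply hαB <;>
      refine Finset.mem_biUnion.2 ⟨γ, hγ, Finset.mem_union.2 ?_⟩
    · exact Or.inl (Finset.mem_filter.2 ⟨hαT, h⟩)
    · exact Or.inr (Finset.mem_filter.2 ⟨hαT, h⟩)
  · have hr' : r.Prime ∧ r ∣ Fintype.card F - 1 ∧ X r α ≠ 1 := by
      rcases Finset.mem_union.1 hr with h | h
      · exact ⟨(hJ r h).1, (hJ r h).2, h1 r h⟩
      · exact ⟨(hK r h).1, (hK r h).2.1, h2 r h⟩
    have hβ0 : β ≠ 0 := by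
      rintro rfl
      rw [zero_pow hr'.1.ne_zero] at hβ
      exact hα.1 hβ.symm
    exact hr'.2.2 (hβ ▸ mulChar_pow_eq_one_of_orderOf (hX r hr'.1 hr'.2.1) hβ0)

/-- Sieve criterion with the primes of `J` treated exactly and those of `K` sieved. -/
theorem exists_of_prime_sieve (Γ : Finset F) (hΓ : ∀ γ ∈ Γ, γ ∉ Set.range (algebraMap k F))
    (J K : Finset ℕ) (hJ : ∀ r ∈ J, r.Prime ∧ r ∣ Fintype.card F - 1)
    (hK : ∀ r ∈ K, r.Prime ∧ r ∣ Fintype.card F - 1 ∧ r ∉ J)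
    (h : 2 * 2 ^ J.card * (K.card + 2 * Γ.card + 1) * (Fintype.card k : ℝ) ^ 2 <
      √(Fintype.card F) * (1 - ∑ r ∈ K, 1 / (r : ℝ) - 2 * Γ.card / Fintype.card k)) :
    ∃ α : F, α ≠ 0 ∧ Algebra.trace k F α = 0 ∧ Algebra.trace k F α⁻¹ = 0 ∧
      (∀ γ ∈ Γ, Algebra.trace k F (γ * α) ≠ 0 ∧ Algebra.trace k F (γ * α⁻¹) ≠ 0) ∧
      ∀ r ∈ J ∪ K, ∀ β, β ^ r ≠ α := by
  obtain ⟨X, hX⟩ := exists_mulChar_orderOf_prime F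
  have hJX : ∀ r ∈ J, r.Prime ∧ orderOf (X r) = r :=
    fun r hr => ⟨(hJ r hr).1, hX r (hJ r hr).1 (hJ r hr).2⟩
  set θ := ∏ r ∈ J, (1 - 1 / (r : ℝ)) with hθ
  have hθ0 : 0 < θ := prod_one_sub_inv_pos fun r hr => (hJ r hr).1
  have hq : (0 : ℝ) < Fintype.card k := by exact_mod_cast Fintype.card_pos
  set Q : ℝ := (Fintype.card F : ℝ) with hQdef
  have hQ : (0 : ℝ) < Q := by rw [hQdef]; exact_mod_cast Fintype.card_pos
  have hsq : √Q * √Q = Q := Real.mul_self_sqrt hQ.le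
  have hs : 0 < √Q := Real.sqrt_pos.2 hQ
  set S := ∑ r ∈ K, 1 / (r : ℝ) with hS
  have hS0 : 0 ≤ S := Finset.sum_nonneg fun r _ => by positivity
  have hpos : 0 < 1 - S - 2 * Γ.card / Fintype.card k := by
    by_contra! hneg
    have : (0 : ℝ) ≤ 2 * 2 ^ J.card * (K.card + 2 * Γ.card + 1) * (Fintype.card k : ℝ) ^ 2 := by
      positivity
    nlinarith
  have hΓ0 : (0 : ℝ) ≤ 2 * Γ.card / Fintype.card k := by positivity
  have hbound : ∀ G : Finset F, (∀ α ∈ G, α ≠ 0) →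
      (∀ χ : MulChar F ℂ, χ ≠ 1 → ‖∑ α ∈ G, χ α‖ ≤ 2 * √Q) →
      (G.card : ℝ) ≤ Q / Fintype.card k ^ 3 + 2 * √Q →
      ((sieved X G J).card : ℝ) ≤ θ * (Q / Fintype.card k ^ 3 + 2 ^ J.card * (2 * √Q)) := by
    intro G hG hE hc
    have h1 := (abs_le.1 (abs_card_sieved_sub_le G hG hE J hJX)).2
    have h2 := mul_le_mul_of_nonneg_left hc hθ0.le
    rw [← hθ] at h1
    linarith
  have hB := card_sieved_badSet_le (k := k) X J Γ
    (c := θ * (Q / Fintype.card k ^ 3 + 2 ^ J.card * (2 * √Q)))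
    (fun γ hγ => hbound _ (fun α hα => ne_zero_of_mem_biTraceZero (Finset.mem_filter.1 hα).1)
      (fun χ hχ => by rw [biTraceZero_filter_eq_traceSet]; exact norm_sum_traceSet_le _ _ hχ)
      (card_biTraceZero_filter_le (hΓ γ hγ)))
    (fun γ hγ => hbound _ (fun α hα => ne_zero_of_mem_biTraceZero (Finset.mem_filter.1 hα).1)
      (fun χ hχ => by rw [biTraceZero_filter_inv_eq_traceSet]; exact norm_sum_traceSet_le _ _ hχ)
      (by rw [card_biTraceZero_filter_inv]; exact card_biTraceZero_filter_le (hΓ γ hγ)))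
  refine exists_of_card_sieved_badSet_lt Γ hX J K hJ hK (by linarith) (hB.trans_lt ?_)
  rw [← hθ, ← hS, ← hQdef]
  set w : ℝ := 2 ^ J.card with hw
  have hw0 : 0 < w := by positivity
  rw [show (Γ.card : ℝ) * (2 * (θ * (Q / Fintype.card k ^ 3 + w * (2 * √Q)))) =
    θ * (Γ.card * (2 * (Q / Fintype.card k ^ 3 + w * (2 * √Q)))) by ring]
  refine mul_lt_mul_of_pos_left ?_ hθ0
  have h' : 2 * w * (K.card + 2 * Γ.card + 1) * √Q <
      Q / Fintype.card k ^ 2 * (1 - S - 2 * Γ.card / Fintype.card k) := by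
    rw [div_mul_eq_mul_div, lt_div_iff₀ (by positivity)]
    have := mul_lt_mul_of_pos_right h hs
    calc _ = 2 * w * (K.card + 2 * Γ.card + 1) * (Fintype.card k : ℝ) ^ 2 * √Q := by ring
      _ < _ := this
      _ = _ := by rw [mul_right_comm, hsq]
  have h3 : Q / Fintype.card k ^ 2 * (2 * Γ.card / Fintype.card k) =
      2 * Γ.card * (Q / (Fintype.card k : ℝ) ^ 3) := by field_simp
  have h4 : 0 ≤ S * (w * √Q) := by positivity
  nlinarith

end Criteria

section LineCount

variable {k F : Type*} [Field k] [Fintype k] [Field F] [Fintype F] [Algebra k F]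

/-- The polynomial `t ↦ N (u + t v) Tr ((u + t v)⁻¹)` on the line through `u` in direction `v`. -/
noncomputable def lineInvTrace (q n : ℕ) (u v : F) : F[X] :=
  ∑ i ∈ Finset.range n, ∏ j ∈ (Finset.range n).erase i, (C (v ^ q ^ j) * X + C (u ^ q ^ j))

theorem sum_prod_erase_eq {F : Type*} [Field F] {n : ℕ} (a : ℕ → F) (ha : ∀ j, a j ≠ 0) :
    ∑ i ∈ Finset.range n, ∏ j ∈ (Finset.range n).erase i, a j =
      (∏ j ∈ Finset.range n, a j) * ∑ i ∈ Finset.range n, (a i)⁻¹ := by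
  rw [Finset.mul_sum]
  refine Finset.sum_congr rfl fun i hi => ?_
  rw [← Finset.mul_prod_erase _ _ hi]
  field_simp [ha i]

theorem sum_prod_erase_pow_eq_zero_iff {x : F} (hx : x ≠ 0) :
    ∑ i ∈ Finset.range (Module.finrank k F), ∏ j ∈ (Finset.range (Module.finrank k F)).erase i,
      x ^ Fintype.card k ^ j = 0 ↔ Algebra.trace k F x⁻¹ = 0 := by
  rw [sum_prod_erase_eq _ fun j => pow_ne_zero _ hx, mul_eq_zero,
    or_iff_right (Finset.prod_ne_zero_iff.2 fun j _ => pow_ne_zero _ hx)]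
  rw [← map_eq_zero (algebraMap k F), FiniteField.algebraMap_trace_eq_sum_pow,
    Nat.card_eq_fintype_card]
  simp only [inv_pow]

theorem natDegree_lineInvTrace_le {F : Type*} [Field F] (q n : ℕ) (u v : F) :
    (lineInvTrace q n u v).natDegree ≤ n - 1 := by
  refine natDegree_sum_le_of_forall_le _ _ fun i hi => ?_
  refine (natDegree_prod_le _ _).trans ?_
  refine (Finset.sum_le_card_nsmul _ _ 1 fun j _ => natDegree_linear_le).trans ?_
  rw [Finset.card_erase_of_mem hi, Finset.card_range, smul_eq_mul, mul_one]

theorem coeff_lineInvTrace {F : Type*} [Field F] (q n : ℕ) (u v : F) :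
    (lineInvTrace q n u v).coeff (n - 1) =
      ∑ i ∈ Finset.range n, ∏ j ∈ (Finset.range n).erase i, v ^ q ^ j := by
  rw [lineInvTrace, finsetSum_coeff]
  refine Finset.sum_congr rfl fun i hi => ?_
  have h := coeff_prod_of_natDegree_le (s := (Finset.range n).erase i)
    (f := fun j => C (v ^ q ^ j) * X + C (u ^ q ^ j)) (n := 1)
    (fun j _ => natDegree_linear_le)
  rw [Finset.card_erase_of_mem hi, Finset.card_range, mul_one] at h
  rw [h]
  refine Finset.prod_congr rfl fun j _ => ?_
  rw [coeff_add, coeff_C_mul, coeff_X_one, coeff_C_of_ne_zero one_ne_zero, mul_one, add_zero]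

theorem frobeniusAlgHom_pow_apply {k F : Type*} [Field k] [Fintype k] [Field F] [Algebra k F]
    (j : ℕ) (x : F) :
    ((FiniteField.frobeniusAlgHom k F) ^ j) x = x ^ Fintype.card k ^ j := by
  induction j generalizing x with
  | zero => simp
  | succ j ih =>
    rw [pow_succ, AlgHom.mul_apply, ih, FiniteField.frobeniusAlgHom_apply, ← pow_mul,
      pow_succ']

theorem eval_lineInvTrace {k F : Type*} [Field k] [Fintype k] [Field F] [Algebra k F]
    (n : ℕ) (u v : F) (t : k) :
    (lineInvTrace (Fintype.card k) n u v).eval (algebraMap k F t) =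
      ∑ i ∈ Finset.range n, ∏ j ∈ (Finset.range n).erase i,
        (u + algebraMap k F t * v) ^ Fintype.card k ^ j := by
  have hfrob : ∀ j, (u + algebraMap k F t * v) ^ Fintype.card k ^ j =
      v ^ Fintype.card k ^ j * algebraMap k F t + u ^ Fintype.card k ^ j := by
    intro j
    rw [← frobeniusAlgHom_pow_apply, map_add, map_mul, AlgHom.commutes,
      frobeniusAlgHom_pow_apply, frobeniusAlgHom_pow_apply]
    ring
  simp only [lineInvTrace, eval_finsetSum, eval_prod, eval_add, eval_mul, eval_C, eval_X, hfrob]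

variable [DecidableEq F] [DecidableEq k]

/-- Counting along lines. -/
theorem card_mul_card_filter_le {γ v : F} (hv0 : v ≠ 0) (hv1 : Algebra.trace k F v = 0)
    (hv2 : Algebra.trace k F (γ * v) = 0) (hv3 : Algebra.trace k F v⁻¹ ≠ 0) :
    Fintype.card k * ((biTraceZero k F).filter fun α => Algebra.trace k F (γ * α) = 0).card ≤
      (Module.finrank k F - 1) * (Finset.univ.filter fun x : F => Algebra.trace k F x = 0 ∧
        Algebra.trace k F (γ * x) = 0).card := by
  set G := (biTraceZero k F).filter fun α => Algebra.trace k F (γ * α) = 0 with hG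
  set V := Finset.univ.filter fun x : F => Algebra.trace k F x = 0 ∧
        Algebra.trace k F (γ * x) = 0 with hV
  have hline : ∀ u ∈ V, (Finset.univ.filter fun t : k => u + algebraMap k F t * v ∈ G).card ≤
      Module.finrank k F - 1 := by
    intro u hu
    set P := lineInvTrace (Fintype.card k) (Module.finrank k F) u v with hP
    have hP0 : P ≠ 0 := by
      intro h0
      have h1 := coeff_lineInvTrace (Fintype.card k) (Module.finrank k F) u v
      rw [← hP, h0, coeff_zero] at h1
      exact hv3 ((sum_prod_erase_pow_eq_zero_iff hv0).1 h1.symm)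
    have hsub : ((Finset.univ.filter fun t : k => u + algebraMap k F t * v ∈ G).map
        ⟨algebraMap k F, (algebraMap k F).injective⟩) ⊆ P.roots.toFinset := by
      intro y hy
      obtain ⟨t, ht, rfl⟩ := Finset.mem_map.1 hy
      have ht' := (Finset.mem_filter.1 ht).2
      have ht2 := (Finset.mem_filter.1 (Finset.mem_filter.1 ht').1).2
      rw [Multiset.mem_toFinset, mem_roots hP0, IsRoot.def, hP]
      change (lineInvTrace _ _ u v).eval (algebraMap k F t) = 0
      rw [eval_lineInvTrace]
      exact (sum_prod_erase_pow_eq_zero_iff ht2.1).2 ht2.2.2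
    have h2 := Finset.card_le_card hsub
    rw [Finset.card_map] at h2
    exact h2.trans ((Multiset.toFinset_card_le _).trans ((card_roots' P).trans
      (natDegree_lineInvTrace_le _ _ _ _)))
  have hcount : Fintype.card k * G.card =
      ∑ u ∈ V, (Finset.univ.filter fun t : k => u + algebraMap k F t * v ∈ G).card := by
    have h3 : ∀ t : k, (V.filter fun u => u + algebraMap k F t * v ∈ G).card = G.card := by
      intro t
      refine Finset.card_bij (fun u _ => u + algebraMap k F t * v)
        (fun u hu => (Finset.mem_filter.1 hu).2) (fun a _ b _ h => add_right_cancel h) ?_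
      intro x hx
      refine ⟨x - algebraMap k F t * v, ?_, by ring⟩
      have hx' := (Finset.mem_filter.1 hx)
      have hx2 := (Finset.mem_filter.1 hx'.1).2
      refine Finset.mem_filter.2 ⟨Finset.mem_filter.2 ⟨Finset.mem_univ _, ?_, ?_⟩, ?_⟩
      · rw [map_sub, ← Algebra.smul_def, map_smul, hx2.2.1, hv1]; simp
      · rw [mul_sub, map_sub, ← Algebra.smul_def, mul_smul_comm, map_smul, hx'.2, hv2]; simp
      · rwa [sub_add_cancel]
    have h4 := Finset.sum_card_bipartiteAbove_eq_sum_card_bipartiteBelow (s := V)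
      (t := (Finset.univ : Finset k)) (fun u t => u + algebraMap k F t * v ∈ G)
    simp only [Finset.bipartiteAbove, Finset.bipartiteBelow, h3, Finset.sum_const,
      Finset.card_univ, smul_eq_mul] at h4
    exact h4.symm
  rw [hcount, mul_comm]
  exact Finset.sum_le_card_nsmul _ _ _ hline

theorem card_biTraceZero_filter_le_of_line {γ : F} (hγ : γ ∉ Set.range (algebraMap k F))
    (hlarge : (Fintype.card F : ℝ) / Fintype.card k ^ 3 + 2 * √(Fintype.card F) + 1 <
      Fintype.card F / Fintype.card k ^ 2) :
    (((biTraceZero k F).filter fun α => Algebra.trace k F (γ * α) = 0).card : ℝ) ≤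
      ((Module.finrank k F : ℝ) - 1) * (Fintype.card F / Fintype.card k ^ 3) := by
  have hq : (0 : ℝ) < Fintype.card k := by exact_mod_cast Fintype.card_pos
  have hVc := card_trace_eq_zero_and_trace_mul_eq_zero hγ
  set V := Finset.univ.filter fun x : F => Algebra.trace k F x = 0 ∧
        Algebra.trace k F (γ * x) = 0 with hV
  have hVr : (V.card : ℝ) = Fintype.card F / Fintype.card k ^ 2 := by
    rw [eq_div_iff (by positivity)]
    exact_mod_cast hVc
  obtain ⟨v, hvV, hv0, hv3⟩ : ∃ v ∈ V, v ≠ 0 ∧ Algebra.trace k F v⁻¹ ≠ 0 := by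
    by_contra! h
    have hsub : V ⊆ insert 0 ((biTraceZero k F).filter
        fun α => Algebra.trace k F (γ * α) = 0) := by
      intro x hx
      have hx' := (Finset.mem_filter.1 hx).2
      by_cases hx0 : x = 0
      · exact Finset.mem_insert.2 (Or.inl hx0)
      · exact Finset.mem_insert_of_mem (Finset.mem_filter.2 ⟨Finset.mem_filter.2
          ⟨Finset.mem_univ _, hx0, hx'.1, h x hx hx0⟩, hx'.2⟩)
    have h1 := (Finset.card_le_card hsub).trans (Finset.card_insert_le _ _)
    have h2 : (V.card : ℝ) ≤ ((biTraceZero k F).filter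
        fun α => Algebra.trace k F (γ * α) = 0).card + 1 := by exact_mod_cast h1
    linarith [card_biTraceZero_filter_le hγ]
  have hv := (Finset.mem_filter.1 hvV).2
  have h := card_mul_card_filter_le hv0 hv.1 hv.2 hv3
  have h1 : (Fintype.card k : ℝ) * ((biTraceZero k F).filter
      fun α => Algebra.trace k F (γ * α) = 0).card ≤ ((Module.finrank k F : ℝ) - 1) * V.card := by
    rw [← Nat.cast_one, ← Nat.cast_sub Module.finrank_pos]
    exact_mod_cast h
  rw [hVr] at h1
  refine le_of_mul_le_mul_left (h1.trans (le_of_eq ?_)) hq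
  field_simp

/-- Sieve criterion without exactly treated primes, using the count along lines. -/
theorem exists_of_prime_sieve_of_line (Γ : Finset F)
    (hΓ : ∀ γ ∈ Γ, γ ∉ Set.range (algebraMap k F))
    (hlarge : (Fintype.card F : ℝ) / Fintype.card k ^ 3 + 2 * √(Fintype.card F) + 1 <
      Fintype.card F / Fintype.card k ^ 2)
    (K : Finset ℕ) (hK : ∀ r ∈ K, r.Prime ∧ r ∣ Fintype.card F - 1)
    (h : 2 * (K.card + 1) * (Fintype.card k : ℝ) ^ 2 <
      √(Fintype.card F) * (1 - ∑ r ∈ K, 1 / (r : ℝ) -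
        2 * Γ.card * ((Module.finrank k F : ℝ) - 1) / Fintype.card k)) :
    ∃ α : F, α ≠ 0 ∧ Algebra.trace k F α = 0 ∧ Algebra.trace k F α⁻¹ = 0 ∧
      (∀ γ ∈ Γ, Algebra.trace k F (γ * α) ≠ 0 ∧ Algebra.trace k F (γ * α⁻¹) ≠ 0) ∧
      ∀ r ∈ K, ∀ β, β ^ r ≠ α := by
  obtain ⟨X, hX⟩ := exists_mulChar_orderOf_prime F
  have hq : (0 : ℝ) < Fintype.card k := by exact_mod_cast Fintype.card_pos
  set Q : ℝ := (Fintype.card F : ℝ) with hQdef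
  have hQ : (0 : ℝ) < Q := by rw [hQdef]; exact_mod_cast Fintype.card_pos
  have hsq : √Q * √Q = Q := Real.mul_self_sqrt hQ.le
  have hs : 0 < √Q := Real.sqrt_pos.2 hQ
  have hn1 : (0 : ℝ) ≤ (Module.finrank k F : ℝ) - 1 := by
    have : 1 ≤ Module.finrank k F := Module.finrank_pos
    have : (1 : ℝ) ≤ Module.finrank k F := by exact_mod_cast this
    linarith
  set S := ∑ r ∈ K, 1 / (r : ℝ) with hS
  have hS0 : 0 ≤ S := Finset.sum_nonneg fun r _ => by positivity
  have hΓ0 : (0 : ℝ) ≤ 2 * Γ.card * ((Module.finrank k F : ℝ) - 1) / Fintype.card k := by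
    positivity
  have hpos : 0 < 1 - S - 2 * Γ.card * ((Module.finrank k F : ℝ) - 1) / Fintype.card k := by
    by_contra! hneg
    have : (0 : ℝ) ≤ 2 * (K.card + 1) * (Fintype.card k : ℝ) ^ 2 := by positivity
    nlinarith
  have hsv : ∀ G : Finset F, sieved X G ∅ = G := fun G => by simp [sieved]
  have hB := card_sieved_badSet_le (k := k) X ∅ Γ
    (c := ((Module.finrank k F : ℝ) - 1) * (Q / Fintype.card k ^ 3))
    (fun γ hγ => by rw [hsv]; exact card_biTraceZero_filter_le_of_line (hΓ γ hγ) hlarge)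
    (fun γ hγ => by
      rw [hsv, card_biTraceZero_filter_inv]
      exact card_biTraceZero_filter_le_of_line (hΓ γ hγ) hlarge)
  have key := exists_of_card_sieved_badSet_lt (k := k) Γ hX ∅ K (by simp)
    (fun r hr => ⟨(hK r hr).1, (hK r hr).2, by simp⟩) (by linarith) (hB.trans_lt ?_)
  · simpa using key
  rw [← hS, ← hQdef, Finset.prod_empty, one_mul, Finset.card_empty, pow_zero, one_mul]
  have h' : 2 * (K.card + 1) * √Q <
      Q / Fintype.card k ^ 2 *
        (1 - S - 2 * Γ.card * ((Module.finrank k F : ℝ) - 1) / Fintype.card k) := by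
    rw [div_mul_eq_mul_div, lt_div_iff₀ (by positivity)]
    have := mul_lt_mul_of_pos_right h hs
    calc _ = 2 * (K.card + 1) * (Fintype.card k : ℝ) ^ 2 * √Q := by ring
      _ < _ := this
      _ = _ := by rw [mul_right_comm, hsq]
  have h3 : Q / Fintype.card k ^ 2 *
      (2 * Γ.card * ((Module.finrank k F : ℝ) - 1) / Fintype.card k) =
      Γ.card * (2 * (((Module.finrank k F : ℝ) - 1) * (Q / (Fintype.card k : ℝ) ^ 3))) := by
    field_simp
  have h4 : 0 ≤ S * √Q := by positivity
  nlinarith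

end LineCount

section Normality

variable {k F : Type*} [Field k] [Fintype k] [Field F] [Fintype F]
  [Algebra k F]

theorem frobenius_toLinearMap_pow_apply {k F : Type*} [Field k] [Fintype k] [Field F]
    [Algebra k F] (i : ℕ) (β : F) :
    ((FiniteField.frobeniusAlgHom k F).toLinearMap ^ i) β = β ^ Fintype.card k ^ i := by
  rw [← frobeniusAlgHom_pow_apply]
  induction i with
  | zero => rfl
  | succ i ih => rw [pow_succ', Module.End.mul_apply, ih, pow_succ']; rfl

theorem polyAct_eq_aeval (h : k[X]) (β : F) : polyAct (Fintype.card k) h β =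
    aeval (FiniteField.frobeniusAlgHom k F).toLinearMap h β := by
  rw [polyAct, aeval_eq_sum_range, sum_over_range _ (by simp), LinearMap.sum_apply]
  refine Finset.sum_congr rfl fun i _ => ?_
  rw [LinearMap.smul_apply, frobenius_toLinearMap_pow_apply, Algebra.smul_def]

/-- The kernel of the action of a polynomial of degree `d` has dimension at most `d`. -/
theorem finrank_ker_aeval_frobenius_le {h : k[X]} (hh : h ≠ 0) :
    Module.finrank k (LinearMap.ker (aeval (FiniteField.frobeniusAlgHom k F).toLinearMap h)) ≤
      h.natDegree := by
  classical
  set U := LinearMap.ker (aeval (FiniteField.frobeniusAlgHom k F).toLinearMap h) with hU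
  have hq : 1 < Fintype.card k := Fintype.one_lt_card
  let L : F[X] := ∑ i ∈ Finset.range (h.natDegree + 1),
    C (algebraMap k F (h.coeff i)) * X ^ Fintype.card k ^ i
  have hLdeg : L.natDegree ≤ Fintype.card k ^ h.natDegree := by
    refine natDegree_sum_le_of_forall_le _ _ fun i hi => ?_
    refine (natDegree_C_mul_X_pow_le _ _).trans (Nat.pow_le_pow_right hq.le ?_)
    have := Finset.mem_range.1 hi
    omega
  have hL0 : L ≠ 0 := by
    intro h0
    have h1 : L.coeff (Fintype.card k ^ h.natDegree) = algebraMap k F h.leadingCoeff := by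
      rw [finsetSum_coeff, Finset.sum_eq_single h.natDegree]
      · rw [coeff_C_mul_X_pow, if_pos rfl]; rfl
      · intro i _ hi
        rw [coeff_C_mul_X_pow, if_neg]
        exact fun h2 => hi (Nat.pow_right_injective hq h2).symm
      · intro h2
        exact absurd (Finset.mem_range.2 (Nat.lt_succ_self _)) h2
    rw [h0, coeff_zero] at h1
    exact hh (leadingCoeff_eq_zero.1 ((map_eq_zero (algebraMap k F)).1 h1.symm))
  have hroot : ∀ x ∈ U, x ∈ L.roots.toFinset := by
    intro x hx
    rw [Multiset.mem_toFinset, mem_roots hL0, IsRoot.def, eval_finsetSum]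
    rw [hU, LinearMap.mem_ker, ← polyAct_eq_aeval, polyAct, sum_over_range _ (by simp)] at hx
    simpa using hx
  have hcard : Nat.card U ≤ Fintype.card k ^ h.natDegree := by
    have h1 : Nat.card U ≤ L.roots.toFinset.card := by
      rw [← Set.ncard_coe_finset]
      exact Nat.card_mono (Set.toFinite _) hroot
    exact h1.trans ((Multiset.toFinset_card_le _).trans ((card_roots' L).trans hLdeg))
  rw [Module.natCard_eq_pow_finrank (K := k), Nat.card_eq_fintype_card] at hcard
  exact (Nat.pow_le_pow_iff_right hq).1 hcard

theorem natDegree_geom_sum_X {k : Type*} [Field k] (n : ℕ) (hn : n ≠ 0) :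
    (∑ i ∈ Finset.range n, X ^ i : k[X]).natDegree = n - 1 := by
  obtain ⟨m, rfl⟩ := Nat.exists_eq_succ_of_ne_zero hn
  rw [Nat.succ_eq_add_one, Nat.add_sub_cancel]
  refine natDegree_eq_of_le_of_coeff_ne_zero ?_ ?_
  · refine natDegree_sum_le_of_forall_le _ _ fun i hi => ?_
    rw [natDegree_X_pow]
    have := Finset.mem_range.1 hi
    omega
  · rw [finsetSum_coeff, Finset.sum_eq_single m]
    · simp
    · intro i _ hi
      rw [coeff_X_pow, if_neg (Ne.symm hi)]
    · simp

theorem aeval_frobenius_geom_sum (α : F) :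
    aeval (FiniteField.frobeniusAlgHom k F).toLinearMap
      (∑ i ∈ Finset.range (Module.finrank k F), X ^ i : k[X]) α =
      algebraMap k F (Algebra.trace k F α) := by
  rw [FiniteField.algebraMap_trace_eq_sum_pow, Nat.card_eq_fintype_card, map_sum,
    LinearMap.sum_apply]
  refine Finset.sum_congr rfl fun i _ => ?_
  rw [map_pow, aeval_X, frobenius_toLinearMap_pow_apply]

theorem isKNormal_one_of_forall_dvd {α : F} (htr : Algebra.trace k F α = 0)
    (h : ∀ h' : k[X], h' ∣ X ^ Module.finrank k F - 1 →
      aeval (FiniteField.frobeniusAlgHom k F).toLinearMap h' α = 0 → h' ≠ 0 →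
      Module.finrank k F - 1 ≤ h'.natDegree) :
    IsKNormal k (Fintype.card k) (Module.finrank k F) 1 α := by
  have hn : Module.finrank k F ≠ 0 := Module.finrank_pos.ne'
  have hdvd : (∑ i ∈ Finset.range (Module.finrank k F), X ^ i : k[X]) ∣
      X ^ Module.finrank k F - 1 := ⟨X - 1, (geom_sum_mul X _).symm⟩
  refine ⟨∑ i ∈ Finset.range (Module.finrank k F), X ^ i, ⟨?_, hdvd, ?_, ?_⟩,
    natDegree_geom_sum_X _ hn⟩
  · exact monic_geom_sum_X hn
  · rw [polyAct_eq_aeval, aeval_frobenius_geom_sum, htr, map_zero]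
  · intro h' hm hd hα
    rw [natDegree_geom_sum_X _ hn]
    rw [polyAct_eq_aeval] at hα
    exact h h' hd hα hm.ne_zero

/-- `1`-normality is implied by finitely many trace conditions. -/
theorem exists_finset_trace_ne_zero_imp_isKNormal (k F : Type*) [Field k] [Fintype k] [Field F]
    [Fintype F] [Algebra k F] : ∃ Γ : Finset F, Γ.card ≤ Module.finrank k F - 1 ∧
      (∀ γ ∈ Γ, γ ∉ Set.range (algebraMap k F)) ∧
      ∀ α : F, Algebra.trace k F α = 0 → (∀ γ ∈ Γ, Algebra.trace k F (γ * α) ≠ 0) →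
        IsKNormal k (Fintype.card k) (Module.finrank k F) 1 α := by
  classical
  set n := Module.finrank k F with hn
  have hn0 : n ≠ 0 := Module.finrank_pos.ne'
  set φ := (FiniteField.frobeniusAlgHom k F).toLinearMap with hφ
  set Φ : k[X] := ∑ i ∈ Finset.range n, X ^ i with hΦ
  have hΦm : Φ.Monic := monic_geom_sum_X hn0
  have hΦd : Φ.natDegree = n - 1 := natDegree_geom_sum_X n hn0
  set P := (UniqueFactorizationMonoid.normalizedFactors Φ).toFinset with hP
  have hPmem : ∀ f, f ∈ P ↔ Irreducible f ∧ f.Monic ∧ f ∣ Φ := fun f => by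
    rw [hP, Multiset.mem_toFinset, Polynomial.mem_normalizedFactors_iff hΦm.ne_zero]
  have hPcard : P.card ≤ n - 1 := by
    have h1 := leadingCoeff_mul_prod_normalizedFactors Φ
    rw [hΦm.leadingCoeff, C_1, one_mul] at h1
    have h2 := natDegree_multiset_prod_of_monic (UniqueFactorizationMonoid.normalizedFactors Φ)
      fun f hf => ((hPmem f).1 (Multiset.mem_toFinset.2 hf)).2.1
    rw [h1, hΦd] at h2
    have h3 := Multiset.card_nsmul_le_sum
      (s := (UniqueFactorizationMonoid.normalizedFactors Φ).map natDegree) (a := 1) (by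
        intro d hd
        obtain ⟨f, hf, rfl⟩ := Multiset.mem_map.1 hd
        exact ((hPmem f).1 (Multiset.mem_toFinset.2 hf)).1.natDegree_pos)
    rw [← h2, Multiset.card_map, smul_eq_mul, mul_one] at h3
    exact (Multiset.toFinset_card_le _).trans h3
  have hγ : ∀ f, ∃ γ : F, f ∈ P → γ ∉ Set.range (algebraMap k F) ∧
      ∀ c, Φ = f * c → ∀ x, aeval φ c x = 0 → Algebra.trace k F (γ * x) = 0 := by
    intro f
    by_cases hf : f ∈ P
    · obtain ⟨hirr, hfm, c, hc⟩ := (hPmem f).1 hf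
      have hc0 : c ≠ 0 := by
        rintro rfl
        exact hΦm.ne_zero (by rw [hc, mul_zero])
      have hdeg : f.natDegree + c.natDegree = n - 1 := by
        rw [← natDegree_mul hirr.ne_zero hc0, ← hc, hΦd]
      have hfpos := hirr.natDegree_pos
      have hU := finrank_ker_aeval_frobenius_le (F := F) hc0
      rw [← hφ] at hU
      obtain ⟨γ, h1, h2⟩ := exists_trace_mul_eq_zero _
        (show Module.finrank k (LinearMap.ker (aeval φ c)) + 2 ≤ Module.finrank k F by
          rw [← hn]; omega)
      refine ⟨γ, fun _ => ⟨h1, fun c' hc' x hx => h2 x ?_⟩⟩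
      have : c' = c := mul_left_cancel₀ hirr.ne_zero (hc'.symm.trans hc)
      rwa [LinearMap.mem_ker, ← this]
    · exact ⟨0, fun h => absurd h hf⟩
  choose g hg using hγ
  refine ⟨P.image g, Finset.card_image_le.trans hPcard, ?_, ?_⟩
  · intro γ hγ
    obtain ⟨f, hf, rfl⟩ := Finset.mem_image.1 hγ
    exact (hg f hf).1
  · intro α htr hα
    refine isKNormal_one_of_forall_dvd htr fun h' _ hα0 hh0 => ?_
    set e := EuclideanDomain.gcd h' Φ with he
    have heα : aeval φ e α = 0 := by
      have hΦα : aeval φ Φ α = 0 := by rw [aeval_frobenius_geom_sum, htr, map_zero]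
      rw [he, EuclideanDomain.gcd_eq_gcd_ab h' Φ, mul_comm h', mul_comm Φ, map_add, map_mul,
        map_mul, LinearMap.add_apply, Module.End.mul_apply, Module.End.mul_apply, hα0, hΦα,
        map_zero, map_zero, add_zero]
    obtain ⟨c, hc⟩ : e ∣ Φ := EuclideanDomain.gcd_dvd_right h' Φ
    have hcu : IsUnit c := by
      by_contra hcu
      have hc0 : c ≠ 0 := by
        rintro rfl
        exact hΦm.ne_zero (by rw [hc, mul_zero])
      obtain ⟨f, hfirr, hfc⟩ := WfDvdMonoid.exists_irreducible_factor hcu hc0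
      have hfm : normalize f ∈ P := (hPmem _).2 ⟨(normalize_associated f).symm.irreducible hfirr,
        monic_normalize hfirr.ne_zero,
        (normalize_associated f).dvd.trans (hfc.trans ⟨e, by rw [hc, mul_comm]⟩)⟩
      obtain ⟨c', hc'⟩ := (normalize_associated f).dvd.trans hfc
      refine hα (g (normalize f)) (Finset.mem_image_of_mem _ hfm)
        ((hg _ hfm).2 (c' * e) (by rw [hc, hc']; ring) α ?_)
      rw [map_mul, Module.End.mul_apply, heα, map_zero]
    have hΦh : Φ ∣ h' := by
      rw [hc]
      exact (hcu.mul_right_dvd).2 (EuclideanDomain.gcd_dvd_left h' Φ)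
    rw [← hn, ← hΦd]
    exact natDegree_le_of_dvd hΦh hh0

end Normality

section Scaling

variable {k F : Type*} [Field k] [Fintype k] [Field F] [Fintype F] [Algebra k F]

theorem mem_range_algebraMap_of_pow_card_eq {k F : Type*} [Field k] [Fintype k] [Field F]
    [Algebra k F] {x : F} (hx : x ^ Fintype.card k = x) :
    x ∈ Set.range (algebraMap k F) := by
  classical
  have hq : 1 < Fintype.card k := Fintype.one_lt_card
  have h0 : (X ^ Fintype.card k - X : F[X]) ≠ 0 := FiniteField.X_pow_card_sub_X_ne_zero F hq
  have hsub : (Finset.univ.map ⟨algebraMap k F, (algebraMap k F).injective⟩) ⊆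
      (X ^ Fintype.card k - X : F[X]).roots.toFinset := by
    intro y hy
    obtain ⟨t, -, rfl⟩ := Finset.mem_map.1 hy
    rw [Multiset.mem_toFinset, mem_roots h0, IsRoot.def]
    simp [← map_pow, FiniteField.pow_card]
  have heq := Finset.eq_of_subset_of_card_le hsub (by
    rw [Finset.card_map, Finset.card_univ]
    refine (Multiset.toFinset_card_le _).trans ((card_roots' _).trans ?_)
    rw [FiniteField.X_pow_card_sub_X_natDegree_eq F hq])
  have hmem : x ∈ (X ^ Fintype.card k - X : F[X]).roots.toFinset := by
    rw [Multiset.mem_toFinset, mem_roots h0, IsRoot.def]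
    simp [hx]
  rw [← heq] at hmem
  obtain ⟨t, -, ht⟩ := Finset.mem_map.1 hmem
  exact ⟨t, ht⟩

/-- An element which is not an `r`-th power for all primes `r` dividing `M`, where
`M (q - 1) = #F - 1`, becomes primitive after scaling by an element of the base field. -/
theorem exists_smul_orderOf_eq {M : ℕ} (hM : M * (Fintype.card k - 1) = Fintype.card F - 1) {α : F}
    (hα : α ≠ 0) (h : ∀ r, r.Prime → r ∣ M → ∀ β, β ^ r ≠ α) :
    ∃ c : k, c ≠ 0 ∧ orderOf (algebraMap k F c * α) = Fintype.card F - 1 := by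
  classical
  obtain ⟨g, hg⟩ := IsCyclic.exists_generator (α := Fˣ)
  have hord : orderOf g = Fintype.card F - 1 := by
    rw [orderOf_eq_card_of_forall_mem_zpowers hg, Nat.card_eq_fintype_card, Fintype.card_units]
  have hQ : 0 < Fintype.card F - 1 := by
    have : 1 < Fintype.card F := Fintype.one_lt_card
    omega
  obtain ⟨e, he⟩ : ∃ e : ℕ, g ^ e = Units.mk0 α hα := by
    have := hg (Units.mk0 α hα)
    rw [← mem_powers_iff_mem_zpowers] at this
    exact this
  have hcop : e.Coprime M := by
    refine Nat.Coprime.symm (Nat.coprime_of_dvd fun r hr hrM => ?_)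
    rintro ⟨m, rfl⟩
    refine h r hr hrM (g ^ m : Fˣ) ?_
    rw [← Units.val_pow_eq_pow_val, ← pow_mul, mul_comm, he, Units.val_mk0]
  have : NeZero (Fintype.card F - 1) := ⟨hQ.ne'⟩
  obtain ⟨u, hu⟩ := ZMod.unitsMap_surjective (m := Fintype.card F - 1) (Dvd.intro _ hM)
    (ZMod.unitOfCoprime e hcop)
  set t := (u : ZMod (Fintype.card F - 1)).val with ht
  have htc : t.Coprime (Fintype.card F - 1) := ZMod.val_coe_unit_coprime u
  have hmod : t ≡ e [MOD M] := by
    have h1 := congrArg (Units.val) hu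
    rw [ZMod.unitsMap_val, ZMod.coe_unitOfCoprime] at h1
    rw [← ZMod.natCast_eq_natCast_iff, ← h1, ht, ZMod.natCast_val]
  have hpow : (g ^ t) ^ (Fintype.card k - 1) = (g ^ e) ^ (Fintype.card k - 1) := by
    rw [← pow_mul, ← pow_mul, pow_eq_pow_iff_modEq, hord, ← hM]
    exact hmod.mul_right' _
  have hx : ((g ^ t * (g ^ e)⁻¹ : Fˣ) : F) ^ Fintype.card k = (g ^ t * (g ^ e)⁻¹ : Fˣ) := by
    have h1 : (g ^ t * (g ^ e)⁻¹) ^ (Fintype.card k - 1) = 1 := by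
      rw [mul_pow, inv_pow, hpow, mul_inv_cancel]
    have h2 : (g ^ t * (g ^ e)⁻¹) ^ Fintype.card k = g ^ t * (g ^ e)⁻¹ := by
      conv_lhs => rw [← Nat.sub_add_cancel (Fintype.card_pos (α := k)), pow_succ]
      rw [h1, one_mul]
    rw [← Units.val_pow_eq_pow_val, h2]
  obtain ⟨c, hc⟩ := mem_range_algebraMap_of_pow_card_eq hx
  refine ⟨c, ?_, ?_⟩
  · rintro rfl
    rw [map_zero] at hc
    exact Units.ne_zero _ hc.symm
  · have h3 : algebraMap k F c * α = ((g ^ t : Fˣ) : F) := by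
      rw [hc, ← Units.val_mk0 hα, ← he, ← Units.val_mul, inv_mul_cancel_right]
    rw [h3, orderOf_units, ← hord]
    exact Nat.Coprime.orderOf_pow (by rw [hord]; exact htc.symm)

variable (k F) in
/-- There is a pair of mutually inverse primitive `1`-normal elements. -/
def HasPrimitiveOneNormalPair : Prop :=
  ∃ α : F, α ≠ 0 ∧ orderOf α = Fintype.card F - 1 ∧ orderOf α⁻¹ = Fintype.card F - 1 ∧
    IsKNormal k (Fintype.card k) (Module.finrank k F) 1 α ∧
    IsKNormal k (Fintype.card k) (Module.finrank k F) 1 α⁻¹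

theorem orderOf_inv_of_ne_zero {F : Type*} [Field F] {α : F} (hα : α ≠ 0) :
    orderOf α⁻¹ = orderOf α := by
  have h1 : α⁻¹ = ((Units.mk0 α hα)⁻¹ : Fˣ) := by simp
  have h2 : α = (Units.mk0 α hα : Fˣ) := rfl
  rw [h1, orderOf_units, orderOf_inv]
  conv_rhs => rw [h2, orderOf_units]

theorem hasPrimitiveOneNormalPair_of_trace_conditions {Γ : Finset F}
    (hΓ : ∀ α : F, Algebra.trace k F α = 0 → (∀ γ ∈ Γ, Algebra.trace k F (γ * α) ≠ 0) →
        IsKNormal k (Fintype.card k) (Module.finrank k F) 1 α) {M : ℕ}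
    (hM : M * (Fintype.card k - 1) = Fintype.card F - 1) {α : F} (hα : α ≠ 0)
    (h1 : Algebra.trace k F α = 0) (h2 : Algebra.trace k F α⁻¹ = 0)
    (h3 : ∀ γ ∈ Γ, Algebra.trace k F (γ * α) ≠ 0 ∧ Algebra.trace k F (γ * α⁻¹) ≠ 0)
    (h4 : ∀ r, r.Prime → r ∣ M → ∀ β, β ^ r ≠ α) : HasPrimitiveOneNormalPair k F := by
  obtain ⟨c, hc, hord⟩ := exists_smul_orderOf_eq hM hα h4
  have hne : algebraMap k F c * α ≠ 0 := mul_ne_zero (by simpa using hc) hα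
  refine ⟨algebraMap k F c * α, hne, hord, (orderOf_inv_of_ne_zero hne).trans hord,
    hΓ _ ?_ ?_, hΓ _ ?_ ?_⟩
  · rw [← Algebra.smul_def, map_smul, h1, smul_zero]
  · intro γ hγ
    rw [← Algebra.smul_def, mul_smul_comm, map_smul, smul_eq_mul]
    exact mul_ne_zero hc (h3 γ hγ).1
  · rw [mul_inv, ← map_inv₀, ← Algebra.smul_def, map_smul, h2, smul_zero]
  · intro γ hγ
    rw [mul_inv, ← map_inv₀, ← Algebra.smul_def, mul_smul_comm, map_smul, smul_eq_mul]
    exact mul_ne_zero (inv_ne_zero hc) (h3 γ hγ).2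

/-- Sieve criterion for pairs of primitive `1`-normal elements. -/
theorem hasPrimitiveOneNormalPair_of_prime_sieve {q n M : ℕ} (hq : Fintype.card k = q)
    (hn : Module.finrank k F = n) (hM : M * (q - 1) = q ^ n - 1) (J K : Finset ℕ)
    (hJ : ∀ r ∈ J, r.Prime ∧ r ∣ M) (hK : ∀ r ∈ K, r.Prime ∧ r ∣ M ∧ r ∉ J)
    (hJK : ∀ r, r.Prime → r ∣ M → r ∈ J ∪ K)
    (h : 2 * 2 ^ J.card * (K.card + 2 * n - 1) * (q : ℝ) ^ 2 <
      √((q : ℝ) ^ n) * (1 - ∑ r ∈ K, 1 / (r : ℝ) - 2 * (n - 1) / q)) :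
    HasPrimitiveOneNormalPair k F := by
  classical
  subst hq hn
  have hF : Fintype.card F = Fintype.card k ^ Module.finrank k F := Module.card_eq_pow_finrank
  rw [← hF] at hM
  have hd : M ∣ Fintype.card F - 1 := Dvd.intro _ hM
  have hq0 : (0 : ℝ) < Fintype.card k := by exact_mod_cast Fintype.card_pos
  have hn1 : 1 ≤ Module.finrank k F := Module.finrank_pos
  obtain ⟨Γ, hΓc, hΓr, hΓ⟩ := exists_finset_trace_ne_zero_imp_isKNormal k F
  have hΓ' : (Γ.card : ℝ) ≤ (Module.finrank k F : ℝ) - 1 := by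
    rw [← Nat.cast_one, ← Nat.cast_sub hn1]
    exact_mod_cast hΓc
  obtain ⟨α, hα, h1, h2, h3, h4⟩ := exists_of_prime_sieve Γ hΓr J K
    (fun r hr => ⟨(hJ r hr).1, (hJ r hr).2.trans hd⟩)
    (fun r hr => ⟨(hK r hr).1, (hK r hr).2.1.trans hd, (hK r hr).2.2⟩) (by
      rw [hF, Nat.cast_pow]
      refine lt_of_le_of_lt ?_ (h.trans_le ?_)
      · gcongr
        linarith
      · gcongr)
  exact hasPrimitiveOneNormalPair_of_trace_conditions hΓ hM hα h1 h2 h3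
    fun r hr hrM => h4 r (hJK r hr hrM)

/-- Sieve criterion using the count along lines. -/
theorem hasPrimitiveOneNormalPair_of_prime_sieve_of_line {q n M : ℕ} (hq : Fintype.card k = q)
    (hn : Module.finrank k F = n) (hM : M * (q - 1) = q ^ n - 1)
    (hlarge : ((q : ℝ) ^ n) / q ^ 3 + 2 * √((q : ℝ) ^ n) + 1 < (q : ℝ) ^ n / q ^ 2) (K : Finset ℕ)
    (hK : ∀ r, r ∈ K ↔ r.Prime ∧ r ∣ M)
    (h : 2 * (K.card + 1) * (q : ℝ) ^ 2 <
      √((q : ℝ) ^ n) * (1 - ∑ r ∈ K, 1 / (r : ℝ) - 2 * (n - 1) ^ 2 / q)) :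
    HasPrimitiveOneNormalPair k F := by
  classical
  subst hq hn
  have hF : Fintype.card F = Fintype.card k ^ Module.finrank k F := Module.card_eq_pow_finrank
  rw [← hF] at hM
  have hd : M ∣ Fintype.card F - 1 := Dvd.intro _ hM
  have hq0 : (0 : ℝ) < Fintype.card k := by exact_mod_cast Fintype.card_pos
  have hn1 : 1 ≤ Module.finrank k F := Module.finrank_pos
  obtain ⟨Γ, hΓc, hΓr, hΓ⟩ := exists_finset_trace_ne_zero_imp_isKNormal k F
  have hΓ' : (Γ.card : ℝ) ≤ (Module.finrank k F : ℝ) - 1 := by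
    rw [← Nat.cast_one, ← Nat.cast_sub hn1]
    exact_mod_cast hΓc
  have hn2 : (0 : ℝ) ≤ (Module.finrank k F : ℝ) - 1 := le_trans (by positivity) hΓ'
  obtain ⟨α, hα, h1, h2, h3, h4⟩ := exists_of_prime_sieve_of_line Γ hΓr
    (by rw [hF, Nat.cast_pow]; exact hlarge) K
    (fun r hr => ⟨((hK r).1 hr).1, ((hK r).1 hr).2.trans hd⟩) (by
      rw [hF, Nat.cast_pow]
      refine h.trans_le ?_
      rw [sq, ← mul_assoc]
      gcongr)
  exact hasPrimitiveOneNormalPair_of_trace_conditions hΓ hM hα h1 h2 h3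
    fun r hr hrM => h4 r ((hK r).2 ⟨hr, hrM⟩)

end Scaling

section PrimeFactorBounds

theorem prod_pow_le_of_forall_primeFactors {M t : ℕ} (hM : M ≠ 0) (L : Finset ℕ)
    (hL : ∀ r ∈ L, r < 2 ^ t) (h : ∀ r, r.Prime → r ∣ M → r < 2 ^ t → r ∈ L) :
    (2 ^ t) ^ M.primeFactors.card * ∏ r ∈ L, r ≤ (2 ^ t) ^ L.card * M := by
  classical
  set S := M.primeFactors.filter (· < 2 ^ t) with hS
  set T := M.primeFactors.filter (¬ · < 2 ^ t) with hT
  have hSL : S ⊆ L := fun r hr => by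
    rw [hS, Finset.mem_filter] at hr
    exact h r (Nat.prime_of_mem_primeFactors hr.1) (Nat.dvd_of_mem_primeFactors hr.1) hr.2
  have hcard : M.primeFactors.card = S.card + T.card :=
    (Finset.card_filter_add_card_filter_not (s := M.primeFactors) (· < 2 ^ t)).symm
  have hprod : (∏ r ∈ S, r) * ∏ r ∈ T, r ≤ M := by
    rw [Finset.prod_filter_mul_prod_filter_not]
    exact Nat.le_of_dvd (Nat.pos_of_ne_zero hM) (Nat.prod_primeFactors_dvd M)
  have hTp : (2 ^ t) ^ T.card ≤ ∏ r ∈ T, r := by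
    refine Finset.pow_card_le_prod _ _ _ fun r hr => ?_
    rw [hT, Finset.mem_filter] at hr
    exact not_lt.1 hr.2
  have hLp : ∏ r ∈ L \ S, r ≤ (2 ^ t) ^ (L \ S).card :=
    Finset.prod_le_pow_card _ _ _ fun r hr => (hL r (Finset.sdiff_subset hr)).le
  have hLc : (L \ S).card + S.card = L.card := Finset.card_sdiff_add_card_eq_card hSL
  calc (2 ^ t) ^ M.primeFactors.card * ∏ r ∈ L, r
      = (2 ^ t) ^ S.card * (2 ^ t) ^ T.card * ((∏ r ∈ L \ S, r) * ∏ r ∈ S, r) := by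
        rw [hcard, pow_add, Finset.prod_sdiff hSL]
    _ ≤ (2 ^ t) ^ S.card * (∏ r ∈ T, r) * ((2 ^ t) ^ (L \ S).card * ∏ r ∈ S, r) := by gcongr
    _ = (2 ^ t) ^ L.card * ((∏ r ∈ S, r) * ∏ r ∈ T, r) := by rw [← hLc, pow_add]; ring
    _ ≤ _ := by gcongr

theorem card_le_of_forall_prime_dvd {B c m : ℕ} (hc : 0 < c) (hB : 0 < B) (S : Finset ℕ)
    (hS : ∀ r ∈ S, r.Prime ∧ B ≤ r ∧ r ∣ c) (h : c < B ^ (m + 1)) : S.card ≤ m := by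
  have h1 : ∏ r ∈ S, r ∣ c :=
    Finset.prod_primes_dvd c (fun r hr => (hS r hr).1.prime) fun r hr => (hS r hr).2.2
  have h2 : B ^ S.card ≤ ∏ r ∈ S, r :=
    Finset.pow_card_le_prod _ _ _ fun r hr => (hS r hr).2.1
  have h3 := (h2.trans (Nat.le_of_dvd hc h1)).trans_lt h
  rcases (Nat.lt_or_ge m S.card) with h4 | h4
  · exact absurd (Nat.pow_le_pow_right hB h4) (not_le.2 h3)
  · exact h4

theorem eq_geom_sum_of_mul_sub_one {q n M : ℕ} (hq : 1 < q) (hM : M * (q - 1) = q ^ n - 1) :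
    M = ∑ i ∈ Finset.range n, q ^ i := by
  have := Nat.geomSum_eq (m := q) (by omega) n
  rw [this, ← hM, Nat.mul_div_cancel _ (by omega)]

theorem lt_two_mul_pow_of_mul_sub_one {q n M : ℕ} (hq : 1 < q) (hn : 0 < n)
    (hM : M * (q - 1) = q ^ n - 1) : M < 2 * q ^ (n - 1) := by
  obtain ⟨m, rfl⟩ := Nat.exists_eq_succ_of_ne_zero hn.ne'
  obtain ⟨r, rfl⟩ : ∃ r, q = r + 2 := ⟨q - 2, by omega⟩
  simp only [Nat.succ_eq_add_one, Nat.add_sub_cancel] at *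
  have h1 : (r + 2) ^ (m + 1) - 1 < 2 * (r + 2) ^ m * (r + 2 - 1) := by
    have : 0 < (r + 2) ^ m := by positivity
    have h1 : (r + 2) ^ (m + 1) ≤ 2 * (r + 2) ^ m * (r + 2 - 1) := by
      rw [show r + 2 - 1 = r + 1 by omega, pow_succ]
      nlinarith
    exact (Nat.sub_lt (by positivity) one_pos).trans_le h1
  rw [← hM] at h1
  exact Nat.lt_of_mul_lt_mul_right h1

theorem eq_or_modEq_one_of_prime_dvd {q n M r : ℕ} (hq : 1 < q) (hn : n.Prime)
    (hM : M * (q - 1) = q ^ n - 1) (hr : r.Prime) (hrM : r ∣ M) : r = n ∨ r % n = 1 := by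
  have : Fact r.Prime := ⟨hr⟩
  have hpow : (q : ZMod r) ^ n = 1 := by
    have h1 : ((q ^ n - 1 : ℕ) : ZMod r) = 0 := by
      rw [ZMod.natCast_eq_zero_iff, ← hM]
      exact hrM.mul_right _
    rw [Nat.cast_sub (Nat.one_le_pow _ _ (by omega))] at h1
    push_cast at h1
    exact sub_eq_zero.1 h1
  rcases (Nat.dvd_prime hn).1 (orderOf_dvd_of_pow_eq_one hpow) with h1 | h1
  · left
    have hq1 : (q : ZMod r) = 1 := orderOf_eq_one_iff.1 h1
    have h2 : ((M : ℕ) : ZMod r) = 0 := (ZMod.natCast_eq_zero_iff _ _).2 hrM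
    rw [eq_geom_sum_of_mul_sub_one hq hM] at h2
    simp only [Nat.cast_sum, Nat.cast_pow, hq1, one_pow, Finset.sum_const, Finset.card_range,
      nsmul_eq_mul, mul_one] at h2
    exact (Nat.prime_dvd_prime_iff_eq hr hn).1 ((ZMod.natCast_eq_zero_iff _ _).1 h2)
  · right
    have h0 : (q : ZMod r) ≠ 0 := by
      rintro h0
      rw [h0, zero_pow hn.ne_zero] at hpow
      exact zero_ne_one hpow
    have h2 := ZMod.orderOf_dvd_card_sub_one h0
    rw [h1] at h2
    obtain ⟨m, hm⟩ := h2
    have hr2 := hr.two_le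
    have hn2 := hn.two_le
    rw [show r = 1 + n * m by omega, Nat.add_mul_mod_self_left, Nat.mod_eq_of_lt (by omega)]

end PrimeFactorBounds

section Criteria

theorem mul_sq_lt_sqrt_mul_div {n lo q Y D c : ℕ} (hn : 4 ≤ n) (hlo : lo ≤ q) (hq : 0 < q)
    (hD : 0 < D) (h : (c * D) ^ 2 < lo ^ (n - 4) * Y ^ 2) :
    (c : ℝ) * (q : ℝ) ^ 2 < √((q : ℝ) ^ n) * ((Y : ℝ) / D) := by
  have hq' : (0 : ℝ) < q := by exact_mod_cast hq
  have hD' : (0 : ℝ) < D := by exact_mod_cast hD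
  have h1 : √((q : ℝ) ^ n) = (q : ℝ) ^ 2 * √((q : ℝ) ^ (n - 4)) := by
    obtain ⟨m, rfl⟩ := Nat.exists_eq_add_of_le hn
    rw [Nat.add_sub_cancel_left, pow_add, Real.sqrt_mul (by positivity),
      show (q : ℝ) ^ 4 = ((q : ℝ) ^ 2) ^ 2 by ring, Real.sqrt_sq (by positivity)]
  have h2 : ((c * D : ℕ) : ℝ) < √((q : ℝ) ^ (n - 4)) * Y := by
    refine lt_of_pow_lt_pow_left₀ 2 (by positivity) ?_
    rw [mul_pow, Real.sq_sqrt (by positivity)]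
    calc (((c * D : ℕ) : ℝ)) ^ 2 < (lo : ℝ) ^ (n - 4) * (Y : ℝ) ^ 2 := by exact_mod_cast h
      _ ≤ _ := by gcongr
  rw [h1, mul_comm (c : ℝ), mul_assoc]
  refine mul_lt_mul_of_pos_left ?_ (by positivity)
  rw [← mul_div_assoc, lt_div_iff₀ hD']
  exact_mod_cast h2

/-- An integer upper bound for `10 ^ 6 * ∑ r ∈ L, 1 / r`. -/
def recipBound (L : List ℕ) : ℕ := (L.map fun r => 10 ^ 6 / r + 1).sum

theorem sum_inv_le_recipBound (L : List ℕ) (K : Finset ℕ) (h : ∀ r ∈ K, r ∈ L) :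
    ∑ r ∈ K, 1 / (r : ℝ) ≤ recipBound L / 10 ^ 6 := by
  classical
  have hterm (r : ℕ) : 1 / (r : ℝ) ≤ ((10 ^ 6 / r + 1 : ℕ) : ℝ) / 10 ^ 6 := by
    have h1 : ((10 ^ 6 : ℕ) : ℝ) / r ≤ ((10 ^ 6 / r + 1 : ℕ) : ℝ) := by
      push_cast
      have := Nat.lt_floor_add_one (((10 ^ 6 : ℕ) : ℝ) / r)
      rw [Nat.floor_div_eq_div] at this
      push_cast at this ⊢
      exact this.le
    rw [le_div_iff₀ (by norm_num)]
    calc 1 / (r : ℝ) * 10 ^ 6 = ((10 ^ 6 : ℕ) : ℝ) / r := by push_cast; ring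
      _ ≤ _ := h1
  have hind : ∀ (L : List ℕ) (K : Finset ℕ), (∀ r ∈ K, r ∈ L) →
      ∑ r ∈ K, (10 ^ 6 / r + 1) ≤ recipBound L := by
    intro L
    induction L with
    | nil =>
      intro K hK
      rw [Finset.eq_empty_of_forall_notMem fun r hr => List.not_mem_nil (hK r hr)]
      simp
    | cons a L ih =>
      intro K hK
      have h1 : recipBound (a :: L) = 10 ^ 6 / a + 1 + recipBound L := by
        simp only [recipBound, List.map_cons, List.sum_cons]
      have h2 := ih (K.erase a) fun r hr => by
        rw [Finset.mem_erase] at hr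
        exact (List.mem_cons.1 (hK r hr.2)).resolve_left hr.1
      by_cases ha : a ∈ K
      · rw [← Finset.add_sum_erase _ _ ha]
        omega
      · rw [Finset.erase_eq_of_notMem ha] at h2
        exact h2.trans (h1 ▸ Nat.le_add_left _ _)
  calc ∑ r ∈ K, 1 / (r : ℝ) ≤ ∑ r ∈ K, ((10 ^ 6 / r + 1 : ℕ) : ℝ) / 10 ^ 6 :=
        Finset.sum_le_sum fun r _ => hterm r
    _ = ((∑ r ∈ K, (10 ^ 6 / r + 1) : ℕ) : ℝ) / 10 ^ 6 := by
        rw [← Finset.sum_div]; push_cast; rfl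
    _ ≤ _ := by
        gcongr
        exact hind L K h

theorem sum_inv_le_of_split (L : List ℕ) (K : Finset ℕ) {B m : ℕ} (hB : 0 < B)
    (hL : ∀ r ∈ K, r < B → r ∈ L) (hm : (K.filter (¬ · < B)).card ≤ m) :
    ∑ r ∈ K, 1 / (r : ℝ) ≤ ((recipBound L + m * (10 ^ 6 / B + 1) : ℕ) : ℝ) / 10 ^ 6 := by
  rw [← Finset.sum_filter_add_sum_filter_not K (· < B)]
  have h1 := sum_inv_le_recipBound L (K.filter (· < B)) fun r hr => by
    rw [Finset.mem_filter] at hr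
    exact hL r hr.1 hr.2
  have hB' := sum_inv_le_recipBound [B] {B} (by simp)
  simp only [Finset.sum_singleton, recipBound, List.map_cons, List.map_nil, List.sum_cons,
    List.sum_nil, add_zero] at hB'
  have h2 : ∑ r ∈ K.filter (¬ · < B), 1 / (r : ℝ) ≤ m * (((10 ^ 6 / B + 1 : ℕ) : ℝ) / 10 ^ 6) := by
    calc ∑ r ∈ K.filter (¬ · < B), 1 / (r : ℝ) ≤ ∑ r ∈ K.filter (¬ · < B), 1 / (B : ℝ) := by
          refine Finset.sum_le_sum fun r hr => ?_
          rw [Finset.mem_filter, not_lt] at hr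
          have : (0 : ℝ) < B := by exact_mod_cast hB
          gcongr
          exact hr.2
      _ = (K.filter (¬ · < B)).card * (1 / (B : ℝ)) := by rw [Finset.sum_const, nsmul_eq_mul]
      _ ≤ _ := by gcongr
  refine (add_le_add h1 h2).trans_eq ?_
  push_cast
  ring

theorem card_le_of_split (L : List ℕ) (K : Finset ℕ) {B m : ℕ}
    (hL : ∀ r ∈ K, r < B → r ∈ L) (hm : (K.filter (¬ · < B)).card ≤ m) :
    K.card ≤ L.length + m := by
  classical
  rw [← Finset.card_filter_add_card_filter_not (s := K) (· < B)]
  refine add_le_add ((Finset.card_le_card (t := L.toFinset) fun r hr => ?_).trans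
    (List.toFinset_card_le L)) hm
  rw [Finset.mem_filter] at hr
  exact List.mem_toFinset.2 (hL r hr.1 hr.2)

/-- Integer test for the prime sieve: `L` lists the possible prime divisors below `B`, those below
`A` are sieved exactly, and there are at most `m` prime divisors from `B` on. -/
def sieveCheck (n lo A B m : ℕ) (L : List ℕ) : Bool :=
  let L₁ := L.filter (· < A)
  let L₂ := L.filter (A ≤ ·)
  let Y := 10 ^ 6 * lo - ((recipBound L₂ + m * (10 ^ 6 / B + 1)) * lo + 2 * (n - 1) * 10 ^ 6)
  (2 * 2 ^ L₁.length * (L₂.length + m + 2 * n - 1) * (10 ^ 6 * lo)) ^ 2 < lo ^ (n - 4) * Y ^ 2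

/-- Integer test for the sieve on a line, with notation as in `sieveCheck`. -/
def lineCheck (n lo B m : ℕ) (L : List ℕ) : Bool :=
  let Y := 10 ^ 6 * lo - ((recipBound L + m * (10 ^ 6 / B + 1)) * lo + 2 * (n - 1) ^ 2 * 10 ^ 6)
  (2 * (L.length + m + 1) * (10 ^ 6 * lo)) ^ 2 < lo ^ (n - 4) * Y ^ 2

theorem div_le_of_sub {N lo s t q : ℕ} {S : ℝ} (hN : 0 < N) (hlo : 0 < lo) (hq : lo ≤ q)
    (hS : S ≤ s / N) (hY : 0 < N * lo - (s * lo + t * N)) :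
    ((N * lo - (s * lo + t * N) : ℕ) : ℝ) / ((N * lo : ℕ) : ℝ) ≤ 1 - S - t / q := by
  have hN' : (0 : ℝ) < N := by exact_mod_cast hN
  have hlo' : (0 : ℝ) < lo := by exact_mod_cast hlo
  have h1 : (t : ℝ) / q ≤ t / lo := by gcongr
  rw [Nat.cast_sub (by omega)]
  push_cast
  calc ((N : ℝ) * lo - (s * lo + t * N)) / (N * lo) = 1 - s / N - t / lo := by
        field_simp
        ring
    _ ≤ _ := by linarith

variable {k F : Type*} [Field k] [Fintype k] [Field F] [Fintype F] [Algebra k F] {q n M : ℕ}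

theorem hasPrimitiveOneNormalPair_of_sieveCheck (hq : Fintype.card k = q)
    (hn : Module.finrank k F = n) (hM : M * (q - 1) = q ^ n - 1) (hn4 : 4 ≤ n) {lo A B m c : ℕ}
    {L : List ℕ} (hlo : 0 < lo) (hloq : lo ≤ q) (hAB : A ≤ B) (hB : 0 < B) (hc : 0 < c)
    (hcB : c < B ^ (m + 1)) (hcM : ∀ r, r.Prime → r ∣ M → B ≤ r → r ∣ c)
    (hL : ∀ r, r.Prime → r ∣ M → r < B → r ∈ L) (h : sieveCheck n lo A B m L = true) :
    HasPrimitiveOneNormalPair k F := by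
  classical
  have hq1 : 1 < q := hq ▸ Fintype.one_lt_card
  have hM0 : M ≠ 0 := by
    rintro rfl
    have := Nat.one_lt_pow (by omega : n ≠ 0) hq1
    omega
  set J := M.primeFactors.filter (· < A) with hJ
  set K := M.primeFactors.filter (¬ · < A) with hK
  have hmem (r : ℕ) : r ∈ M.primeFactors ↔ r.Prime ∧ r ∣ M := by
    rw [Nat.mem_primeFactors]; tauto
  have hKL : ∀ r ∈ K, r < B → r ∈ L.filter (A ≤ ·) := by
    intro r hr hrB
    rw [hK, Finset.mem_filter, hmem, not_lt] at hr
    exact List.mem_filter.2 ⟨hL r hr.1.1 hr.1.2 hrB, by simpa using hr.2⟩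
  have hKm : (K.filter (¬ · < B)).card ≤ m := by
    refine card_le_of_forall_prime_dvd hc hB _ (fun r hr => ?_) hcB
    rw [Finset.mem_filter, hK, Finset.mem_filter, hmem, not_lt, not_lt] at hr
    exact ⟨hr.1.1.1, hr.2, hcM r hr.1.1.1 hr.1.1.2 hr.2⟩
  have hJc : J.card ≤ (L.filter (· < A)).length := by
    refine (Finset.card_le_card (t := (L.filter (· < A)).toFinset) fun r hr => ?_).trans
      (List.toFinset_card_le _)
    rw [hJ, Finset.mem_filter, hmem] at hr
    rw [List.mem_toFinset, List.mem_filter]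
    exact ⟨hL r hr.1.1 hr.1.2 (hr.2.trans_le hAB), by simpa using hr.2⟩
  refine hasPrimitiveOneNormalPair_of_prime_sieve hq hn hM J K
    (fun r hr => (hmem r).1 (Finset.mem_filter.1 hr).1)
    (fun r hr => ⟨((hmem r).1 (Finset.mem_filter.1 hr).1).1,
      ((hmem r).1 (Finset.mem_filter.1 hr).1).2, fun hr' =>
        (Finset.mem_filter.1 hr).2 (Finset.mem_filter.1 hr').2⟩)
    (fun r hr hrM => by rw [hJ, hK, Finset.filter_union_filter_not_eq]; exact (hmem r).2 ⟨hr, hrM⟩)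
    ?_
  simp only [sieveCheck, decide_eq_true_eq] at h
  have hKc := card_le_of_split _ K hKL hKm
  have hS := sum_inv_le_of_split _ K hB hKL hKm
  set L₁ := L.filter (· < A)
  set L₂ := L.filter (A ≤ ·)
  have hY : 0 < 10 ^ 6 * lo -
      ((recipBound L₂ + m * (10 ^ 6 / B + 1)) * lo + 2 * (n - 1) * 10 ^ 6) := by
    rw [Nat.pos_iff_ne_zero]
    intro h0
    rw [h0] at h
    simp at h
  have h1 := mul_sq_lt_sqrt_mul_div hn4 hloq (by omega) (by positivity) h
  have h2 := div_le_of_sub (by norm_num) hlo hloq (by exact_mod_cast hS) hY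
  push_cast [Nat.cast_sub (show 1 ≤ n by omega)] at h2
  calc 2 * 2 ^ J.card * (K.card + 2 * n - 1) * (q : ℝ) ^ 2
      ≤ ((2 * 2 ^ L₁.length * (L₂.length + m + 2 * n - 1) : ℕ) : ℝ) * (q : ℝ) ^ 2 := by
        have h3 : (K.card : ℝ) ≤ L₂.length + m := by exact_mod_cast hKc
        push_cast [Nat.cast_sub (show 1 ≤ L₂.length + m + 2 * n by omega)]
        have : (4 : ℝ) ≤ n := by exact_mod_cast hn4
        have h4 : (0 : ℝ) ≤ K.card := by positivity
        gcongr
        · linarith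
        · norm_num
    _ < _ := h1
    _ ≤ _ := by
        refine mul_le_mul_of_nonneg_left ?_ (Real.sqrt_nonneg _)
        push_cast
        exact h2

theorem hasPrimitiveOneNormalPair_of_lineCheck (hq : Fintype.card k = q)
    (hn : Module.finrank k F = n) (hM : M * (q - 1) = q ^ n - 1) (hn4 : 5 ≤ n) (hq64 : 64 ≤ q)
    {lo B m c : ℕ} {L : List ℕ} (hlo : 0 < lo) (hloq : lo ≤ q) (hB : 0 < B) (hc : 0 < c)
    (hcB : c < B ^ (m + 1)) (hcM : ∀ r, r.Prime → r ∣ M → B ≤ r → r ∣ c)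
    (hL : ∀ r, r.Prime → r ∣ M → r < B → r ∈ L) (h : lineCheck n lo B m L = true) :
    HasPrimitiveOneNormalPair k F := by
  classical
  have hq1 : 1 < q := hq ▸ Fintype.one_lt_card
  have hM0 : M ≠ 0 := by
    rintro rfl
    have := Nat.one_lt_pow (by omega : n ≠ 0) hq1
    omega
  have hmem (r : ℕ) : r ∈ M.primeFactors ↔ r.Prime ∧ r ∣ M := by
    rw [Nat.mem_primeFactors]; tauto
  set K := M.primeFactors with hK
  have hKL : ∀ r ∈ K, r < B → r ∈ L := fun r hr hrB =>
    hL r ((hmem r).1 hr).1 ((hmem r).1 hr).2 hrB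
  have hKm : (K.filter (¬ · < B)).card ≤ m := by
    refine card_le_of_forall_prime_dvd hc hB _ (fun r hr => ?_) hcB
    rw [Finset.mem_filter, hmem, not_lt] at hr
    exact ⟨hr.1.1, hr.2, hcM r hr.1.1 hr.1.2 hr.2⟩
  have hlarge : ((q : ℝ) ^ n) / q ^ 3 + 2 * √((q : ℝ) ^ n) + 1 < (q : ℝ) ^ n / q ^ 2 := by
    have h64 : (64 : ℝ) ≤ q := by exact_mod_cast hq64
    have hq0 : (0 : ℝ) < q := by linarith
    set s := √((q : ℝ) ^ (n - 4)) with hs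
    have hss : s ^ 2 = (q : ℝ) ^ (n - 4) := Real.sq_sqrt (by positivity)
    have h1 : √((q : ℝ) ^ n) = (q : ℝ) ^ 2 * s := by
      obtain ⟨m, rfl⟩ := Nat.exists_eq_add_of_le (show 4 ≤ n by omega)
      rw [hs, Nat.add_sub_cancel_left, pow_add, Real.sqrt_mul (by positivity),
        show (q : ℝ) ^ 4 = ((q : ℝ) ^ 2) ^ 2 by ring, Real.sqrt_sq (by positivity)]
    have h2 : (q : ℝ) ^ n = q ^ 4 * s ^ 2 := by
      rw [hss, ← pow_add, Nat.add_sub_cancel' (by omega)]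
    have h8 : 8 ≤ s := by
      refine Real.le_sqrt_of_sq_le ?_
      calc (8 : ℝ) ^ 2 = 64 := by norm_num
        _ ≤ q := h64
        _ = (q : ℝ) ^ 1 := (pow_one _).symm
        _ ≤ _ := pow_le_pow_right₀ (by linarith) (by omega)
    rw [h1, h2, show (q : ℝ) ^ 4 * s ^ 2 / q ^ 3 = q * s ^ 2 by field_simp,
      show (q : ℝ) ^ 4 * s ^ 2 / q ^ 2 = q ^ 2 * s ^ 2 by field_simp]
    have h3 : q * s ^ 2 * 64 ≤ q * s ^ 2 * q := by gcongr
    have h4 : (q : ℝ) ^ 2 * s * 8 ≤ q ^ 2 * s * s := by gcongr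
    have h5 : (1 : ℝ) < q ^ 2 * s ^ 2 / 8 := by
      nlinarith [sq_nonneg (q * s), mul_pos hq0 (show 0 < s by linarith)]
    nlinarith
  refine hasPrimitiveOneNormalPair_of_prime_sieve_of_line hq hn hM hlarge K hmem ?_
  simp only [lineCheck, decide_eq_true_eq] at h
  have hKc := card_le_of_split _ K hKL hKm
  have hS := sum_inv_le_of_split _ K hB hKL hKm
  have hY : 0 < 10 ^ 6 * lo -
      ((recipBound L + m * (10 ^ 6 / B + 1)) * lo + 2 * (n - 1) ^ 2 * 10 ^ 6) := by
    rw [Nat.pos_iff_ne_zero]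
    intro h0
    rw [h0] at h
    simp at h
  have h1 := mul_sq_lt_sqrt_mul_div (by omega) hloq (by omega) (by positivity) h
  have h2 := div_le_of_sub (by norm_num) hlo hloq (by exact_mod_cast hS) hY
  push_cast [Nat.cast_sub (show 1 ≤ n by omega)] at h2
  calc 2 * (K.card + 1) * (q : ℝ) ^ 2
      ≤ ((2 * (L.length + m + 1) : ℕ) : ℝ) * (q : ℝ) ^ 2 := by
        have h3 : (K.card : ℝ) ≤ L.length + m := by exact_mod_cast hKc
        push_cast
        gcongr
    _ < _ := h1
    _ ≤ _ := by
        refine mul_le_mul_of_nonneg_left ?_ (Real.sqrt_nonneg _)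
        push_cast
        exact h2

/-- Integer test for the criterion in which all prime divisors are sieved exactly; the number of
them is estimated by means of the possible prime divisors `L` below `2 ^ t`. -/
def fullCheck (n lo t : ℕ) (L : List ℕ) : Bool :=
  decide (2 * (n - 1) < (n - 4) * t ∧ 2 * (n - 1) < lo ∧
    (4 * (2 * n - 1) ^ 2 * lo ^ 2) ^ t * (4 * ((2 ^ t) ^ L.length) ^ 2) <
      lo ^ ((n - 4) * t - 2 * (n - 1)) * ((lo - 2 * (n - 1)) ^ (2 * t) * L.prod ^ 2))

theorem hasPrimitiveOneNormalPair_of_two_pow_lt (hq : Fintype.card k = q)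
    (hn : Module.finrank k F = n) (hM : M * (q - 1) = q ^ n - 1) (hn4 : 4 ≤ n)
    (h : 2 * 2 ^ M.primeFactors.card * (2 * n - 1) * (q : ℝ) ^ 2 <
      √((q : ℝ) ^ n) * (1 - 2 * (n - 1) / q)) :
    HasPrimitiveOneNormalPair k F := by
  classical
  have hq1 : 1 < q := hq ▸ Fintype.one_lt_card
  have hM0 : M ≠ 0 := by
    rintro rfl
    have := Nat.one_lt_pow (by omega : n ≠ 0) hq1
    omega
  refine hasPrimitiveOneNormalPair_of_prime_sieve hq hn hM M.primeFactors ∅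
    (fun r hr => ⟨Nat.prime_of_mem_primeFactors hr, Nat.dvd_of_mem_primeFactors hr⟩) (by simp)
    (fun r hr hrM => by simp [hr, hrM, hM0]) (by simpa using h)

end Criteria

section FullSieve

variable {k F : Type*} [Field k] [Fintype k] [Field F] [Fintype F] [Algebra k F] {q n M : ℕ}

theorem hasPrimitiveOneNormalPair_of_sq_lt (hq : Fintype.card k = q)
    (hn : Module.finrank k F = n) (hM : M * (q - 1) = q ^ n - 1) (hn4 : 4 ≤ n)
    (hqn : 2 * (n - 1) ≤ q)
    (h : (2 * 2 ^ M.primeFactors.card * (2 * n - 1) * q) ^ 2 <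
      q ^ (n - 4) * (q - 2 * (n - 1)) ^ 2) :
    HasPrimitiveOneNormalPair k F := by
  have hq1 : 1 < q := hq ▸ Fintype.one_lt_card
  refine hasPrimitiveOneNormalPair_of_two_pow_lt hq hn hM hn4 ?_
  have h1 := mul_sq_lt_sqrt_mul_div hn4 le_rfl (by omega) (by omega : 0 < q) h
  have hq0 : (q : ℝ) ≠ 0 := by positivity
  rw [Nat.cast_sub hqn, sub_div, div_self hq0] at h1
  push_cast [Nat.cast_sub (show 1 ≤ n by omega), Nat.cast_sub (show 1 ≤ 2 * n by omega)] at h1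
  exact h1

theorem hasPrimitiveOneNormalPair_of_fullCheck (hq : Fintype.card k = q)
    (hn : Module.finrank k F = n) (hM : M * (q - 1) = q ^ n - 1) (hn4 : 4 ≤ n) {lo t : ℕ}
    {L : List ℕ} (hloq : lo ≤ q) (hnodup : L.Nodup) (hLt : ∀ r ∈ L, r < 2 ^ t)
    (hL : ∀ r, r.Prime → r ∣ M → r < 2 ^ t → r ∈ L) (h : fullCheck n lo t L = true) :
    HasPrimitiveOneNormalPair k F := by
  have hq1 : 1 < q := hq ▸ Fintype.one_lt_card
  have hM0 : M ≠ 0 := by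
    rintro rfl
    have := Nat.one_lt_pow (by omega : n ≠ 0) hq1
    omega
  simp only [fullCheck, decide_eq_true_eq] at h
  obtain ⟨he, hlo, h⟩ := h
  refine hasPrimitiveOneNormalPair_of_sq_lt hq hn hM hn4 (by omega) ?_
  have hprod := prod_pow_le_of_forall_primeFactors hM0 L.toFinset
    (fun r hr => hLt r (List.mem_toFinset.1 hr))
    (fun r h1 h2 h3 => List.mem_toFinset.2 (hL r h1 h2 h3))
  rw [List.toFinset_card_of_nodup hnodup, List.prod_toFinset _ hnodup, List.map_id'] at hprod
  have hprod' := hprod.trans (Nat.mul_le_mul_left _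
    (lt_two_mul_pow_of_mul_sub_one hq1 (by omega) hM).le)
  rw [pow_right_comm] at hprod'
  generalize 2 ^ M.primeFactors.card = w at *
  generalize (2 ^ t) ^ L.length = z at *
  generalize L.prod = P at *
  set a := 2 * (n - 1) with ha
  set e := (n - 4) * t - a with hedef
  have hee : (n - 4) * t = e + a := by omega
  have hsub : (lo - a) * q ≤ (q - a) * lo := by
    obtain ⟨u, rfl⟩ := Nat.exists_eq_add_of_lt hlo
    obtain ⟨v, rfl⟩ := Nat.exists_eq_add_of_le hloq
    rw [show a + u + 1 - a = u + 1 by omega, show a + u + 1 + v - a = u + 1 + v by omega]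
    nlinarith
  have ht : t ≠ 0 := by
    rintro rfl
    omega
  have hlo0 : 0 < lo := by omega
  refine lt_of_pow_lt_pow_left₀ t (Nat.zero_le _) ?_
  have hP : 0 < P := by
    rw [Nat.pos_iff_ne_zero]
    rintro rfl
    simp at h
  refine lt_of_mul_lt_mul_right (a := P ^ 2 * lo ^ (2 * t)) ?_ (Nat.zero_le _)
  calc ((2 * w * (2 * n - 1) * q) ^ 2) ^ t * (P ^ 2 * lo ^ (2 * t))
      = (4 * (2 * n - 1) ^ 2) ^ t * (q ^ 2) ^ t * lo ^ (2 * t) * (w ^ t * P) ^ 2 := by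
        rw [show (2 * w * (2 * n - 1) * q) ^ 2 = 4 * (2 * n - 1) ^ 2 * q ^ 2 * w ^ 2 by ring,
          mul_pow, mul_pow (4 * (2 * n - 1) ^ 2), pow_right_comm w 2 t]
        ring
    _ ≤ (4 * (2 * n - 1) ^ 2) ^ t * (q ^ 2) ^ t * lo ^ (2 * t) * (z * (2 * q ^ (n - 1))) ^ 2 := by
        gcongr
    _ = (4 * (2 * n - 1) ^ 2 * lo ^ 2) ^ t * (4 * z ^ 2) * (q ^ (2 * t) * q ^ a) := by
        rw [mul_pow _ (lo ^ 2), pow_mul lo, pow_mul q, ha, pow_mul' q 2]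
        ring
    _ < lo ^ e * ((lo - a) ^ (2 * t) * P ^ 2) * (q ^ (2 * t) * q ^ a) := by gcongr
    _ = lo ^ e * q ^ a * P ^ 2 * ((lo - a) * q) ^ (2 * t) := by rw [mul_pow]; ring
    _ ≤ q ^ e * q ^ a * P ^ 2 * ((q - a) * lo) ^ (2 * t) := by gcongr
    _ = (q ^ (n - 4) * (q - a) ^ 2) ^ t * (P ^ 2 * lo ^ (2 * t)) := by
        rw [mul_pow, mul_pow, ← pow_add, ← hee, pow_mul, ← pow_mul (q - a)]
        ring

theorem hasPrimitiveOneNormalPair_of_le (hq : Fintype.card k = q)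
    (hn : Module.finrank k F = n) (hM : M * (q - 1) = q ^ n - 1) (hn17 : 17 ≤ n)
    (hqn : 2 * n ≤ q) : HasPrimitiveOneNormalPair k F := by
  have hq1 : 1 < q := hq ▸ Fintype.one_lt_card
  have hM0 : M ≠ 0 := by
    rintro rfl
    have := Nat.one_lt_pow (by omega : n ≠ 0) hq1
    omega
  refine hasPrimitiveOneNormalPair_of_sq_lt hq hn hM (by omega) (by omega) ?_
  have hprod := prod_pow_le_of_forall_primeFactors (t := 4) hM0 {2, 3, 5, 7, 11, 13} (by decide)
    (fun r h1 _ h3 => by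
      have h2 := h1.two_le
      norm_num at h3
      interval_cases r <;> revert h1 <;> decide)
  have hMq := lt_two_mul_pow_of_mul_sub_one hq1 (by omega) hM
  rw [pow_right_comm] at hprod
  generalize 2 ^ M.primeFactors.card = w at *
  have hprod2 : w ^ 4 * 30030 ≤ 16 ^ 6 * M := by
    refine le_trans (le_of_eq ?_) (hprod.trans (le_of_eq ?_)) <;> rfl
  have hw : w ^ 4 ≤ 1118 * q ^ (n - 1) := by omega
  have hw2 : w ^ 2 * q ^ 8 < q ^ n := by
    refine lt_of_pow_lt_pow_left₀ 2 (Nat.zero_le _) ?_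
    calc (w ^ 2 * q ^ 8) ^ 2 = w ^ 4 * q ^ 16 := by ring
      _ ≤ 1118 * q ^ (n - 1) * q ^ 16 := by gcongr
      _ < 34 ^ 2 * q ^ (n - 1) * q ^ 16 := by gcongr; norm_num
      _ ≤ q ^ 2 * q ^ (n - 1) * q ^ 16 := by gcongr; omega
      _ = q ^ (n + 17) := by
        rw [← pow_add, ← pow_add]
        congr 1
        omega
      _ ≤ (q ^ n) ^ 2 := by
        rw [← pow_mul]
        exact Nat.pow_le_pow_right (by omega) (by omega)
  refine lt_of_mul_lt_mul_right (a := q ^ 4) ?_ (Nat.zero_le _)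
  calc (2 * w * (2 * n - 1) * q) ^ 2 * q ^ 4 ≤ (2 * w * q * q) ^ 2 * q ^ 4 := by
        gcongr
        omega
    _ = 4 * (w ^ 2 * q ^ 8) := by ring
    _ < 4 * q ^ n := by gcongr
    _ = q ^ (n - 4) * 2 ^ 2 * q ^ 4 := by
        rw [mul_right_comm, ← pow_add, Nat.sub_add_cancel (by omega)]
        ring
    _ ≤ q ^ (n - 4) * (q - 2 * (n - 1)) ^ 2 * q ^ 4 := by
        gcongr
        omega

end FullSieve

section PrimeTable

/-- The primes below `1024`. -/
def smallPrimes : List ℕ :=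
  [2, 3, 5, 7, 11, 13, 17, 19, 23, 29, 31, 37, 41, 43, 47, 53, 59, 61, 67, 71, 73, 79, 83, 89, 97,
   101, 103, 107, 109, 113, 127, 131, 137, 139, 149, 151, 157, 163, 167, 173, 179, 181, 191, 193,
   197, 199, 211, 223, 227, 229, 233, 239, 241, 251, 257, 263, 269, 271, 277, 281, 283, 293, 307,
   311, 313, 317, 331, 337, 347, 349, 353, 359, 367, 373, 379, 383, 389, 397, 401, 409, 419, 421,
   431, 433, 439, 443, 449, 457, 461, 463, 467, 479, 487, 491, 499, 503, 509, 521, 523, 541, 547,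
   557, 563, 569, 571, 577, 587, 593, 599, 601, 607, 613, 617, 619, 631, 641, 643, 647, 653, 659,
   661, 673, 677, 683, 691, 701, 709, 719, 727, 733, 739, 743, 751, 757, 761, 769, 773, 787, 797,
   809, 811, 821, 823, 827, 829, 839, 853, 857, 859, 863, 877, 881, 883, 887, 907, 911, 919, 929,
   937, 941, 947, 953, 967, 971, 977, 983, 991, 997, 1009, 1013, 1019, 1021]

theorem nodup_smallPrimes : smallPrimes.Nodup := by decide +kernel

theorem mem_smallPrimes {r : ℕ} (hr : r.Prime) (h : r < 1024) : r ∈ smallPrimes := by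
  have key : ∀ r < 1024, r ∈ smallPrimes ∨ r < 2 ∨
      ∃ s ∈ [2, 3, 5, 7, 11, 13, 17, 19, 23, 29, 31], s ∣ r ∧ s < r := by decide +kernel
  rcases key r h with h1 | h1 | ⟨s, hs, hsr, hlt⟩
  · exact h1
  · exact absurd hr.two_le (by omega)
  · rcases (Nat.dvd_prime hr).1 hsr with rfl | rfl
    · simp at hs
    · omega

/-- The primes below `B ≤ 1024` which may divide `(q ^ n - 1) / (q - 1)`. -/
def possiblePrimes (n B : ℕ) (nprime : Bool) : List ℕ :=
  smallPrimes.filter fun r => r < B && (!nprime || r == n || r % n == 1)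

variable {q n M : ℕ}

theorem mem_possiblePrimes {B r : ℕ} {nprime : Bool} (hq : 1 < q)
    (hM : M * (q - 1) = q ^ n - 1) (hB : B ≤ 1024) (hn : nprime = true → n.Prime) (hr : r.Prime)
    (hrM : r ∣ M) (hrB : r < B) : r ∈ possiblePrimes n B nprime := by
  refine List.mem_filter.2 ⟨mem_smallPrimes hr (by omega), ?_⟩
  cases nprime
  · simpa using hrB
  · rcases eq_or_modEq_one_of_prime_dvd hq (hn rfl) hM hr hrM with h | h <;> simp [h, hrB]
    omega

variable {k F : Type*} [Field k] [Fintype k] [Field F] [Fintype F] [Algebra k F]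

theorem hasPrimitiveOneNormalPair_of_interval (hq : Fintype.card k = q)
    (hn : Module.finrank k F = n) (hM : M * (q - 1) = q ^ n - 1)
    (lo hi A B m : ℕ) (nprime : Bool) (hprime : nprime = true → n.Prime) (hloq : lo ≤ q)
    (hqhi : q < hi)
    (h : (decide (4 ≤ n ∧ 0 < lo ∧ A ≤ B ∧ 0 < B ∧ B ≤ 1024 ∧ 2 * hi ^ (n - 1) < B ^ (m + 1)) &&
      sieveCheck n lo A B m (possiblePrimes n B nprime)) = true) :
    HasPrimitiveOneNormalPair k F := by
  have hq1 : 1 < q := hq ▸ Fintype.one_lt_card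
  rw [Bool.and_eq_true, decide_eq_true_eq] at h
  obtain ⟨⟨hn4, hlo, hAB, hB, hB2, hpow⟩, h⟩ := h
  have hM2 := lt_two_mul_pow_of_mul_sub_one hq1 (by omega) hM
  refine hasPrimitiveOneNormalPair_of_sieveCheck hq hn hM hn4 hlo hloq hAB hB (c := M) ?_ ?_
    (fun r _ hrM _ => hrM) (fun r hr hrM hrB => mem_possiblePrimes hq1 hM hB2 hprime hr hrM hrB) h
  · rw [Nat.pos_iff_ne_zero]
    rintro rfl
    have := Nat.one_lt_pow (by omega : n ≠ 0) hq1
    omega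
  · refine hM2.trans_le (le_trans ?_ hpow.le)
    gcongr

theorem hasPrimitiveOneNormalPair_of_interval_of_line (hq : Fintype.card k = q)
    (hn : Module.finrank k F = n) (hM : M * (q - 1) = q ^ n - 1)
    (lo hi B m : ℕ) (nprime : Bool) (hprime : nprime = true → n.Prime) (hloq : lo ≤ q)
    (hqhi : q < hi)
    (h : (decide (5 ≤ n ∧ 64 ≤ lo ∧ 0 < B ∧ B ≤ 1024 ∧ 2 * hi ^ (n - 1) < B ^ (m + 1)) &&
      lineCheck n lo B m (possiblePrimes n B nprime)) = true) :
    HasPrimitiveOneNormalPair k F := by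
  have hq1 : 1 < q := hq ▸ Fintype.one_lt_card
  rw [Bool.and_eq_true, decide_eq_true_eq] at h
  obtain ⟨⟨hn4, hlo, hB, hB2, hpow⟩, h⟩ := h
  have hM2 := lt_two_mul_pow_of_mul_sub_one hq1 (by omega) hM
  refine hasPrimitiveOneNormalPair_of_lineCheck hq hn hM hn4 (by omega) (by omega) hloq hB
    (c := M) ?_ ?_ (fun r _ hrM _ => hrM)
    (fun r hr hrM hrB => mem_possiblePrimes hq1 hM hB2 hprime hr hrM hrB) h
  · rw [Nat.pos_iff_ne_zero]
    rintro rfl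
    have := Nat.one_lt_pow (by omega : n ≠ 0) hq1
    omega
  · refine hM2.trans_le (le_trans ?_ hpow.le)
    gcongr

theorem hasPrimitiveOneNormalPair_of_tail (hq : Fintype.card k = q)
    (hn : Module.finrank k F = n) (hM : M * (q - 1) = q ^ n - 1)
    (lo t : ℕ) (nprime : Bool) (hprime : nprime = true → n.Prime) (hloq : lo ≤ q)
    (h : (decide (4 ≤ n ∧ t ≤ 10) &&
      fullCheck n lo t (possiblePrimes n (2 ^ t) nprime)) = true) :
    HasPrimitiveOneNormalPair k F := by
  have hq1 : 1 < q := hq ▸ Fintype.one_lt_card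
  rw [Bool.and_eq_true, decide_eq_true_eq] at h
  obtain ⟨⟨hn4, ht⟩, h⟩ := h
  refine hasPrimitiveOneNormalPair_of_fullCheck hq hn hM hn4 hloq (nodup_smallPrimes.filter _)
    (fun r hr => ?_) (fun r hr hrM hrB => mem_possiblePrimes hq1 hM
      (Nat.pow_le_pow_right (by norm_num) ht) hprime hr hrM hrB) h
  have := (List.mem_filter.1 hr).2
  simp only [Bool.and_eq_true, decide_eq_true_eq] at this
  exact this.1

/-- Integer test for a single `q`, based on the prime divisors of `(q ^ n - 1) / (q - 1)` below
`1024`. -/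
def pointCheck (n q : ℕ) : Bool :=
  let M := (q ^ n - 1) / (q - 1)
  let L := smallPrimes.filter fun r => M % r == 0
  let m := Nat.log2 (M / Nat.gcd M (L.prod ^ 32)) / 10
  (decide (64 ≤ q ∧ 5 ≤ n) && lineCheck n q 1024 m L) ||
    [0, 3, 4, 6, 8, 12].any fun A => sieveCheck n q A 1024 m L

theorem hasPrimitiveOneNormalPair_of_pointCheck (hq : Fintype.card k = q)
    (hn : Module.finrank k F = n) (hM : M * (q - 1) = q ^ n - 1) (hn4 : 4 ≤ n)
    (h : pointCheck n q = true) : HasPrimitiveOneNormalPair k F := by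
  have hq1 : 1 < q := hq ▸ Fintype.one_lt_card
  have hM0 : M ≠ 0 := by
    rintro rfl
    have := Nat.one_lt_pow (by omega : n ≠ 0) hq1
    omega
  have hMd : (q ^ n - 1) / (q - 1) = M := by
    rw [← hM, Nat.mul_div_cancel _ (by omega)]
  simp only [pointCheck, hMd] at h
  set L := smallPrimes.filter fun r => M % r == 0 with hL
  set c := M / Nat.gcd M (L.prod ^ 32) with hc
  have hg : Nat.gcd M (L.prod ^ 32) * c = M := Nat.mul_div_cancel' (Nat.gcd_dvd_left _ _)
  have hc0 : 0 < c := by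
    rw [Nat.pos_iff_ne_zero]
    intro h0
    rw [h0, mul_zero] at hg
    exact hM0 hg.symm
  have hmemL (r : ℕ) (hr : r.Prime) (hrM : r ∣ M) (hrB : r < 1024) : r ∈ L :=
    List.mem_filter.2 ⟨mem_smallPrimes hr hrB, by simpa using Nat.mod_eq_zero_of_dvd hrM⟩
  have hlog : c < 1024 ^ (Nat.log2 c / 10 + 1) := by
    rw [show 1024 = 2 ^ 10 by norm_num, ← pow_mul]
    exact (Nat.lt_log2_self).trans_le (Nat.pow_le_pow_right (by norm_num) (by omega))
  have hrc (r : ℕ) (hr : r.Prime) (hrM : r ∣ M) (hrB : 1024 ≤ r) : r ∣ c := by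
    rw [← hg] at hrM
    refine (hr.dvd_mul.1 hrM).resolve_left fun h1 => ?_
    have h2 := hr.dvd_of_dvd_pow (h1.trans (Nat.gcd_dvd_right _ _))
    obtain ⟨s, hs, hrs⟩ := (hr.prime.dvd_prod_iff).1 h2
    have h3 : ∀ s ∈ smallPrimes, 0 < s ∧ s < 1024 := by decide +kernel
    have h4 := h3 s (List.mem_filter.1 hs).1
    exact absurd (Nat.le_of_dvd h4.1 hrs) (by omega)
  rw [Bool.or_eq_true, Bool.and_eq_true, decide_eq_true_eq] at h
  rcases h with ⟨⟨h64, h5⟩, h⟩ | h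
  · exact hasPrimitiveOneNormalPair_of_lineCheck hq hn hM h5 h64 (by omega) le_rfl (by norm_num)
      hc0 hlog hrc hmemL h
  · obtain ⟨A, hA, h⟩ := List.any_eq_true.1 h
    have hA' : A ≤ 1024 := by
      simp only [List.mem_cons, List.not_mem_nil, or_false] at hA
      omega
    exact hasPrimitiveOneNormalPair_of_sieveCheck hq hn hM hn4 (by omega) le_rfl hA' (by norm_num)
      hc0 hlog hrc hmemL h

end PrimeTable

section NumericalCases

/-- An integer form of `q ^ (n / 2 - ϑ) > 2 * ((2 * n - 2) / (1 - (2 * n - 1) / q) + 2)`, where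
`ϑ = 2` if `q` and `n` are coprime and `ϑ = 3` otherwise. -/
def sizeCondition (n q : ℕ) : Bool :=
  q ^ (2 * if Nat.gcd q n = 1 then 2 else 3) *
    (2 * ((2 * n - 2) * q + 2 * (q + 1 - 2 * n))) ^ 2 < q ^ n * (q + 1 - 2 * n) ^ 2

/-- A necessary condition for `q < 2 ^ 12` to be a prime power. -/
def maybePrimePow (q : ℕ) : Bool :=
  [2, 3, 5, 7, 11, 13, 17, 19, 23, 29, 31, 37, 41, 43, 47, 53].all
    fun r => q % r != 0 || r ^ 12 % q == 0

theorem maybePrimePow_of_isPrimePow {q : ℕ} (hq : IsPrimePow q) (hlt : q < 2 ^ 12) :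
    maybePrimePow q = true := by
  obtain ⟨p, e, hp, he, rfl⟩ := (isPrimePow_nat_iff q).1 hq
  have hprimes : ∀ r ∈ [2, 3, 5, 7, 11, 13, 17, 19, 23, 29, 31, 37, 41, 43, 47, 53],
      r.Prime := by
    intro r hr
    simp only [List.mem_cons, List.not_mem_nil, or_false] at hr
    rcases hr with rfl | rfl | rfl | rfl | rfl | rfl | rfl | rfl | rfl | rfl | rfl | rfl | rfl |
      rfl | rfl | rfl <;> norm_num
  refine List.all_eq_true.2 fun r hr => ?_
  rw [Bool.or_eq_true, bne_iff_ne, beq_iff_eq, or_iff_not_imp_left, not_not]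
  intro h0
  obtain rfl : r = p := (Nat.prime_dvd_prime_iff_eq (hprimes r hr) hp).1
    ((hprimes r hr).dvd_of_dvd_pow (Nat.dvd_of_mod_eq_zero h0))
  refine Nat.mod_eq_zero_of_dvd (pow_dvd_pow r ?_)
  have h1 : 2 ^ e < 2 ^ 12 := (Nat.pow_le_pow_left hp.two_le e).trans_lt hlt
  exact ((Nat.pow_lt_pow_iff_right (by norm_num)).1 h1).le

/-- The pairs `(n, q)` which are treated by exhibiting an element. -/
def exceptionalCard : ℕ → List ℕ
  | 6 => [37, 41, 43, 47, 49, 53, 59, 61, 67, 71, 73, 79, 83, 89, 97, 101, 103, 107, 109, 113,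
      121, 125, 131, 137, 139, 149, 151, 163, 169, 173, 179, 181, 199, 229]
  | 8 => [17, 19, 23]
  | _ => []

/-- The test applied to all `q` below a given bound. -/
def rangeCheck (n bound : ℕ) : Bool :=
  (List.range bound).all fun q =>
    !maybePrimePow q || !sizeCondition n q || (exceptionalCard n).contains q || pointCheck n q

variable {k F : Type*} [Field k] [Fintype k] [Field F] [Fintype F] [Algebra k F] {q n M : ℕ}

theorem hasPrimitiveOneNormalPair_of_rangeCheck (hq : Fintype.card k = q)
    (hn : Module.finrank k F = n) (hM : M * (q - 1) = q ^ n - 1) (hn4 : 4 ≤ n)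
    (hsize : sizeCondition n q = true) (hexc : q ∉ exceptionalCard n) {bound : ℕ}
    (hb : bound ≤ 2 ^ 12) (hqb : q < bound) (h : rangeCheck n bound = true) :
    HasPrimitiveOneNormalPair k F := by
  have hpp : IsPrimePow q := hq ▸ FiniteField.isPrimePow_card k
  have h1 := List.all_eq_true.1 h q (List.mem_range.2 hqb)
  rw [maybePrimePow_of_isPrimePow hpp (by omega), hsize,
    show (exceptionalCard n).contains q = false by simpa using hexc] at h1
  exact hasPrimitiveOneNormalPair_of_pointCheck hq hn hM hn4 (by simpa using h1)

theorem five_le_of_sizeCondition (hq : 2 * n ≤ q) (hn : 0 < n) (h : sizeCondition n q = true) :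
    5 ≤ n := by
  by_contra! hlt
  simp only [sizeCondition, decide_eq_true_eq] at h
  refine absurd h (not_lt.2 ?_)
  gcongr
  · omega
  · split_ifs <;> omega
  · omega

theorem hasPrimitiveOneNormalPair_of_sizeCondition (hq : Fintype.card k = q)
    (hn : Module.finrank k F = n) (hqn : 2 * n ≤ q) (hn0 : 0 < n)
    (hsize : sizeCondition n q = true) (hexc : q ∉ exceptionalCard n) :
    HasPrimitiveOneNormalPair k F := by
  have hn5 := five_le_of_sizeCondition hqn hn0 hsize
  have hM : (∑ i ∈ Finset.range n, q ^ i) * (q - 1) = q ^ n - 1 := by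
    have h1 := Nat.geomSum_eq (m := q) (by omega) n
    rw [h1]
    exact Nat.div_mul_cancel (by simpa using Nat.sub_dvd_pow_sub_pow q 1 n)
  rcases Nat.lt_or_ge 16 n with hn17 | hn16
  · exact hasPrimitiveOneNormalPair_of_le hq hn hM hn17 hqn
  have hrange {bound : ℕ} (hb : bound ≤ 2 ^ 12) (h : rangeCheck n bound = true)
      (hqb : q < bound) := hasPrimitiveOneNormalPair_of_rangeCheck hq hn hM (by omega) hsize hexc
        hb hqb h
  have hinterval := hasPrimitiveOneNormalPair_of_interval hq hn hM
  have hline := hasPrimitiveOneNormalPair_of_interval_of_line hq hn hM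
  have htail := hasPrimitiveOneNormalPair_of_tail hq hn hM
  clear hsize hexc hM hn
  obtain rfl | rfl | rfl | rfl | rfl | rfl | rfl | rfl | rfl | rfl | rfl | rfl :
      n = 5 ∨ n = 6 ∨ n = 7 ∨ n = 8 ∨ n = 9 ∨ n = 10 ∨ n = 11 ∨ n = 12 ∨ n = 13 ∨ n = 14 ∨
        n = 15 ∨ n = 16 := by omega
  · rcases Nat.lt_or_ge q 2690 with h1 | h1
    · exact hrange (by norm_num) (by decide +kernel) h1
    rcases Nat.lt_or_ge q 4368 with h2 | h2
    · exact hline 2690 4368 100 7 true (by norm_num) h1 h2 (by decide +kernel)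
    rcases Nat.lt_or_ge q 117852 with h3 | h3
    · exact hline 4368 117852 100 10 true (by norm_num) h2 h3 (by decide +kernel)
    rcases Nat.lt_or_ge q (2 ^ 117) with h4 | h4
    · exact hline 117852 (2 ^ 117) 400 54 true (by norm_num) h3 h4 (by decide +kernel)
    exact htail (2 ^ 117) 10 true (by norm_num) h4 (by decide +kernel)
  · rcases Nat.lt_or_ge q 3134 with h1 | h1
    · exact hrange (by norm_num) (by decide +kernel) h1
    rcases Nat.lt_or_ge q 4442 with h2 | h2
    · exact hinterval 3134 4442 6 50 10 false (by simp) h1 h2 (by decide +kernel)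
    rcases Nat.lt_or_ge q 28832 with h3 | h3
    · exact hinterval 4442 28832 8 50 13 false (by simp) h2 h3 (by decide +kernel)
    rcases Nat.lt_or_ge q (2 ^ 44) with h4 | h4
    · exact hinterval 28832 (2 ^ 44) 12 200 28 false (by simp) h3 h4 (by decide +kernel)
    exact htail (2 ^ 44) 7 false (by simp) h4 (by decide +kernel)
  · rcases Nat.lt_or_ge q 31 with h1 | h1
    · exact hrange (by norm_num) (by decide +kernel) h1
    rcases Nat.lt_or_ge q (2 ^ 10) with h2 | h2
    · exact hinterval 31 (2 ^ 10) 0 100 9 true (by norm_num) h1 h2 (by decide +kernel)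
    exact htail (2 ^ 10) 7 true (by norm_num) h2 (by decide +kernel)
  · rcases Nat.lt_or_ge q 115 with h1 | h1
    · exact hrange (by norm_num) (by decide +kernel) h1
    rcases Nat.lt_or_ge q (2 ^ 13) with h2 | h2
    · exact hinterval 115 (2 ^ 13) 8 100 13 false (by simp) h1 h2 (by decide +kernel)
    exact htail (2 ^ 13) 6 false (by simp) h2 (by decide +kernel)
  · rcases Nat.lt_or_ge q 65 with h1 | h1
    · exact hrange (by norm_num) (by decide +kernel) h1
    rcases Nat.lt_or_ge q (2 ^ 10) with h2 | h2
    · exact hinterval 65 (2 ^ 10) 12 50 14 false (by simp) h1 h2 (by decide +kernel)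
    exact htail (2 ^ 10) 5 false (by simp) h2 (by decide +kernel)
  · rcases Nat.lt_or_ge q 46 with h1 | h1
    · exact hrange (by norm_num) (by decide +kernel) h1
    rcases Nat.lt_or_ge q (2 ^ 8) with h2 | h2
    · exact hinterval 46 (2 ^ 8) 18 50 12 false (by simp) h1 h2 (by decide +kernel)
    exact htail (2 ^ 8) 5 false (by simp) h2 (by decide +kernel)
  · rcases Nat.lt_or_ge q 23 with h1 | h1
    · exact hrange (by norm_num) (by decide +kernel) h1
    exact htail 23 8 true (by norm_num) h1 (by decide +kernel)
  · rcases Nat.lt_or_ge q 37 with h1 | h1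
    · exact hrange (by norm_num) (by decide +kernel) h1
    rcases Nat.lt_or_ge q (2 ^ 6) with h2 | h2
    · exact hinterval 37 (2 ^ 6) 24 50 11 false (by simp) h1 h2 (by decide +kernel)
    exact htail (2 ^ 6) 5 false (by simp) h2 (by decide +kernel)
  · exact htail 26 5 true (by norm_num) hqn (by decide +kernel)
  · rcases Nat.lt_or_ge q 32 with h1 | h1
    · exact hrange (by norm_num) (by decide +kernel) h1
    exact htail 32 5 false (by simp) h1 (by decide +kernel)
  · exact htail 30 6 false (by simp) hqn (by decide +kernel)
  · exact htail 32 5 false (by simp) hqn (by decide +kernel)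

end NumericalCases

section PackedArithmetic

/-- Evaluates a number before it is passed on, which makes kernel reduction call-by-value. -/
def forceNat {β : Type} (a : ℕ) (f : ℕ → β) : β :=
  Nat.rec (motive := fun _ => β) (f 0) (fun m _ => f (Nat.succ m)) a

@[simp]
theorem forceNat_eq {β : Type} (a : ℕ) (f : ℕ → β) : forceNat a f = f a := by
  cases a <;> rfl

/-- Replaces `T` by `g` in the base `T` expansion of `z`, repeatedly. -/
def foldPacked (T g n z : ℕ) : ℕ :=
  Nat.rec (motive := fun _ => ℕ → ℕ) (fun z => z)
    (fun _ ih z => forceNat z fun z => ih (Nat.add (Nat.mod z T) (Nat.mul (Nat.div z T) g))) n z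

/-- Reduces the lowest `n` digits of `z` in base `B` modulo `p`, dropping the others. -/
def reducePacked (B p n z : ℕ) : ℕ :=
  Nat.rec (motive := fun _ => ℕ → ℕ) (fun _ => 0)
    (fun _ ih z => forceNat z fun z =>
      Nat.add (Nat.mod (Nat.mod z B) p) (Nat.mul B (ih (Nat.div z B)))) n z

theorem foldPacked_succ (T g n z : ℕ) :
    foldPacked T g (n + 1) z = foldPacked T g n (z % T + z / T * g) :=
  forceNat_eq z fun z => foldPacked T g n (z % T + z / T * g)

theorem reducePacked_succ (B p n z : ℕ) :
    reducePacked B p (n + 1) z = z % B % p + B * reducePacked B p n (z / B) :=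
  forceNat_eq z fun z => z % B % p + B * reducePacked B p n (z / B)

theorem coeff_le_eval_one (P : ℕ[X]) (i : ℕ) : P.coeff i ≤ P.eval 1 := by
  rw [eval_eq_sum_range]
  simp only [one_pow, mul_one]
  rcases Nat.lt_or_ge P.natDegree i with h | h
  · rw [coeff_eq_zero_of_natDegree_lt h]
    exact Nat.zero_le _
  · exact Finset.single_le_sum (f := P.coeff) (fun _ _ => Nat.zero_le _)
      (Finset.mem_range.2 (Nat.lt_succ_of_le h))

/-- The number `z` encodes a polynomial with at most `d` coefficients of sum at most `s` by its
value at `B`, and this polynomial takes the value `x` at `θ`. -/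
def IsPacked {R : Type*} [CommRing R] (θ : R) (B d s z : ℕ) (x : R) : Prop :=
  ∃ P : ℕ[X], P.eval B = z ∧ P.eval 1 ≤ s ∧ (∀ i, d ≤ i → P.coeff i = 0) ∧ aeval θ P = x

variable {R : Type*} [CommRing R] {θ : R} {B d s z : ℕ} {x : R}

theorem IsPacked.eq_zero (h : IsPacked θ B d s 0 x) (hB : 0 < B) : x = 0 := by
  obtain ⟨P, h1, -, -, rfl⟩ := h
  have : P = 0 := by
    ext i
    rw [eval_eq_sum_range, Finset.sum_eq_zero_iff] at h1
    rcases Nat.lt_or_ge P.natDegree i with h | h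
    · rw [coeff_eq_zero_of_natDegree_lt h, coeff_zero]
    · have := h1 i (Finset.mem_range.2 (Nat.lt_succ_of_le h))
      rw [coeff_zero]
      exact (Nat.mul_eq_zero.1 this).resolve_right (pow_pos hB i).ne'
  rw [this, map_zero]

theorem IsPacked.mono {d' s' : ℕ} (h : IsPacked θ B d s z x) (hd : d ≤ d') (hs : s ≤ s') :
    IsPacked θ B d' s' z x := by
  obtain ⟨P, h1, h2, h3, h4⟩ := h
  exact ⟨P, h1, h2.trans hs, fun i hi => h3 i (hd.trans hi), h4⟩

theorem isPacked_zero : IsPacked θ B d s 0 0 :=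
  ⟨0, by simp, by simp, by simp, by simp⟩

theorem isPacked_natCast (a : ℕ) : IsPacked θ B 1 a a (a : R) :=
  ⟨C a, by simp, by simp, fun i hi => coeff_C_of_ne_zero (by omega), by simp⟩

theorem isPacked_root : IsPacked θ B 2 1 B θ :=
  ⟨X, by simp, by simp, fun i hi => coeff_X_of_ne_one (by omega), by simp⟩

theorem IsPacked.add {s' z' : ℕ} {x' : R} (h : IsPacked θ B d s z x)
    (h' : IsPacked θ B d s' z' x') : IsPacked θ B d (s + s') (z + z') (x + x') := by
  obtain ⟨P, h1, h2, h3, h4⟩ := h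
  obtain ⟨P', h1', h2', h3', h4'⟩ := h'
  refine ⟨P + P', by rw [eval_add, h1, h1'], by rw [eval_add]; omega, fun i hi => ?_,
    by rw [map_add, h4, h4']⟩
  rw [coeff_add, h3 i hi, h3' i hi]

theorem IsPacked.mul {d' s' z' : ℕ} {x' : R} (h : IsPacked θ B d s z x)
    (h' : IsPacked θ B d' s' z' x') : IsPacked θ B (d + d' - 1) (s * s') (z * z') (x * x') := by
  obtain ⟨P, h1, h2, h3, h4⟩ := h
  obtain ⟨P', h1', h2', h3', h4'⟩ := h'
  refine ⟨P * P', by rw [eval_mul, h1, h1'], by rw [eval_mul]; exact Nat.mul_le_mul h2 h2',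
    fun i hi => ?_, by rw [map_mul, h4, h4']⟩
  rw [coeff_mul]
  refine Finset.sum_eq_zero fun a ha => ?_
  have := Finset.HasAntidiagonal.mem_antidiagonal.1 ha
  rcases Nat.lt_or_ge a.1 d with hlt | hge
  · rw [h3' a.2 (by omega), mul_zero]
  · rw [h3 a.1 hge, zero_mul]

/-- The lowest digit of an encoded polynomial is its constant coefficient. -/
theorem IsPacked.exists_digit (h : IsPacked θ B d s z x) (hs : s < B) :
    ∃ a x', a = z % B ∧ a ≤ s ∧ IsPacked θ B (d - 1) (s - a) (z / B) x' ∧ x = a + θ * x' := by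
  obtain ⟨P, h1, h2, h3, rfl⟩ := h
  have hP : P.divX * X + C (P.coeff 0) = P := divX_mul_X_add P
  have ha : P.coeff 0 < B := (coeff_le_eval_one P 0).trans_lt (h2.trans_lt hs)
  have hz : z = P.coeff 0 + B * P.divX.eval B := by
    rw [← h1]
    conv_lhs => rw [← hP]
    simp only [eval_add, eval_mul, eval_X, eval_C]
    ring
  have h5 : P.eval 1 = P.divX.eval 1 + P.coeff 0 := by
    conv_lhs => rw [← hP]
    simp
  refine ⟨P.coeff 0, aeval θ P.divX, ?_, by omega, ⟨P.divX, ?_, by omega, fun i hi => ?_, rfl⟩, ?_⟩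
  · rw [hz, Nat.add_mul_mod_self_left, Nat.mod_eq_of_lt ha]
  · rw [hz, Nat.add_mul_div_left _ _ (by omega), Nat.div_eq_of_lt ha, zero_add]
  · rw [coeff_divX]
    exact h3 _ (by omega)
  · conv_lhs => rw [← hP]
    simp only [map_add, map_mul, aeval_X, map_natCast, eq_natCast]
    simp [mul_comm, add_comm]

theorem IsPacked.cons {a : ℕ} (h : IsPacked θ B d s z x) :
    IsPacked θ B (d + 1) (a + s) (a + B * z) (a + θ * x) := by
  have h1 := (isPacked_root (θ := θ) (B := B)).mul h
  rw [one_mul] at h1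
  exact ((isPacked_natCast (θ := θ) (B := B) a).mono (by omega) le_rfl).add
    (h1.mono (by omega) le_rfl)

theorem IsPacked.split (m : ℕ) (h : IsPacked θ B d s z x) (hs : s < B) :
    ∃ s₀ s₁ x₀ x₁, s₀ + s₁ ≤ s ∧ z % B ^ m < B ^ m ∧ IsPacked θ B m s₀ (z % B ^ m) x₀ ∧
      IsPacked θ B (d - m) s₁ (z / B ^ m) x₁ ∧ x = x₀ + θ ^ m * x₁ := by
  have hB : 0 < B := by omega
  induction m generalizing d s z x with
  | zero => exact ⟨0, s, 0, x, by omega, by simp [Nat.mod_one],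
      by simpa [Nat.mod_one] using isPacked_zero, by simpa using h, by simp⟩
  | succ m ih =>
    obtain ⟨a, x', ha, has, h', rfl⟩ := h.exists_digit hs
    obtain ⟨s₀, s₁, x₀, x₁, h1, -, h2, h3, rfl⟩ := ih h' (by omega)
    refine ⟨a + s₀, s₁, a + θ * x₀, x₁, by omega, Nat.mod_lt _ (pow_pos hB _), ?_, ?_, ?_⟩
    · rw [pow_succ', Nat.mod_mul, ← ha]
      exact h2.cons
    · rw [pow_succ', ← Nat.div_div_eq_div_mul]
      exact h3.mono (by omega) le_rfl
    · ring

theorem IsPacked.foldPacked {D g σ : ℕ} (hg : IsPacked θ B D σ g (θ ^ D)) (hσ : 0 < σ) {m : ℕ}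
    (h : IsPacked θ B (D + m) s z x) (hs : s * σ ^ m < B) :
    IsPacked θ B D (s * σ ^ m) (foldPacked (B ^ D) g m z) x := by
  induction m generalizing s z x with
  | zero =>
    rw [pow_zero, mul_one]
    exact h
  | succ m ih =>
    rw [foldPacked_succ]
    have hle : s ≤ s * σ ^ (m + 1) := Nat.le_mul_of_pos_right _ (pow_pos hσ _)
    obtain ⟨s₀, s₁, x₀, x₁, h1, -, h2, h3, rfl⟩ := h.split D (hle.trans_lt hs)
    have h4 := (h2.mono (show D ≤ D + m by omega) le_rfl).add
      ((h3.mul hg).mono (show _ ≤ D + m by omega) le_rfl)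
    have h5 : s₀ + s₁ * σ ≤ s * σ :=
      calc s₀ + s₁ * σ ≤ s₀ * σ + s₁ * σ :=
            Nat.add_le_add_right (Nat.le_mul_of_pos_right _ hσ) _
        _ = (s₀ + s₁) * σ := by ring
        _ ≤ s * σ := Nat.mul_le_mul_right _ h1
    have h6 : s * σ * σ ^ m = s * σ ^ (m + 1) := by ring
    have h7 := ih (h4.mono le_rfl h5) (h6 ▸ hs)
    rw [h6, mul_comm x₁] at h7
    exact h7

theorem IsPacked.reducePacked {p : ℕ} (hp : (p : R) = 0) (hp0 : 0 < p)
    (h : IsPacked θ B d s z x) (hs : s < B) :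
    IsPacked θ B d (d * p) (reducePacked B p d z) x := by
  induction d generalizing s z x with
  | zero =>
    obtain ⟨P, -, -, h3, rfl⟩ := h
    have : P = 0 := ext fun i => h3 i (Nat.zero_le _)
    rw [this, map_zero]
    exact isPacked_zero
  | succ d ih =>
    obtain ⟨a, x', ha, has, h', rfl⟩ := h.exists_digit hs
    rw [reducePacked_succ, ← ha]
    have h1 : (a : R) = (a % p : ℕ) := by
      conv_lhs => rw [← Nat.mod_add_div a p]
      rw [Nat.cast_add, Nat.cast_mul, hp, zero_mul, add_zero]
    rw [h1]
    refine (ih h' (by omega)).cons.mono le_rfl ?_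
    have := Nat.mod_lt a hp0
    rw [Nat.succ_mul]
    omega

/-- The number encoding the polynomial with coefficient list `l`, lowest degree first. -/
def packList (B : ℕ) (l : List ℕ) : ℕ := l.foldr (fun a s => a + B * s) 0

/-- The value at `θ` of the polynomial with coefficient list `l`, lowest degree first. -/
def evalList (θ : R) (l : List ℕ) : R := l.foldr (fun (a : ℕ) s => (a : R) + θ * s) 0

theorem isPacked_packList (l : List ℕ) :
    IsPacked θ B l.length l.sum (packList B l) (evalList θ l) := by
  induction l with
  | nil => exact isPacked_zero
  | cons a l ih => exact ih.cons

end PackedArithmetic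

section PackedPrograms

variable (B T p d g : ℕ)

/-- The sum of two packed residues. -/
def addPacked (y z : ℕ) : ℕ := reducePacked B p d (y + z)

/-- The product of two packed residues. -/
def mulPacked (y z : ℕ) : ℕ := reducePacked B p d (foldPacked T g d (y * z))

/-- The power of a packed residue with exponent `e < 2 ^ fuel`. -/
def powPacked (z : ℕ) : ℕ → ℕ → ℕ
  | 0, _ => 1
  | fuel + 1, e =>
    if e = 0 then 1 else
      forceNat (powPacked z fuel (e / 2)) fun h => forceNat (mulPacked B T p d g h h) fun s =>
        if e % 2 = 0 then s else mulPacked B T p d g s z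

/-- The product of `w` with all `z ^ (m / r) - 1` for `r` in a list. -/
def orderProduct (m z : ℕ) : List ℕ → ℕ → ℕ
  | [], w => w
  | r :: l, w =>
    forceNat (m / r) fun e => forceNat (powPacked B T p d g z 64 e) fun y =>
      forceNat (addPacked B p d y (p - 1)) fun y => forceNat (mulPacked B T p d g w y) fun w =>
        orderProduct m z l w

/-- Passes the list of the `n` iterated `q`-th powers of `z` to `f`. -/
def withConjugates {β : Type} (q : ℕ) : ℕ → ℕ → (List ℕ → β) → β
  | 0, _, f => f []
  | n + 1, z, f =>
    forceNat (powPacked B T p d g z 64 q) fun y => withConjugates q n y fun l => f (z :: l)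

/-- Horner evaluation of a list of packed residues, highest degree first. -/
def hornerPacked (z : ℕ) : List ℕ → ℕ → ℕ
  | [], w => w
  | c :: l, w =>
    forceNat (mulPacked B T p d g w z) fun y => forceNat (addPacked B p d y c) fun y =>
      hornerPacked z l y

/-- The product of `w` with the values of a polynomial at `z`, `z * h`, …, `z * h ^ (n - 1)`. -/
def resolventProduct (h : ℕ) (l : List ℕ) : ℕ → ℕ → ℕ → ℕ
  | 0, _, w => w
  | n + 1, z, w =>
    forceNat (hornerPacked B T p d g z l 0) fun y => forceNat (mulPacked B T p d g w y) fun w =>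
      forceNat (mulPacked B T p d g z h) fun z => resolventProduct h l n z w

/-- The computational part of `certificateCheck`. -/
def residueCheck (n q m : ℕ) (P : List ℕ) : Bool :=
  forceNat (powPacked B T p d g B 64 (m - 1)) fun b =>
    forceNat (powPacked B T p d g B 64 (m / n)) fun h =>
      forceNat (orderProduct B T p d g m B P 1) fun w =>
        withConjugates B T p d g q n B fun l => withConjugates B T p d g q n b fun l' =>
          forceNat (resolventProduct B T p d g h l (n - 1) h w) fun w =>
            forceNat (resolventProduct B T p d g h l' (n - 1) h w) fun w =>
              Nat.beq (addPacked B p d (powPacked B T p d g B 64 m) (p - 1)) 0 &&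
                (Nat.beq (hornerPacked B T p d g 1 l 0) 0 &&
                  (Nat.beq (hornerPacked B T p d g 1 l' 0) 0 &&
                    Nat.beq (addPacked B p d (powPacked B T p d g w 64 m) (p - 1)) 0))

variable {B T p d g} {R : Type*} [CommRing R]

/-- The number `g` encodes the residue of the `d`-th power of `θ`, and `B` is large enough for
computations with packed residues modulo `p`. -/
structure IsPackedModulus (θ : R) (B p d g : ℕ) : Prop where
  exists_isPacked : ∃ σ, 0 < σ ∧ IsPacked θ B d σ g (θ ^ d) ∧ d * p * (d * p) * σ ^ d < B
  two_le : 2 ≤ d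
  pos : 0 < p
  cast_eq_zero : (p : R) = 0

namespace IsPackedModulus

variable {θ : R} {y z : ℕ} {u v : R}

theorem lt (H : IsPackedModulus θ B p d g) : d * p + d * p < B := by
  obtain ⟨σ, hσ, -, h⟩ := H.exists_isPacked
  refine lt_of_le_of_lt ?_ h
  have h2 : 2 ≤ d * p := H.two_le.trans (Nat.le_mul_of_pos_right d H.pos)
  calc d * p + d * p = 2 * (d * p) := by ring
    _ ≤ d * p * (d * p) := Nat.mul_le_mul_right _ h2
    _ ≤ _ := Nat.le_mul_of_pos_right _ (pow_pos hσ _)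

theorem add (H : IsPackedModulus θ B p d g)
    (hy : IsPacked θ B d (d * p) y u) (hz : IsPacked θ B d (d * p) z v) :
    IsPacked θ B d (d * p) (addPacked B p d y z) (u + v) :=
  (hy.add hz).reducePacked H.cast_eq_zero H.pos H.lt

theorem mul (H : IsPackedModulus θ B p d g)
    (hy : IsPacked θ B d (d * p) y u) (hz : IsPacked θ B d (d * p) z v) :
    IsPacked θ B d (d * p) (mulPacked B (B ^ d) p d g y z) (u * v) := by
  obtain ⟨σ, hσ, hg, h⟩ := H.exists_isPacked
  exact (IsPacked.foldPacked hg hσ ((hy.mul hz).mono (Nat.sub_le _ _) le_rfl) h).reducePacked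
    H.cast_eq_zero H.pos h

theorem natCast (H : IsPackedModulus θ B p d g)
    {a : ℕ} (ha : a ≤ p) : IsPacked θ B d (d * p) a (a : R) := by
  have := H.two_le
  exact (isPacked_natCast a).mono (by omega) (ha.trans (Nat.le_mul_of_pos_left p (by omega)))

theorem root (H : IsPackedModulus θ B p d g) : IsPacked θ B d (d * p) B θ := by
  have := H.two_le
  exact isPacked_root.mono this (by nlinarith [H.pos])

theorem one (H : IsPackedModulus θ B p d g) : IsPacked θ B d (d * p) 1 (1 : R) := by
  simpa using H.natCast (a := 1) H.pos

theorem sub_one (H : IsPackedModulus θ B p d g) (hz : IsPacked θ B d (d * p) z u) :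
    IsPacked θ B d (d * p) (addPacked B p d z (p - 1)) (u - 1) := by
  have h := H.add hz (H.natCast (Nat.sub_le p 1))
  rwa [Nat.cast_sub H.pos, H.cast_eq_zero, Nat.cast_one, zero_sub, ← sub_eq_add_neg] at h

theorem pow (H : IsPackedModulus θ B p d g)
    (hz : IsPacked θ B d (d * p) z u) {fuel e : ℕ} (he : e < 2 ^ fuel) :
    IsPacked θ B d (d * p) (powPacked B (B ^ d) p d g z fuel e) (u ^ e) := by
  induction fuel generalizing e with
  | zero =>
    obtain rfl : e = 0 := by simpa using he
    simpa [powPacked] using H.one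
  | succ fuel ih =>
    rw [powPacked]
    simp only [forceNat_eq]
    have h2 := ih (e := e / 2) (by rw [pow_succ] at he; omega)
    have h3 := H.mul h2 h2
    rw [← pow_add] at h3
    split_ifs with h0 h1
    · simpa [h0] using H.one
    · rwa [show e / 2 + e / 2 = e by omega] at h3
    · have h4 := H.mul h3 hz
      rwa [← pow_succ, show e / 2 + e / 2 + 1 = e by omega] at h4

theorem isPacked_orderProduct (H : IsPackedModulus θ B p d g)
    (hz : IsPacked θ B d (d * p) z u) {m : ℕ} (hm : m < 2 ^ 64) (P : List ℕ)
    {w : ℕ} {x : R} (hw : IsPacked θ B d (d * p) w x) :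
    IsPacked θ B d (d * p) (orderProduct B (B ^ d) p d g m z P w)
      (x * (P.map fun r => u ^ (m / r) - 1).prod) := by
  induction P generalizing w x with
  | nil => simpa [orderProduct] using hw
  | cons r P ih =>
    rw [orderProduct]
    simp only [forceNat_eq]
    have h := ih (H.mul hw (H.sub_one (H.pow hz ((Nat.div_le_self m r).trans_lt hm))))
    rwa [List.map_cons, List.prod_cons, ← mul_assoc]

theorem exists_withConjugates_eq (H : IsPackedModulus θ B p d g)
    (hz : IsPacked θ B d (d * p) z u) {q : ℕ} (hq : q < 2 ^ 64) (n : ℕ) :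
    ∃ l, (∀ {β : Type} (f : List ℕ → β), withConjugates B (B ^ d) p d g q n z f = f l) ∧
      List.Forall₂ (IsPacked θ B d (d * p)) l ((List.range n).map fun i => u ^ q ^ i) := by
  induction n generalizing z u with
  | zero => exact ⟨[], fun f => rfl, by simp⟩
  | succ n ih =>
    obtain ⟨l, h1, h2⟩ := ih (H.pow hz hq)
    refine ⟨z :: l, fun f => ?_, ?_⟩
    · rw [withConjugates]
      simp only [forceNat_eq]
      exact h1 _
    · rw [List.range_succ_eq_map, List.map_cons, List.map_map]
      refine List.Forall₂.cons (by simpa using hz) ?_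
      convert h2 using 3 with i
      simp [pow_succ', pow_mul]

theorem isPacked_hornerPacked (H : IsPackedModulus θ B p d g)
    (hz : IsPacked θ B d (d * p) z u) {l : List ℕ} {l' : List R}
    (hl : List.Forall₂ (IsPacked θ B d (d * p)) l l') {w : ℕ} {x : R}
    (hw : IsPacked θ B d (d * p) w x) :
    IsPacked θ B d (d * p) (hornerPacked B (B ^ d) p d g z l w)
      (l'.foldl (fun a c => a * u + c) x) := by
  induction hl generalizing w x with
  | nil => exact hw
  | cons hc _ ih =>
    rw [hornerPacked]
    simp only [forceNat_eq]
    exact ih (H.add (H.mul hw hz) hc)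

theorem isPacked_resolventProduct (H : IsPackedModulus θ B p d g)
    (hz : IsPacked θ B d (d * p) z u) {h : ℕ}
    (hh : IsPacked θ B d (d * p) h v) {l : List ℕ} {l' : List R}
    (hl : List.Forall₂ (IsPacked θ B d (d * p)) l l') (n : ℕ) {w : ℕ} {x : R}
    (hw : IsPacked θ B d (d * p) w x) :
    IsPacked θ B d (d * p) (resolventProduct B (B ^ d) p d g h l n z w)
      (x * ∏ j ∈ Finset.range n, l'.foldl (fun a c => a * (u * v ^ j) + c) 0) := by
  induction n generalizing z u w x with
  | zero => simpa [resolventProduct] using hw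
  | succ n ih =>
    rw [resolventProduct]
    simp only [forceNat_eq]
    have h1 := ih (H.mul hz hh) (H.mul hw (H.isPacked_hornerPacked hz hl isPacked_zero))
    rw [Finset.prod_range_succ', pow_zero, mul_one, mul_comm (∏ _ ∈ _, _), ← mul_assoc]
    convert h1 using 7
    ring

end IsPackedModulus

theorem foldl_horner (f : ℕ → R) (u : R) (n : ℕ) :
    ((List.range n).map f).foldl (fun a c => a * u + c) 0 =
      ∑ i ∈ Finset.range n, u ^ (n - 1 - i) * f i := by
  induction n with
  | zero => simp
  | succ n ih =>
    rw [List.range_succ, List.map_append, List.foldl_append, ih, Finset.sum_range_succ]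
    simp only [List.map_cons, List.map_nil, List.foldl_cons, List.foldl_nil, Nat.add_sub_cancel,
      Nat.sub_self, pow_zero, one_mul, Finset.sum_mul]
    congr 1
    refine Finset.sum_congr rfl fun i hi => ?_
    have := Finset.mem_range.1 hi
    rw [show n - i = n - 1 - i + 1 by omega, pow_succ]
    ring

/-- The properties of `θ` certified by `residueCheck`. -/
structure IsCertified (θ : R) (n q m : ℕ) (P : List ℕ) : Prop where
  pow_eq_one : θ ^ m = 1
  sum_eq_zero : ∑ i ∈ Finset.range n, θ ^ q ^ i = 0
  sum_pow_eq_zero : ∑ i ∈ Finset.range n, (θ ^ (m - 1)) ^ q ^ i = 0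
  prod_pow_eq_one : ((P.map fun r => θ ^ (m / r) - 1).prod *
      (∏ j ∈ Finset.range (n - 1), ∑ i ∈ Finset.range n,
        ((θ ^ (m / n)) ^ (j + 1)) ^ (n - 1 - i) * θ ^ q ^ i) *
      ∏ j ∈ Finset.range (n - 1), ∑ i ∈ Finset.range n,
        ((θ ^ (m / n)) ^ (j + 1)) ^ (n - 1 - i) * (θ ^ (m - 1)) ^ q ^ i) ^ m = 1

theorem IsPackedModulus.isCertified {θ : R} (H : IsPackedModulus θ B p d g) {n q m : ℕ}
    {P : List ℕ} (hq : q < 2 ^ 64) (hm : m < 2 ^ 64)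
    (h : residueCheck B (B ^ d) p d g n q m P = true) : IsCertified θ n q m P := by
  have hB : 0 < B := lt_of_le_of_lt (Nat.zero_le _) H.lt
  have hb := H.pow H.root (fuel := 64) (e := m - 1) (by omega)
  have hη := H.pow H.root (fuel := 64) (e := m / n) ((Nat.div_le_self m n).trans_lt hm)
  have hw := H.isPacked_orderProduct H.root hm P H.one
  obtain ⟨l, hl1, hl2⟩ := H.exists_withConjugates_eq H.root hq n
  obtain ⟨l', hl1', hl2'⟩ := H.exists_withConjugates_eq hb hq n
  have hw1 := H.isPacked_resolventProduct hη hη hl2 (n - 1) hw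
  have hw2 := H.isPacked_resolventProduct hη hη hl2' (n - 1) hw1
  have hend := H.sub_one (H.pow hw2 hm)
  have h1 := H.sub_one (H.pow H.root hm)
  have h2 := H.isPacked_hornerPacked H.one hl2 isPacked_zero
  have h3 := H.isPacked_hornerPacked H.one hl2' isPacked_zero
  rw [residueCheck] at h
  simp only [forceNat_eq, hl1, hl1', Bool.and_eq_true, Nat.beq_eq] at h
  obtain ⟨c1, c2, c3, c4⟩ := h
  rw [c1] at h1
  rw [c2] at h2
  rw [c3] at h3
  rw [c4] at hend
  have e1 := h1.eq_zero hB
  have e2 := h2.eq_zero hB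
  have e3 := h3.eq_zero hB
  have e4 := hend.eq_zero hB
  simp only [foldl_horner, one_pow, one_mul] at e2 e3
  simp only [foldl_horner, one_mul, ← pow_succ'] at e4
  exact ⟨sub_eq_zero.1 e1, e2, e3, sub_eq_zero.1 e4⟩

end PackedPrograms

section Certificates

/-- Trial division of a number below `2 ^ 20`. -/
def primeCheck (r : ℕ) : Bool :=
  decide (2 ≤ r ∧ r < 2 ^ 20) && smallPrimes.all fun s => r < s * s || r % s != 0

theorem prime_of_primeCheck {r : ℕ} (h : primeCheck r = true) : r.Prime := by
  simp only [primeCheck, Bool.and_eq_true, decide_eq_true_eq, List.all_eq_true, Bool.or_eq_true,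
    bne_iff_ne] at h
  obtain ⟨⟨h2, hlt⟩, h⟩ := h
  by_contra hr
  have hsq := Nat.minFac_sq_le_self (by omega) hr
  have hp := Nat.minFac_prime (show r ≠ 1 by omega)
  rcases h _ (mem_smallPrimes hp (by nlinarith)) with h1 | h1
  · nlinarith
  · exact h1 (Nat.mod_eq_zero_of_dvd (Nat.minFac_dvd r))

/-- Tests that a root `θ` of `X ^ g.length - g` modulo `p`, together with the prime divisors `P` of
`q ^ n - 1` for `q = p ^ e`, certifies a pair of primitive `1`-normal elements. -/
def certificateCheck (n p e : ℕ) (g P : List ℕ) : Bool :=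
  forceNat n fun n => forceNat p fun p => forceNat (p ^ e) fun q => forceNat (q ^ n - 1) fun m =>
    decide (2 ≤ g.length ∧ 0 < p ∧ 0 < e ∧ 0 < g.sum ∧ 0 < m ∧ q < 2 ^ 64 ∧ m < 2 ^ 64 ∧ n ∣ m ∧
      m ∣ P.prod ^ 64 ∧
      g.length * p * (g.length * p) * g.sum ^ g.length < 2 ^ 200) && (P.all primeCheck &&
    forceNat (2 ^ 200) fun B => forceNat g.length fun d => forceNat (B ^ d) fun T =>
      forceNat (packList B g) fun c => residueCheck B T p d c n q m P)

theorem isCertified_of_certificateCheck {n p e : ℕ} {g P : List ℕ}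
    (h : certificateCheck n p e g P = true) {R : Type*} [CommRing R] (hp : (p : R) = 0) {θ : R}
    (hθ : θ ^ g.length = evalList θ g) : IsCertified θ n (p ^ e) ((p ^ e) ^ n - 1) P := by
  simp only [certificateCheck, forceNat_eq, Bool.and_eq_true, decide_eq_true_eq] at h
  obtain ⟨⟨h1, h2, -, h3, -, h4, h5, -, -, h6⟩, -, h7⟩ := h
  exact IsPackedModulus.isCertified ⟨⟨_, h3, by rw [hθ]; exact isPacked_packList g, h6⟩, h1, h2, hp⟩
    h4 h5 h7

end Certificates

section Resolvents

variable {k F : Type*} [Field k] [Fintype k] [Field F] [Fintype F] [Algebra k F]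

variable (k) in
/-- The `F`-linear extension of the action of polynomials over `k` on `α`. -/
def frobeniusEval (α : F) : F[X] →ₗ[F] F :=
  Polynomial.lsum fun i => LinearMap.mulRight F (α ^ Fintype.card k ^ i)

theorem frobeniusEval_monomial {k F : Type*} [Fintype k] [Field F] (α : F) (i : ℕ) (c : F) :
    frobeniusEval k α (monomial i c) = c * α ^ Fintype.card k ^ i := by
  simp [frobeniusEval, Polynomial.lsum]

theorem frobeniusEval_map (α : F) (h : k[X]) : frobeniusEval k α (h.map (algebraMap k F)) =
    aeval (FiniteField.frobeniusAlgHom k F).toLinearMap h α := by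
  induction h using Polynomial.induction_on' with
  | add h₁ h₂ ih₁ ih₂ => rw [Polynomial.map_add, map_add, map_add, LinearMap.add_apply, ih₁, ih₂]
  | monomial i c =>
    rw [map_monomial, frobeniusEval_monomial, aeval_monomial, Module.End.mul_apply,
      frobenius_toLinearMap_pow_apply]
    simp [Algebra.smul_def]

theorem frobeniusEval_mul_map {α : F} {h : k[X]}
    (hα : aeval (FiniteField.frobeniusAlgHom k F).toLinearMap h α = 0) (V : F[X]) :
    frobeniusEval k α (V * h.map (algebraMap k F)) = 0 := by
  induction V using Polynomial.induction_on' with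
  | add V₁ V₂ ih₁ ih₂ => rw [add_mul, map_add, ih₁, ih₂, add_zero]
  | monomial i c =>
    have h1 : monomial i c * h.map (algebraMap k F) =
        c • (X ^ i * h).map (algebraMap k F) := by
      rw [← C_mul_X_pow_eq_monomial, smul_eq_C_mul, Polynomial.map_mul, Polynomial.map_pow, map_X,
        mul_assoc]
    rw [h1, map_smul, frobeniusEval_map, map_mul, Module.End.mul_apply, hα, map_zero, smul_zero]

/-- An element of trace zero all of whose other Lagrange resolvents are non-zero is `1`-normal. -/
theorem isKNormal_one_of_resolvent_ne_zero {n : ℕ} (hn : Module.finrank k F = n) {η α : F}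
    (hη : IsPrimitiveRoot η n) (htr : ∑ i ∈ Finset.range n, α ^ Fintype.card k ^ i = 0)
    (hres : ∀ j < n - 1, ∑ i ∈ Finset.range n,
      (η ^ (j + 1)) ^ (n - 1 - i) * α ^ Fintype.card k ^ i ≠ 0) :
    IsKNormal k (Fintype.card k) n 1 α := by
  classical
  subst hn
  set n := Module.finrank k F with hn
  refine isKNormal_one_of_forall_dvd ?_ fun h hd hα h0 => ?_
  · refine (algebraMap k F).injective ?_
    rw [FiniteField.algebraMap_trace_eq_sum_pow, Nat.card_eq_fintype_card, map_zero]
    exact htr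
  have hH0 : h.map (algebraMap k F) ≠ 0 :=
    (Polynomial.map_ne_zero_iff (algebraMap k F).injective).2 h0
  have hroot : ∀ j < n - 1, (h.map (algebraMap k F)).IsRoot (η ^ (j + 1)) := by
    intro j hj
    by_contra hne
    refine hres j hj ?_
    set ζ := η ^ (j + 1) with hζ
    obtain ⟨u, hu⟩ := hd
    have hU : (X ^ n - 1 : F[X]) = h.map (algebraMap k F) * u.map (algebraMap k F) := by
      rw [← Polynomial.map_mul, ← hu]
      simp [← hn]
    have hζn : ζ ^ n = 1 := by rw [hζ, ← pow_mul, mul_comm, pow_mul, hη.pow_eq_one, one_pow]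
    have hUζ : (u.map (algebraMap k F)).IsRoot ζ := by
      have h1 := congrArg (eval ζ) hU
      rw [eval_sub, eval_pow, eval_X, eval_one, hζn, sub_self, eval_mul] at h1
      exact (mul_eq_zero.1 h1.symm).resolve_left hne
    obtain ⟨V, hV⟩ := dvd_iff_isRoot.2 hUζ
    have hS : ∑ i ∈ Finset.range n, (X ^ i * C ζ ^ (n - 1 - i) : F[X]) =
        V * h.map (algebraMap k F) := by
      refine mul_right_cancel₀ (X_sub_C_ne_zero ζ) ?_
      rw [(Commute.all _ _).geom_sum₂_mul, ← C_pow, hζn, C_1, hU, hV]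
      ring
    have h2 := frobeniusEval_mul_map hα V
    rw [← hS, map_sum] at h2
    rw [← h2]
    refine Finset.sum_congr rfl fun i _ => ?_
    rw [← C_pow, mul_comm (X ^ i), C_mul_X_pow_eq_monomial, frobeniusEval_monomial]
  have hinj : Set.InjOn (fun j => η ^ (j + 1)) (Finset.range (n - 1) : Set ℕ) := by
    intro i hi j hj hij
    have hi' := Finset.mem_range.1 hi
    have hj' := Finset.mem_range.1 hj
    have := hη.pow_inj (by omega) (by omega) hij
    omega
  have hsub : ((Finset.range (n - 1)).image fun j => η ^ (j + 1)).val ⊆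
      (h.map (algebraMap k F)).roots := by
    intro x hx
    rw [Finset.mem_val, Finset.mem_image] at hx
    obtain ⟨j, hj, rfl⟩ := hx
    exact (mem_roots hH0).2 (hroot j (Finset.mem_range.1 hj))
  have hle := card_le_degree_of_subset_roots hsub
  rwa [Finset.card_image_of_injOn hinj, Finset.card_range, natDegree_map] at hle

end Resolvents

section CertifiedPairs

theorem map_evalList {R S : Type*} [CommRing R] [CommRing S] (f : R →+* S) (θ : R) (l : List ℕ) :
    f (evalList θ l) = evalList (f θ) l := by
  induction l with
  | nil => exact map_zero f
  | cons a l ih =>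
    change f (a + θ * evalList θ l) = a + f θ * evalList (f θ) l
    rw [map_add, map_natCast, map_mul, ih]

theorem degree_evalList_X_lt {R : Type*} [CommRing R] (l : List ℕ) :
    (evalList (X : R[X]) l).degree < l.length := by
  rw [degree_lt_iff_coeff_zero]
  induction l with
  | nil => intro i _; exact coeff_zero i
  | cons a l ih =>
    intro i hi
    change coeff ((a : R[X]) + X * evalList X l) i = 0
    rw [List.length_cons] at hi
    obtain ⟨i, rfl⟩ := Nat.exists_eq_add_of_le' (show 1 ≤ i by omega)
    rw [coeff_add, coeff_X_mul, ih i (by omega), add_zero, ← C_eq_natCast,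
      coeff_C_of_ne_zero (by omega)]

variable {k F : Type*} [Field k] [Fintype k] [Field F] [Fintype F] [Algebra k F]

theorem hasPrimitiveOneNormalPair_of_isCertified {n m : ℕ} {P : List ℕ}
    (hn : Module.finrank k F = n) (hm : Fintype.card F - 1 = m) (hnm : n ∣ m)
    (hP : ∀ r, r.Prime → r ∣ m → r ∈ P) {α : F}
    (hα : IsCertified α n (Fintype.card k) m P) : HasPrimitiveOneNormalPair k F := by
  have hm0 : 0 < m := by
    have : 1 < Fintype.card F := Fintype.one_lt_card
    omega
  have hα0 : α ≠ 0 := by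
    rintro rfl
    exact zero_ne_one ((zero_pow hm0.ne').symm.trans hα.pow_eq_one)
  have hne : (P.map fun r => α ^ (m / r) - 1).prod *
      (∏ j ∈ Finset.range (n - 1), ∑ i ∈ Finset.range n,
        ((α ^ (m / n)) ^ (j + 1)) ^ (n - 1 - i) * α ^ Fintype.card k ^ i) *
      ∏ j ∈ Finset.range (n - 1), ∑ i ∈ Finset.range n,
        ((α ^ (m / n)) ^ (j + 1)) ^ (n - 1 - i) * (α ^ (m - 1)) ^ Fintype.card k ^ i ≠ 0 := by
    intro h0
    have := hα.prod_pow_eq_one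
    rw [h0, zero_pow hm0.ne'] at this
    exact zero_ne_one this
  have hord : orderOf α = m := by
    refine orderOf_eq_of_pow_and_pow_div_prime hm0 hα.pow_eq_one fun r hr hrm h1 => ?_
    refine left_ne_zero_of_mul (left_ne_zero_of_mul hne) (List.prod_eq_zero ?_)
    exact List.mem_map.2 ⟨r, hP r hr hrm, by rw [h1, sub_self]⟩
  have hinv : α⁻¹ = α ^ (m - 1) := by
    refine inv_eq_of_mul_eq_one_left ?_
    rw [← pow_succ, Nat.sub_add_cancel hm0, hα.pow_eq_one]
  have hη : IsPrimitiveRoot (α ^ (m / n)) n :=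
    (hord ▸ IsPrimitiveRoot.orderOf α).pow hm0 (Nat.div_mul_cancel hnm).symm
  refine ⟨α, hα0, hord.trans hm.symm, ((orderOf_inv_of_ne_zero hα0).trans hord).trans hm.symm,
    ?_, ?_⟩
  · rw [hn]
    refine isKNormal_one_of_resolvent_ne_zero hn hη hα.sum_eq_zero fun j hj => ?_
    exact Finset.prod_ne_zero_iff.1 (right_ne_zero_of_mul (left_ne_zero_of_mul hne)) j
      (Finset.mem_range.2 hj)
  · rw [hn, hinv]
    refine isKNormal_one_of_resolvent_ne_zero hn hη hα.sum_pow_eq_zero fun j hj => ?_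
    exact Finset.prod_ne_zero_iff.1 (right_ne_zero_of_mul hne) j (Finset.mem_range.2 hj)

theorem hasPrimitiveOneNormalPair_of_certificateCheck {n p e : ℕ} {g P : List ℕ}
    (hq : Fintype.card k = p ^ e) (hn : Module.finrank k F = n)
    (h : certificateCheck n p e g P = true) : HasPrimitiveOneNormalPair k F := by
  have hcert := h
  simp only [certificateCheck, forceNat_eq, Bool.and_eq_true, decide_eq_true_eq] at h
  obtain ⟨⟨hg, -, he, -, hm0, -, -, hnm, hmP, -⟩, hP, -⟩ := h
  have hF : Fintype.card F = (p ^ e) ^ n := by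
    rw [Module.card_eq_pow_finrank (K := k), hq, hn]
  have hp : (p : F) = 0 := by
    have h1 : ((p ^ e : ℕ) : k) = 0 := by rw [← hq]; exact Nat.cast_card_eq_zero k
    rw [Nat.cast_pow] at h1
    have h2 : (p : k) = 0 := pow_eq_zero_iff he.ne' |>.1 h1
    rw [← map_natCast (algebraMap k F), h2, map_zero]
  set f : F[X] := X ^ g.length - evalList X g with hf
  have hdeg : f.degree = g.length := by
    rw [hf, degree_sub_eq_left_of_degree_lt, degree_X_pow]
    rw [degree_X_pow]
    exact degree_evalList_X_lt g
  obtain ⟨α, hα⟩ : ∃ α : F, α ^ g.length = evalList α g := by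
    have h1 := isCertified_of_certificateCheck hcert (R := AdjoinRoot f) (θ := AdjoinRoot.root f)
      (by rw [← map_natCast (AdjoinRoot.of f), hp, map_zero]) (by
        rw [← sub_eq_zero, ← AdjoinRoot.mk_X, ← map_evalList, ← map_pow, ← map_sub]
        exact AdjoinRoot.mk_self)
    have h2 : f ∣ X ^ ((p ^ e) ^ n - 1) - 1 := by
      rw [← AdjoinRoot.mk_eq_zero, map_sub, map_pow, AdjoinRoot.mk_X, h1.pow_eq_one, map_one,
        sub_self]
    have h3 : f ∣ X ^ Fintype.card F - X := by
      refine h2.trans ⟨X, ?_⟩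
      rw [sub_mul, one_mul, ← pow_succ, hF, Nat.sub_add_cancel (by omega)]
    have h4 : (X ^ Fintype.card F - X : F[X]).Splits := by
      rw [splits_iff_card_roots, FiniteField.roots_X_pow_card_sub_X,
        FiniteField.X_pow_card_sub_X_natDegree_eq F Fintype.one_lt_card]
      rfl
    obtain ⟨α, hα⟩ := (h4.of_dvd (FiniteField.X_pow_card_sub_X_ne_zero F Fintype.one_lt_card)
      h3).exists_eval_eq_zero (by
        rw [hdeg]
        exact_mod_cast (show g.length ≠ 0 by omega))
    refine ⟨α, sub_eq_zero.1 ?_⟩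
    rw [← hα, hf, eval_sub, eval_pow, eval_X, ← coe_evalRingHom, map_evalList, coe_evalRingHom,
      eval_X]
  refine hasPrimitiveOneNormalPair_of_isCertified hn (by rw [hF]) hnm (fun r hr hrm => ?_)
    (by rw [hq]; exact isCertified_of_certificateCheck hcert hp hα)
  have h1 := (hr.prime.dvd_of_dvd_pow (hrm.trans hmP))
  obtain ⟨s, hs, hrs⟩ := (hr.prime.dvd_prod_iff).1 h1
  rw [(Nat.prime_dvd_prime_iff_eq hr (prime_of_primeCheck (List.all_eq_true.1 hP s hs))).1 hrs]
  exact hs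

end CertifiedPairs

section ExceptionalCases

/-- Certificates for the exceptional cases, each consisting of the extension degree `n`, the base
field cardinality `p ^ e`, the polynomial expressing the highest power of a generator, and the prime
divisors of the order of the multiplicative group. -/
def certificates : List (ℕ × ℕ × ℕ × List ℕ × List ℕ) :=
  [ (6, 37, 1, [2, 0, 0, 2, 2, 0], [2, 3, 7, 19, 31, 43, 67]),
    (6, 41, 1, [7, 0, 2, 2, 0, 0], [2, 3, 5, 7, 547, 1723]),
    (6, 43, 1, [9, 0, 4, 5, 4, 0], [2, 3, 7, 11, 13, 139, 631]),
    (6, 47, 1, [2, 0, 3, 3, 2, 0], [2, 3, 7, 23, 37, 61, 103]),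
    (6, 7, 2, [4, 0, 0, 2, 3, 2, 5, 4, 6, 1, 4, 0], [2, 3, 5, 13, 19, 43, 181]),
    (6, 53, 1, [2, 0, 2, 2, 0, 0], [2, 3, 7, 13, 409, 919]),
    (6, 59, 1, [3, 0, 1, 2, 0, 0], [2, 3, 5, 7, 29, 163, 3541]),
    (6, 61, 1, [2, 0, 1, 1, 0, 0], [2, 3, 5, 7, 13, 31, 97, 523]),
    (6, 67, 1, [4, 0, 2, 3, 1, 0], [2, 3, 7, 11, 17, 31, 4423]),
    (6, 71, 1, [2, 0, 2, 3, 3, 0], [2, 3, 5, 7, 1657, 5113]),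
    (6, 73, 1, [5, 0, 4, 3, 3, 0], [2, 3, 7, 37, 751, 1801]),
    (6, 79, 1, [2, 0, 2, 1, 0, 0], [2, 3, 5, 7, 13, 43, 6163]),
    (6, 83, 1, [3, 0, 2, 2, 0, 0], [2, 3, 7, 19, 41, 367, 2269]),
    (6, 89, 1, [3, 0, 1, 1, 3, 0], [2, 3, 5, 7, 11, 373, 8011]),
    (6, 97, 1, [5, 0, 4, 3, 1, 0], [2, 3, 7, 67, 139, 3169]),
    (6, 101, 1, [2, 0, 2, 1, 1, 0], [2, 3, 5, 7, 13, 17, 37, 10303]),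
    (6, 103, 1, [2, 0, 1, 1, 1, 0], [2, 3, 7, 13, 17, 19, 79, 3571]),
    (6, 107, 1, [3, 0, 2, 1, 1, 0], [2, 3, 7, 13, 19, 53, 127, 199]),
    (6, 109, 1, [6, 0, 1, 1, 0, 0], [2, 3, 5, 7, 11, 61, 193, 571]),
    (6, 113, 1, [3, 0, 3, 1, 1, 0], [2, 3, 7, 13, 19, 991, 4219]),
    (6, 11, 2, [4, 0, 1, 7, 6, 4, 1, 7, 2, 0, 1, 0], [2, 3, 5, 7, 13, 19, 37, 61, 1117]),
    (6, 5, 3, [2, 0, 4, 3, 4, 3, 1, 4, 3, 3, 3, 0, 0, 0, 2, 3, 4, 0],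
      [2, 3, 7, 19, 31, 829, 5167]),
    (6, 131, 1, [3, 0, 1, 2, 1, 0], [2, 3, 5, 7, 11, 13, 811, 17293]),
    (6, 137, 1, [3, 0, 1, 1, 2, 0], [2, 3, 7, 17, 23, 37, 73, 6211]),
    (6, 139, 1, [4, 0, 4, 1, 3, 0], [2, 3, 5, 7, 13, 23, 499, 19183]),
    (6, 149, 1, [2, 0, 2, 3, 3, 0], [2, 3, 5, 7, 31, 37, 103, 7351]),
    (6, 151, 1, [5, 0, 3, 4, 5, 0], [2, 3, 5, 7, 19, 1093, 22651]),
    (6, 163, 1, [4, 0, 2, 2, 3, 0], [2, 3, 7, 19, 41, 67, 26407]),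
    (6, 13, 2, [6, 0, 3, 1, 10, 0, 5, 5, 5, 12, 7, 0], [2, 3, 5, 7, 17, 61, 157, 28393]),
    (6, 173, 1, [2, 0, 2, 1, 0, 0], [2, 3, 7, 13, 29, 43, 109, 30103]),
    (6, 179, 1, [3, 0, 0, 2, 4, 0], [2, 3, 5, 7, 13, 19, 43, 89, 4603]),
    (6, 181, 1, [2, 0, 0, 1, 3, 0], [2, 3, 5, 7, 13, 31, 79, 139, 1051]),
    (6, 199, 1, [2, 0, 1, 2, 1, 0], [2, 3, 5, 7, 11, 13, 433, 13267]),
    (6, 229, 1, [6, 0, 3, 5, 1, 0], [2, 3, 5, 7, 19, 23, 97, 181, 7459]),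
    (8, 17, 1, [3, 0, 7, 8, 2, 8, 6, 0], [2, 3, 5, 29, 41761]),
    (8, 19, 1, [4, 0, 4, 0, 2, 3, 4, 0], [2, 3, 5, 17, 181, 3833]),
    (8, 23, 1, [3, 0, 1, 0, 0, 3, 1, 0], [2, 3, 5, 11, 53, 139921])]

set_option maxHeartbeats 4000000 in
set_option maxRecDepth 100000 in
theorem certificateCheck_of_mem : ∀ c ∈ certificates,
    certificateCheck c.1 c.2.1 c.2.2.1 c.2.2.2.1 c.2.2.2.2 = true := by
  simp only [certificates, List.forall_mem_cons, List.not_mem_nil, false_imp_iff, imp_true_iff,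
    and_true]
  and_intros <;> decide +kernel

theorem exists_certificate {n q : ℕ} (h : q ∈ exceptionalCard n) :
    ∃ c ∈ certificates, c.1 = n ∧ c.2.1 ^ c.2.2.1 = q := by
  have hcheck : ∀ n ∈ [6, 8], ∀ q ∈ exceptionalCard n,
      (certificates.any fun c => c.1 == n && c.2.1 ^ c.2.2.1 == q) = true := by decide +kernel
  have hn : n ∈ [6, 8] := by
    unfold exceptionalCard at h
    split at h <;> simp_all
  obtain ⟨c, hc, hcn⟩ := List.any_eq_true.1 (hcheck n hn q h)
  simp only [Bool.and_eq_true, beq_iff_eq] at hcn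
  exact ⟨c, hc, hcn⟩

theorem hasPrimitiveOneNormalPair_of_mem_exceptionalCard {k F : Type*} [Field k] [Fintype k]
    [Field F] [Fintype F] [Algebra k F] {q n : ℕ} (hq : Fintype.card k = q)
    (hn : Module.finrank k F = n) (h : q ∈ exceptionalCard n) : HasPrimitiveOneNormalPair k F := by
  obtain ⟨c, hc, rfl, rfl⟩ := exists_certificate h
  exact hasPrimitiveOneNormalPair_of_certificateCheck hq hn (certificateCheck_of_mem c hc)

end ExceptionalCases

/-- The weakest form of the hypothesis, with `l = 0` and `d = 1`, in integer arithmetic. -/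
theorem sizeCondition_of_lt_rpow {q n t : ℕ} (hq : 2 * n ≤ q) (hn : 0 < n)
    (ht : t = if Nat.gcd q n = 1 then 2 else 3) {W l S : ℝ} (hW : 1 ≤ W) (hl : 0 ≤ l) (hS : 0 ≤ S)
    (hpos : 0 < 1 - S - (2 * (n : ℝ) - 1) / q)
    (h : 2 * W * ((l + 2 * n - 2) / (1 - S - (2 * (n : ℝ) - 1) / q) + 2) <
      (q : ℝ) ^ ((n : ℝ) / 2 - t)) : sizeCondition n q = true := by
  have hq0 : (0 : ℝ) < q := by
    have : 0 < q := by omega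
    exact_mod_cast this
  have hn1 : (1 : ℝ) ≤ n := by exact_mod_cast hn
  set D : ℝ := q + 1 - 2 * n with hD
  have hDq : D / q = 1 - (2 * (n : ℝ) - 1) / q := by
    rw [hD]
    field_simp
    ring
  have hDpos : 0 < D / q := by rw [hDq]; linarith
  have hD0 : 0 < D := by
    have := mul_pos hDpos hq0
    rwa [div_mul_cancel₀ _ hq0.ne'] at this
  have h1 : 2 * ((2 * (n : ℝ) - 2) * q + 2 * D) / D < (q : ℝ) ^ ((n : ℝ) / 2 - t) := by
    refine lt_of_le_of_lt ?_ h
    have e1 : 2 * ((2 * (n : ℝ) - 2) * q + 2 * D) / D =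
        2 * 1 * ((0 + 2 * n - 2) / (D / q) + 2) := by
      field_simp
      ring
    rw [e1]
    have e2 : 1 - S - (2 * (n : ℝ) - 1) / q ≤ D / q := by rw [hDq]; linarith
    have e3 : 0 ≤ 0 + 2 * (n : ℝ) - 2 := by linarith
    have e4 : 0 ≤ l + 2 * (n : ℝ) - 2 := by linarith
    gcongr
  have h2 : 0 ≤ 2 * ((2 * (n : ℝ) - 2) * q + 2 * D) := by
    have : 0 ≤ (2 * (n : ℝ) - 2) * q := mul_nonneg (by linarith) hq0.le
    linarith
  rw [div_lt_iff₀ hD0] at h1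
  have h3 := pow_lt_pow_left₀ h1 h2 two_ne_zero
  have h4 : ((q : ℝ) ^ ((n : ℝ) / 2 - t)) ^ 2 * (q : ℝ) ^ (2 * t) = (q : ℝ) ^ n := by
    rw [← Real.rpow_natCast, ← Real.rpow_natCast, ← Real.rpow_natCast, ← Real.rpow_mul hq0.le,
      ← Real.rpow_add hq0]
    congr 1
    push_cast
    ring
  have h5 : (q : ℝ) ^ (2 * t) * (2 * ((2 * (n : ℝ) - 2) * q + 2 * D)) ^ 2 < q ^ n * D ^ 2 := by
    calc _ < (q : ℝ) ^ (2 * t) * ((q : ℝ) ^ ((n : ℝ) / 2 - t) * D) ^ 2 := by gcongr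
      _ = _ := by rw [← h4]; ring
  rw [sizeCondition, decide_eq_true_eq, ← ht]
  have c1 : ((2 * n - 2 : ℕ) : ℝ) = 2 * n - 2 := by
    rw [Nat.cast_sub (by omega)]
    push_cast
    ring
  have c2 : ((q + 1 - 2 * n : ℕ) : ℝ) = D := by
    rw [Nat.cast_sub (by omega)]
    push_cast
    ring
  rw [← c1, ← c2] at h5
  exact_mod_cast h5

/-- `W(d)` is positive. -/
theorem one_le_Wnat {d : ℕ} (hd : d ≠ 0) : 1 ≤ Wnat d :=
  Finset.card_pos.2 ⟨1, Finset.mem_filter.2 ⟨Nat.one_mem_divisors.2 hd, squarefree_one⟩⟩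

/-- Criterion of Lemma 5.4: let `d ∣ q^n − 1`, suppose every prime divisor of
`(q^n−1)/d` coprime to `d` is `≡ 1 (mod n₀)`, and let `p 0, …, p (l-1)` be the first
`l` primes `≡ 1 (mod n₀)`, with product at most `(q^n−1)/d`. If
`1 − S_l − (2n−1)/q > 0` and `q^{n/2−ϑ} > 2·W(d)·((l+2n−2)/(1−S_l−(2n−1)/q) + 2)`,
then `F_{q^n}` contains a pair `(α, α⁻¹)` of primitive `1`-normal elements. -/
theorem exists_primitive_one_normal_pair_of_prime_sieve
    (q n : ℕ) (hq : IsPrimePow q) (hn : 0 < n)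
    (Fq F : Type*) [Field Fq] [Field F] [Fintype Fq] [Fintype F] [Algebra Fq F]
    (hcard : Fintype.card Fq = q) (hdim : Module.finrank Fq F = n)
    (d : ℕ) (hd : d ∣ q ^ n - 1) (n₀ : ℕ) (hn₀ : 0 < n₀)
    (hall : ∀ p₀ : ℕ, p₀.Prime → p₀ ∣ (q ^ n - 1) / d → Nat.Coprime p₀ d →
      p₀ ≡ 1 [MOD n₀])
    (l : ℕ) (p : Fin l → ℕ)
    (hp : ∀ i, (p i).Prime ∧ p i ≡ 1 [MOD n₀]) (hmono : StrictMono p)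
    (hfirst : ∀ m : ℕ, m.Prime → m ≡ 1 [MOD n₀] → (∀ j, p j ≠ m) → ∀ i, p i < m)
    (hprod : ∏ i, p i ≤ (q ^ n - 1) / d)
    (hDpos : (0 : ℝ) < 1 - (∑ i, (1 : ℝ) / (p i : ℝ)) - (2 * (n : ℝ) - 1) / (q : ℝ))
    (hineq : (q : ℝ) ^ ((n : ℝ) / 2 - (if Nat.gcd q n = 1 then 2 else 3 : ℕ)) >
      2 * (Wnat d : ℝ) *
        (((l : ℝ) + 2 * (n : ℝ) - 2) /
            (1 - (∑ i, (1 : ℝ) / (p i : ℝ)) - (2 * (n : ℝ) - 1) / (q : ℝ)) + 2)) :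
    ∃ α : F, α ≠ 0 ∧ orderOf α = q ^ n - 1 ∧ orderOf α⁻¹ = q ^ n - 1 ∧
      IsKNormal Fq q n 1 α ∧ IsKNormal Fq q n 1 α⁻¹ := by
  have hq1 : 1 < q := hq.one_lt
  have hd0 : d ≠ 0 := by
    rintro rfl
    have h1 := Nat.one_lt_pow hn.ne' hq1
    have h2 := Nat.eq_zero_of_zero_dvd hd
    omega
  have hS : (0 : ℝ) ≤ ∑ i, (1 : ℝ) / (p i : ℝ) := Finset.sum_nonneg fun i _ => by positivity
  have hq0 : (0 : ℝ) < q := by exact_mod_cast (show 0 < q by omega)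
  have hqn : 2 * n ≤ q := by
    have h1 : (2 * (n : ℝ) - 1) / q < 1 := by linarith
    rw [div_lt_one hq0] at h1
    have h2 : 2 * (n : ℝ) < q + 1 := by linarith
    have h3 : 2 * n < q + 1 := by exact_mod_cast h2
    omega
  have hsize : sizeCondition n q = true := sizeCondition_of_lt_rpow hqn hn rfl
    (by exact_mod_cast one_le_Wnat hd0) (Nat.cast_nonneg l) hS hDpos hineq
  have hpair : HasPrimitiveOneNormalPair Fq F := by
    by_cases hexc : q ∈ exceptionalCard n
    · exact hasPrimitiveOneNormalPair_of_mem_exceptionalCard hcard hdim hexc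
    · exact hasPrimitiveOneNormalPair_of_sizeCondition hcard hdim hqn hn hsize hexc
  rw [HasPrimitiveOneNormalPair, Module.card_eq_pow_finrank (K := Fq), hcard, hdim] at hpair
  exact hpair

end
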